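/- Let X ⊂ int(𝔸) be an f-invariant essential annular continuum. Assume there exists ρ < 0 such that for all points x, y ∈ X̃ accessible from Ũ₊ one has k(f̃ⁿ(x), y)/n → ρ as n → ∞, and assume inf ρ_mes(f̃, X) > 0. Suppose x ∈ X̃ is accessible from V + k₁ and f̃⁻¹(x) is accessible from V + k₂. Then for every point z ∈ X̃ accessible from Ũ₊ there exist an integer n and an integer j with k₁ ≤ j ≤ k₂ such that f̃ⁿ(z) is accessible from V + j. -/

import Mathlib

open Set Function MeasureTheory Filter Topology

noncomputable section

/-- The vertical fiber `[-1,1]`. -/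
abbrev II : Set ℝ := Set.Icc (-1 : ℝ) 1

/-- The universal cover `ℝ × [-1,1]` of the annulus. -/
abbrev Strip : Type := ℝ × II

/-- The compact annulus `(ℝ/ℤ) × [-1,1]`. -/
abbrev Ann : Type := AddCircle (1 : ℝ) × II

/-- The covering projection `π`. -/
def pr (z : Strip) : Ann := ((z.1 : AddCircle (1 : ℝ)), z.2)

/-- The deck transformation `T^k`. -/
def shiftPt (k : ℤ) (z : Strip) : Strip := (z.1 + k, z.2)

/-- `S + k`, the image of `S` under `T^k`. -/
def shiftSet (k : ℤ) (S : Set Strip) : Set Strip := shiftPt k '' S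

/-- `f` is isotopic to the identity. -/
def IsotopicToId (f : Ann → Ann) : Prop :=
  ∃ H : ℝ → Ann → Ann, Continuous (fun p : ℝ × Ann => H p.1 p.2) ∧
    (∀ t : ℝ, Function.Bijective (H t)) ∧ H 0 = id ∧ H 1 = f

/-- `F` is a lift of `f` commuting with the deck transformation. -/
def IsLift (f : Ann → Ann) (F : Strip → Strip) : Prop :=
  (∀ z, pr (F z) = f (pr z)) ∧ (∀ z, F (shiftPt 1 z) = shiftPt 1 (F z))

/-- `X` is an essential annular continuum with complementary components `Um`, `Up`. -/
structure IsEAC (X Um Up : Set Ann) : Prop where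
  compact : IsCompact X
  connected : IsConnected X
  inInterior : ∀ p ∈ X, ((p.2 : ℝ)) ∈ Set.Ioo (-1 : ℝ) 1
  hUm : Um = connectedComponentIn Xᶜ ((0 : AddCircle (1 : ℝ)), ⟨-1, le_rfl, by norm_num⟩)
  hUp : Up = connectedComponentIn Xᶜ ((0 : AddCircle (1 : ℝ)), ⟨1, by norm_num, le_rfl⟩)
  cover : Xᶜ = Um ∪ Up
  ne : Um ≠ Up

/-- An arc `γ : [0,1] → U ∪ {p}` with `γ([0,1)) ⊂ U` and `γ(1) = p`. -/
def IsArcTo (U : Set Strip) (γ : unitInterval → Strip) (p : Strip) : Prop :=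
  Continuous γ ∧ Function.Injective γ ∧ (∀ t, t ≠ 1 → γ t ∈ U) ∧ γ 1 = p

/-- `p` is accessible from `U`. -/
def AccFrom (U : Set Strip) (p : Strip) : Prop := ∃ γ, IsArcTo U γ p

/-- The order `≺` on accessible points, with access arcs starting on `ℝ × {b}`. -/
def PrecB (b : ℝ) (U : Set Strip) (x x' : Strip) : Prop :=
  ∃ γ γ' : unitInterval → Strip,
    IsArcTo U γ x ∧ IsArcTo U γ' x' ∧
    ((γ 0).2 : ℝ) = b ∧ ((γ' 0).2 : ℝ) = b ∧
    Disjoint (range γ) (range γ') ∧ (γ 0).1 < (γ' 0).1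

/-- `k = k(x,y)` is the unique integer with `T^k(y) ⪯ x ≺ T^{k+1}(y)`. -/
def AccIdxB (b : ℝ) (U : Set Strip) (x y : Strip) (k : ℤ) : Prop :=
  (shiftPt k y = x ∨ PrecB b U (shiftPt k y) x) ∧ PrecB b U x (shiftPt (k + 1) y)

/-- `ρ` is the prime end rotation number of the lift `F` as seen from `U`
(access arcs starting at height `b`): `k(Fⁿ(x), y)/n → ρ` for all accessible `x, y`. -/
def PrimeEndRotB (b : ℝ) (U Xt : Set Strip) (F : Strip → Strip) (ρ : ℝ) : Prop :=
  ∀ x ∈ Xt, ∀ y ∈ Xt, AccFrom U x → AccFrom U y →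
    ∀ k : ℕ → ℤ, (∀ n : ℕ, AccIdxB b U (F^[n] x) y (k n)) →
      Tendsto (fun n : ℕ => (k n : ℝ) / (n : ℝ)) atTop (𝓝 ρ)

/-- The measure-theoretic rotation set `ρ_mes(g̃, X)`, where `φ` is the displacement
function of the lift `g̃` (pushed down to the annulus). -/
def rotMes (g : Ann → Ann) (φ : Ann → ℝ) (X : Set Ann) : Set ℝ :=
  {r | ∃ μ : Measure Ann, IsProbabilityMeasure μ ∧ Measure.map g μ = μ ∧
    μ Xᶜ = 0 ∧ ∫ a, φ a ∂μ = r}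

/-- A point in the interior of the top boundary segment `(0,1) × {1}`. -/
def topSeg : Strip := ((1 : ℝ) / 2, ⟨1, by norm_num, le_rfl⟩)

/-- `β' = β ∖ {x₀} = {0} × (η, 1]`. -/
def betaP (η : ℝ) : Set Strip := {z : Strip | z.1 = 0 ∧ η < (z.2 : ℝ)}

/-- `η = max{y : (0,y) ∈ X̃}`. -/
def etaSpec (Xt : Set Strip) (η : ℝ) : Prop :=
  IsGreatest {y : ℝ | ∃ z ∈ Xt, z.1 = 0 ∧ (z.2 : ℝ) = y} η

/-- The fundamental region `V`: the closure, relative to `Ũ₊`, of the connected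
component of `Ũ₊ ∖ (β' ∪ (β' + 1))` containing the segment `(0,1) × {1}`. -/
def Vset (Utp : Set Strip) (η : ℝ) : Set Strip :=
  Utp ∩ closure (connectedComponentIn (Utp \ (betaP η ∪ shiftSet 1 (betaP η))) topSeg)

/-- A hair of `W`: an arc in `W` starting on `ℝ × {1}`. -/
def IsHair (W : Set Strip) (γ : unitInterval → Strip) : Prop :=
  Continuous γ ∧ Function.Injective γ ∧ ((γ 0).2 : ℝ) = 1 ∧ ∀ t, γ t ∈ W

/-- `(γ)₁`, the projection of the image of `γ` to the first coordinate. -/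
def proj1 (γ : unitInterval → Strip) : Set ℝ := range fun t => (γ t).1

/-- `(V + k)⁻ = ⋃_{j ≤ k} (V + j)`. -/
def VMinus (k : ℤ) (V : Set Strip) : Set Strip := ⋃ j ∈ Iic k, shiftSet j V

/-- `(V + k)⁺ = ⋃_{j ≥ k} (V + j)`. -/
def VPlus (k : ℤ) (V : Set Strip) : Set Strip := ⋃ j ∈ Ici k, shiftSet j V

/-- A crosscut of `Ũ₊`: an arc with endpoints on `X̃` and interior in `Ũ₊`. -/
def IsCrosscut (Utp Xt : Set Strip) (c : unitInterval → Strip) : Prop :=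
  Continuous c ∧ Function.Injective c ∧ c 0 ∈ Xt ∧ c 1 ∈ Xt ∧
    ∀ t, t ≠ 0 → t ≠ 1 → c t ∈ Utp

/-- `F^n` for `n : ℤ`. -/
def iterZ (F : Strip ≃ₜ Strip) (n : ℤ) : Strip → Strip := fun z => (F.toEquiv ^ n) z

end


open Set Function MeasureTheory Filter Topology

namespace OAB

open Complex

lemma exp_eq_close {u v : ℂ} (h : exp u = exp v) (hd : ‖u - v‖ < 2 * Real.pi) : u = v := by
  obtain ⟨n, hn⟩ := Complex.exp_eq_exp_iff_exists_int.1 h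
  have : u - v = n * (2 * Real.pi * I) := by rw [hn]; ring
  rw [this] at hd
  have h2 : ‖(n : ℂ) * (2 * Real.pi * I)‖ = |(n : ℝ)| * (2 * Real.pi) := by
    simp [abs_of_pos Real.pi_pos]
  rw [h2] at hd
  have hn0 : |(n : ℝ)| < 1 := by
    by_contra hc
    push Not at hc
    nlinarith [Real.pi_pos]
  have : n = 0 := by
    have : |n| < 1 := by exact_mod_cast hn0
    exact Int.abs_lt_one_iff.1 this
  simp [hn, this]

/-- continuous functions with the same exponential: they agree eventually near a point where
they agree -/
lemma eventually_eq_of_exp {Y : Type*} [TopologicalSpace Y] {l : Filter Y} {f g : Y → ℂ} {a b : ℂ}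
    (hf : Tendsto f l (𝓝 a)) (hg : Tendsto g l (𝓝 b)) (hab : ‖a - b‖ < 2 * Real.pi)
    (he : ∀ᶠ y in l, exp (f y) = exp (g y)) : ∀ᶠ y in l, f y = g y := by
  have : Tendsto (fun y => ‖f y - g y‖) l (𝓝 ‖a - b‖) := (hf.sub hg).norm
  filter_upwards [he, this.eventually (gt_mem_nhds hab)] with y h1 h2
  exact exp_eq_close h1 h2

lemma const_of_exp_const {Y : Type*} [TopologicalSpace Y] [PreconnectedSpace Y] {f : Y → ℂ}
    (hf : Continuous f) {c : ℂ} (h : ∀ y, exp (f y) = c) (y y' : Y) : f y = f y' := by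
  have : IsLocallyConstant f := by
    rw [IsLocallyConstant.iff_eventually_eq]
    intro y
    exact eventually_eq_of_exp (hf.tendsto y) tendsto_const_nhds (by simp [Real.pi_pos])
      (Eventually.of_forall fun z => by rw [h, h])
  exact this.apply_eq_of_preconnectedSpace y y'

abbrev UI : Type := unitInterval

open Classical in
noncomputable def vlog (g : UI → ℂ) : ℂ :=
  if h : ∃ l : UI → ℂ, Continuous l ∧ ∀ t, exp (l t) = g t then h.choose 1 - h.choose 0 else 0

lemma vlog_eq {g l : UI → ℂ} (hl : Continuous l) (h : ∀ t, exp (l t) = g t) :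
    vlog g = l 1 - l 0 := by
  have hex : ∃ l : UI → ℂ, Continuous l ∧ ∀ t, exp (l t) = g t := ⟨l, hl, h⟩
  rw [vlog, dif_pos hex]
  have h1 := hex.choose_spec
  have := const_of_exp_const (f := fun t => hex.choose t - l t) (h1.1.sub hl) (c := 1)
    (fun t => by rw [Complex.exp_sub, h1.2, h, div_self]; rw [← h]; exact exp_ne_zero _) 1 0
  linear_combination this

lemma exists_lift {g : UI → ℂ} (hg : Continuous g) (h0 : ∀ t, g t ≠ 0) :
    ∃ l : UI → ℂ, Continuous l ∧ ∀ t, exp (l t) = g t := by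
  let g' : C(ℝ, ℂ) := ⟨fun t => g (projIcc 0 1 zero_le_one t), hg.comp continuous_projIcc⟩
  obtain ⟨L, ⟨-, hL⟩, -⟩ := Complex.isCoveringMapOn_exp.existsUnique_continuousMap_lifts g'
    (a₀ := 0) (e₀ := Complex.log (g' 0)) (Complex.exp_log (h0 _)) (fun a => h0 _)
  refine ⟨fun t => L t, L.continuous.comp continuous_subtype_val, fun t => ?_⟩
  have := congrFun hL (t : ℝ)
  simpa [g'] using this

lemma exp_vlog {g : UI → ℂ} (hg : Continuous g) (h0 : ∀ t, g t ≠ 0) :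
    exp (vlog g) = g 1 / g 0 := by
  obtain ⟨l, hl, h⟩ := exists_lift hg h0
  rw [vlog_eq hl h, Complex.exp_sub, h, h]

lemma vlog_mul {g h : UI → ℂ} (hg : Continuous g) (hg0 : ∀ t, g t ≠ 0)
    (hh : Continuous h) (hh0 : ∀ t, h t ≠ 0) : vlog (fun t => g t * h t) = vlog g + vlog h := by
  obtain ⟨l, hl, e⟩ := exists_lift hg hg0
  obtain ⟨l', hl', e'⟩ := exists_lift hh hh0
  rw [vlog_eq hl e, vlog_eq hl' e', vlog_eq (l := fun t => l t + l' t) (hl.add hl') (fun t => by rw [Complex.exp_add, e, e'])]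
  ring

lemma vlog_div {g h : UI → ℂ} (hg : Continuous g) (hg0 : ∀ t, g t ≠ 0)
    (hh : Continuous h) (hh0 : ∀ t, h t ≠ 0) : vlog (fun t => g t / h t) = vlog g - vlog h := by
  obtain ⟨l, hl, e⟩ := exists_lift hg hg0
  obtain ⟨l', hl', e'⟩ := exists_lift hh hh0
  rw [vlog_eq hl e, vlog_eq hl' e', vlog_eq (l := fun t => l t - l' t) (hl.sub hl') (fun t => by rw [Complex.exp_sub, e, e'])]
  ring

lemma vlog_neg {g : UI → ℂ} (hg : Continuous g) (hg0 : ∀ t, g t ≠ 0) :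
    vlog (fun t => - g t) = vlog g := by
  obtain ⟨l, hl, e⟩ := exists_lift hg hg0
  rw [vlog_eq hl e, vlog_eq (l := fun t => l t + Real.pi * I) (hl.add continuous_const)
    (fun t => by rw [Complex.exp_add, e]; simp)]
  ring

/-- continuity of `vlog` in parameters -/
lemma vlog_continuousAt {Y : Type*} [TopologicalSpace Y] {g : Y → UI → ℂ} {y₀ : Y}
    (hg : Continuous (fun p : Y × UI => g p.1 p.2)) (h0 : ∀ t, g y₀ t ≠ 0) :
    ContinuousAt (fun y => vlog (g y)) y₀ := by
  have hgy : ∀ y, Continuous (g y) := fun y => hg.comp (by fun_prop : Continuous fun t => (y, t))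
  have hq : Continuous (fun p : Y × UI => g p.1 p.2 / g y₀ p.2) :=
    hg.div ((hgy y₀).comp continuous_snd) (fun p => h0 _)
  have hev : ∀ᶠ y in 𝓝 y₀, ∀ t : UI, g y t / g y₀ t ∈ slitPlane := by
    have hopen : IsOpen ((fun p : Y × UI => g p.1 p.2 / g y₀ p.2) ⁻¹' slitPlane) :=
      isOpen_slitPlane.preimage hq
    have := isCompact_univ.eventually_forall_of_forall_eventually (x₀ := y₀)
      (P := fun y t => g y t / g y₀ t ∈ slitPlane) (fun t _ => by
        apply hopen.mem_nhds
        simp [div_self (h0 t)])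
    filter_upwards [this] with y hy t using hy t (mem_univ _)
  have hev2 : ∀ᶠ y in 𝓝 y₀, vlog (g y) =
      vlog (g y₀) + (log (g y 1 / g y₀ 1) - log (g y 0 / g y₀ 0)) := by
    filter_upwards [hev] with y hy
    have hc : Continuous (fun t => g y t / g y₀ t) := (hgy y).div (hgy y₀) h0
    have h1 : vlog (fun t => g y t / g y₀ t) =
        log (g y 1 / g y₀ 1) - log (g y 0 / g y₀ 0) :=
      vlog_eq (l := fun t => log (g y t / g y₀ t)) (hc.clog hy)
        (fun t => exp_log (slitPlane_ne_zero (hy t)))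
    rw [← h1, ← vlog_mul (hgy y₀) h0 hc (fun t => slitPlane_ne_zero (hy t))]
    congr 1; ext t
    rw [mul_div_cancel₀ _ (h0 t)]
  rw [continuousAt_congr hev2]
  have hk : ∀ t : UI, ContinuousAt (fun y => log (g y t / g y₀ t)) y₀ := by
    intro t
    have : Continuous (fun y => g y t / g y₀ t) :=
      hq.comp (by fun_prop : Continuous fun y => (y, t))
    exact this.continuousAt.clog (by simp [div_self (h0 t)])
  exact continuousAt_const.add ((hk 1).sub (hk 0))

/-- commutation on the square -/
lemma vlog_square {D : UI → UI → ℂ} (hD : Continuous (fun p : UI × UI => D p.1 p.2))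
    (h0 : ∀ s t, D s t ≠ 0) :
    vlog (D 0) + vlog (fun s => D s 1) = vlog (fun s => D s 0) + vlog (D 1) := by
  have hs : ∀ s, Continuous (D s) := fun s => hD.comp (by fun_prop : Continuous fun t => (s, t))
  have ht : ∀ t, Continuous (fun s => D s t) :=
    fun t => hD.comp (by fun_prop : Continuous fun s => (s, t))
  have hc : Continuous (fun s => vlog (D s)) :=
    continuous_iff_continuousAt.2 fun s => vlog_continuousAt hD (h0 s)
  have h1 := vlog_eq hc (fun s => exp_vlog (hs s) (h0 s))
  rw [vlog_div (ht 1) (fun s => h0 s 1) (ht 0) (fun s => h0 s 0)] at h1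
  linear_combination h1

/-- affine reparametrization -/
noncomputable def aff (a b t : UI) : UI :=
  ⟨(1 - t) * a + t * b, by
    have := t.2.1; have := t.2.2; have := a.2.1; have := a.2.2; have := b.2.1; have := b.2.2
    constructor
    · have : 0 ≤ 1 - (t : ℝ) := by linarith
      positivity
    · nlinarith⟩

@[simp] lemma aff_zero (a b : UI) : aff a b 0 = a := by ext; simp [aff]
@[simp] lemma aff_one (a b : UI) : aff a b 1 = b := by ext; simp [aff]
lemma aff_cont : Continuous (fun p : UI × UI × UI => aff p.1 p.2.1 p.2.2) := by
  unfold aff; fun_prop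
lemma aff_continuous (a b : UI) : Continuous (aff a b) := by
  unfold aff; fun_prop

lemma vlog_aff {g : UI → ℂ} (hg : Continuous g) (h0 : ∀ t, g t ≠ 0) (a b c : UI) :
    vlog (g ∘ aff a c) = vlog (g ∘ aff a b) + vlog (g ∘ aff b c) := by
  obtain ⟨l, hl, e⟩ := exists_lift hg h0
  rw [vlog_eq (g := g ∘ aff a b) (l := l ∘ aff a b) (hl.comp (aff_continuous _ _)) (fun t => e _),
    vlog_eq (g := g ∘ aff b c) (l := l ∘ aff b c) (hl.comp (aff_continuous _ _)) (fun t => e _),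
    vlog_eq (g := g ∘ aff a c) (l := l ∘ aff a c) (hl.comp (aff_continuous _ _)) (fun t => e _)]
  simp

/-- branches of the logarithm -/
noncomputable def bm (w : ℂ) : ℂ := log (I * w) - Real.pi / 2 * I

lemma exp_bm {w : ℂ} (hw : w ≠ 0) : exp (bm w) = w := by
  rw [bm, Complex.exp_sub, exp_log (by simp [hw])]
  have : exp (Real.pi / 2 * I) = I := Complex.exp_pi_div_two_mul_I
  rw [this]; field_simp

lemma mem_slit_of_im_nonpos {w : ℂ} (hw : w ≠ 0) (h : w.im ≤ 0) : I * w ∈ slitPlane := by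
  rw [mem_slitPlane_iff]
  simp
  by_contra hc
  push Not at hc
  exact hw (Complex.ext hc.2 (le_antisymm h hc.1))

lemma bm_continuousAt {Y : Type*} [TopologicalSpace Y] {g : Y → ℂ} {y : Y}
    (hg : ContinuousAt g y) (h : g y ≠ 0) (hi : (g y).im ≤ 0) :
    ContinuousAt (fun y => bm (g y)) y := by
  unfold bm
  exact ((continuousAt_const.mul hg).clog (mem_slit_of_im_nonpos h hi)).sub continuousAt_const

lemma bm_vlog {g : UI → ℂ} (hg : Continuous g) (h : ∀ t, g t ≠ 0) (hi : ∀ t, (g t).im ≤ 0) :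
    vlog g = bm (g 1) - bm (g 0) :=
  vlog_eq (l := fun t => bm (g t))
    (continuous_iff_continuousAt.2 fun t => bm_continuousAt hg.continuousAt (h t) (hi t))
    (fun t => exp_bm (h t))

lemma bm_ofReal_pos {r : ℝ} (hr : 0 < r) : bm r = log r := by
  have : I * (r : ℂ) = (r : ℂ) * I := mul_comm _ _
  rw [bm, this, Complex.log_ofReal_mul hr (by simp), Complex.log_I, Complex.ofReal_log hr.le]
  ring

lemma bm_ofReal_neg {r : ℝ} (hr : 0 < r) : bm (-(r : ℂ)) = log r - Real.pi * I := by
  have : I * (-(r : ℂ)) = (r : ℂ) * (-I) := by ring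
  rw [bm, this, Complex.log_ofReal_mul hr (by simp), Complex.log_neg_I, Complex.ofReal_log hr.le]
  ring

lemma bm_eq_log {w : ℂ} (h : 0 < w.re) : bm w = log w := by
  have hw : w ≠ 0 := by intro hc; simp [hc] at h
  have h1 := Complex.abs_arg_lt_pi_div_two_iff.2 (Or.inl h)
  rw [abs_lt] at h1
  rw [bm, (Complex.log_mul_eq_add_log_iff I_ne_zero hw).2, Complex.log_I]
  · ring
  · rw [Complex.arg_I]; constructor <;> linarith [h1.1, h1.2, Real.pi_pos]

lemma bm_eq_log_neg {w : ℂ} (h : w.re < 0) : bm w = log (-w) - Real.pi * I := by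
  have h' : 0 < (-w).re := by simpa using h
  have hw : -w ≠ 0 := by intro hc; rw [hc] at h'; simp at h'
  have h1 := Complex.abs_arg_lt_pi_div_two_iff.2 (Or.inl h')
  rw [abs_lt] at h1
  have : I * w = (-I) * (-w) := by ring
  rw [bm, this, (Complex.log_mul_eq_add_log_iff (by simp) hw).2, Complex.log_neg_I]
  · ring
  · rw [Complex.arg_neg_I]; constructor <;> linarith [h1.1, h1.2, Real.pi_pos]

lemma vlog_right {g : UI → ℂ} (hg : Continuous g) (h : ∀ t, 0 < (g t).re) :
    vlog g = log (g 1) - log (g 0) := by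
  have hs : ∀ t, g t ∈ slitPlane := fun t => Or.inl (h t)
  exact vlog_eq (l := fun t => log (g t)) (hg.clog hs) (fun t => exp_log (slitPlane_ne_zero (hs t)))

lemma vlog_left {g : UI → ℂ} (hg : Continuous g) (h : ∀ t, (g t).re < 0) :
    vlog g = log (-g 1) - log (-g 0) := by
  have h0 : ∀ t, g t ≠ 0 := fun t hc => by have := h t; simp [hc] at this
  rw [← vlog_neg hg h0, vlog_right (g := fun t => - g t) hg.neg (fun t => by simpa using h t)]

end OAB


open Set Function MeasureTheory Filter Topology

namespace OAB

open Complex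

/-- complex coordinate -/
noncomputable def cc (z : Strip) : ℂ := ⟨z.1, (z.2 : ℝ)⟩

@[simp] lemma cc_re (z : Strip) : (cc z).re = z.1 := rfl
@[simp] lemma cc_im (z : Strip) : (cc z).im = (z.2 : ℝ) := rfl

@[fun_prop] lemma cc_cont : Continuous cc := by
  have : cc = fun z : Strip => (Complex.equivRealProdCLM.symm (z.1, (z.2 : ℝ))) := by
    funext z; apply Complex.ext <;> simp [cc]
  rw [this]; fun_prop

lemma cc_inj : Injective cc := by
  rintro ⟨a, b⟩ ⟨a', b'⟩ h
  have h1 := congrArg Complex.re h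
  have h2 := congrArg Complex.im h
  simp at h1 h2
  ext <;> simp [h1, h2]

lemma cc_sub_ne {z w : Strip} (h : z ≠ w) : cc z - cc w ≠ 0 :=
  fun hc => h (cc_inj (sub_eq_zero.1 hc))

lemma height_le (z : Strip) : (z.2 : ℝ) ≤ 1 := z.2.2.2

lemma strip_ext {z w : Strip} (h1 : z.1 = w.1) (h2 : (z.2 : ℝ) = w.2) : z = w :=
  Prod.ext h1 (Subtype.ext h2)

/-- angular function -/
noncomputable def Th (γ : UI → Strip) (w : Strip) : ℂ :=
  bm (cc w - cc (γ 0)) + vlog (fun t => cc w - cc (γ t))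

noncomputable def Aa (γ δ : UI → Strip) : ℂ := Th γ (δ 1) - Th δ (γ 1)

lemma Aa_anti (γ δ : UI → Strip) : Aa δ γ = - Aa γ δ := by unfold Aa; ring

lemma Th_exp {γ : UI → Strip} (hγ : Continuous γ) {w : Strip} (hw : w ∉ range γ) :
    exp (Th γ w) = cc w - cc (γ 1) := by
  have h0 : ∀ t, cc w - cc (γ t) ≠ 0 := fun t => cc_sub_ne (fun h => hw ⟨t, h.symm⟩)
  rw [Th, Complex.exp_add, exp_bm (h0 0), exp_vlog (by fun_prop) h0]
  field_simp [h0 0]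

lemma Aa_exp {γ δ : UI → Strip} (hγ : Continuous γ) (hδ : Continuous δ)
    (h1 : δ 1 ∉ range γ) (h2 : γ 1 ∉ range δ) : exp (Aa γ δ) = -1 := by
  rw [Aa, Complex.exp_sub, Th_exp hγ h1, Th_exp hδ h2]
  have : cc (γ 1) - cc (δ 1) ≠ 0 := cc_sub_ne (fun h => h2 ⟨1, h.symm⟩)
  field_simp
  ring

lemma Th_cont_param {Y : Type*} [TopologicalSpace Y] {Γ : Y → UI → Strip} {w : Y → Strip} {y₀ : Y}
    (hΓ : Continuous (fun p : Y × UI => Γ p.1 p.2)) (hw : Continuous w)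
    (h1 : ((Γ y₀ 0).2 : ℝ) = 1) (hn : w y₀ ∉ range (Γ y₀)) :
    ContinuousAt (fun y => Th (Γ y) (w y)) y₀ := by
  have h0 : ∀ t, cc (w y₀) - cc (Γ y₀ t) ≠ 0 := fun t => cc_sub_ne (fun h => hn ⟨t, h.symm⟩)
  have hΓ0 : Continuous (fun y => Γ y 0) := hΓ.comp (by fun_prop : Continuous fun y : Y => (y, (0 : UI)))
  refine ContinuousAt.add (bm_continuousAt (by fun_prop) (h0 0) ?_) ?_
  · simp only [sub_im, cc_im, h1]; linarith [height_le (w y₀)]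
  · exact vlog_continuousAt (g := fun y t => cc (w y) - cc (Γ y t)) (by fun_prop) h0

lemma Th_cont {γ : UI → Strip} (hγ : Continuous γ) (h1 : ((γ 0).2 : ℝ) = 1) {w : Strip}
    (hw : w ∉ range γ) : ContinuousAt (Th γ) w :=
  Th_cont_param (Γ := fun _ : Strip => γ) (w := fun w => w) (by fun_prop) continuous_id h1 hw

lemma Th_far_left {γ : UI → Strip} (hγ : Continuous γ) {w : Strip}
    (h : ∀ t, w.1 < (γ t).1) : Th γ w = log (-(cc w - cc (γ 1))) - Real.pi * I := by
  have hr : ∀ t, (cc w - cc (γ t)).re < 0 := fun t => by simpa using h t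
  rw [Th, bm_eq_log_neg (hr 0), vlog_left (by fun_prop) hr]
  ring

lemma Th_far_right {γ : UI → Strip} (hγ : Continuous γ) {w : Strip}
    (h : ∀ t, (γ t).1 < w.1) : Th γ w = log (cc w - cc (γ 1)) := by
  have hr : ∀ t, 0 < (cc w - cc (γ t)).re := fun t => by simpa using h t
  rw [Th, bm_eq_log (hr 0), vlog_right (by fun_prop) hr]
  ring

/-- disjoint paths -/
lemma Aa_disjoint {γ δ : UI → Strip} (hγ : Continuous γ) (hδ : Continuous δ)
    (h1 : ((γ 0).2 : ℝ) = 1) (h2 : ((δ 0).2 : ℝ) = 1) (hd : Disjoint (range γ) (range δ))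
    (hlt : (γ 0).1 < (δ 0).1) : Aa γ δ = Real.pi * I := by
  have hne : ∀ s t, δ t ≠ γ s := fun s t h => disjoint_left.1 hd ⟨s, rfl⟩ ⟨t, h⟩
  have h0 : ∀ s t, cc (δ t) - cc (γ s) ≠ 0 := fun s t => cc_sub_ne (hne s t)
  have hsq := vlog_square (D := fun s t => cc (δ t) - cc (γ s)) (by fun_prop) h0
  have e1 := bm_vlog (g := fun t => cc (δ t) - cc (γ 0)) (by fun_prop) (h0 0)
    (fun t => by simp [h1]; exact height_le _)
  have h0' : ∀ s t, cc (γ s) - cc (δ t) ≠ 0 := fun s t => cc_sub_ne (hne s t).symm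
  have e2 := bm_vlog (g := fun s => cc (γ s) - cc (δ 0)) (by fun_prop) (fun s => h0' s 0)
    (fun t => by simp [h2]; exact height_le _)
  have n1 : vlog (fun s => cc (γ s) - cc (δ 0)) = vlog (fun s => cc (δ 0) - cc (γ s)) := by
    rw [← vlog_neg (by fun_prop) (fun s => h0 s 0)]; simp
  have n2 : vlog (fun t => cc (γ 1) - cc (δ t)) = vlog (fun t => cc (δ t) - cc (γ 1)) := by
    rw [← vlog_neg (by fun_prop) (fun t => h0 1 t)]; simp
  have r1 : cc (δ 0) - cc (γ 0) = (((δ 0).1 - (γ 0).1 : ℝ) : ℂ) := by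
    apply Complex.ext <;> simp [h1, h2]
  have r2 : cc (γ 0) - cc (δ 0) = -(((δ 0).1 - (γ 0).1 : ℝ) : ℂ) := by
    rw [← r1]; ring
  have hp : 0 < (δ 0).1 - (γ 0).1 := by linarith
  rw [r1, bm_ofReal_pos hp] at e1
  rw [r2, bm_ofReal_neg hp] at e2
  unfold Aa Th
  rw [n2]
  rw [n1] at e2
  linear_combination hsq - e1 + e2

lemma Th_split {γ : UI → Strip} (hγ : Continuous γ) {w : Strip} (hw : w ∉ range γ) (s : UI) :
    Th γ w = Th (γ ∘ aff 0 s) w + vlog (fun t => cc w - cc (γ (aff s 1 t))) := by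
  have h0 : ∀ t, cc w - cc (γ t) ≠ 0 := fun t => cc_sub_ne (fun h => hw ⟨t, h.symm⟩)
  have := vlog_aff (g := fun t => cc w - cc (γ t)) (by fun_prop) h0 0 s 1
  have e : (fun t => cc w - cc (γ t)) ∘ aff 0 1 = fun t => cc w - cc (γ t) := by
    funext t; simp only [comp]; congr 3; ext; simp [aff]
  rw [e] at this
  unfold Th
  rw [this]
  simp only [comp_def, aff_zero]
  ring

/-- concatenation -/
noncomputable def cat (p q : UI → Strip) (t : UI) : Strip :=
  if (t : ℝ) ≤ 1 / 2 then p (projIcc 0 1 zero_le_one (2 * t))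
  else q (projIcc 0 1 zero_le_one (2 * t - 1))

lemma cat_cont {p q : UI → Strip} (hp : Continuous p) (hq : Continuous q) (h : p 1 = q 0) :
    Continuous (cat p q) := by
  unfold cat
  refine Continuous.if_le ?_ ?_ (by fun_prop) (by fun_prop) ?_
  · exact hp.comp (continuous_projIcc.comp (by fun_prop))
  · exact hq.comp (continuous_projIcc.comp (by fun_prop))
  · intro t ht
    rw [projIcc_of_right_le _ (by linarith), projIcc_of_le_left _ (by linarith)]
    exact h

@[simp] lemma cat_zero (p q : UI → Strip) : cat p q 0 = p 0 := by
  simp [cat]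

@[simp] lemma cat_one (p q : UI → Strip) : cat p q 1 = q 1 := by
  have h : ¬ ((1 : ℝ) ≤ 1 / 2) := by norm_num
  have e : ((1 : UI) : ℝ) = 1 := rfl
  simp only [cat, e, h, if_false]
  rw [projIcc_of_right_le _ (by norm_num)]; rfl

lemma cat_mem (p q : UI → Strip) (t : UI) :
    (∃ s, cat p q t = p s ∧ (t : ℝ) ≤ 1 / 2 ∧ (s : ℝ) = 2 * t) ∨
    (∃ s, cat p q t = q s ∧ 1 / 2 < (t : ℝ) ∧ (s : ℝ) = 2 * t - 1) := by
  unfold cat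
  split_ifs with h
  · left; exact ⟨_, rfl, h, by rw [projIcc_of_mem _ ⟨by linarith [t.2.1], by linarith⟩]⟩
  · right
    push Not at h
    exact ⟨_, rfl, h, by rw [projIcc_of_mem _ ⟨by linarith, by linarith [t.2.2]⟩]⟩

noncomputable def half : UI := ⟨1 / 2, by norm_num, by norm_num⟩

lemma cat_left (p q : UI → Strip) : cat p q ∘ aff 0 half = p := by
  funext t
  have h1 := t.2.1
  have h2 := t.2.2
  have e : ((aff 0 half t : UI) : ℝ) = t / 2 := by simp [aff, half]; ring
  have h : ((aff 0 half t : UI) : ℝ) ≤ 1 / 2 := by rw [e]; linarith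
  simp only [comp, cat, h, if_true]
  congr 1
  rw [projIcc_of_mem _ (by rw [e]; exact ⟨by linarith, by linarith⟩)]
  ext; simp [e]; ring

lemma cat_right (p q : UI → Strip) (h : p 1 = q 0) : cat p q ∘ aff half 1 = q := by
  funext t
  have h1 := t.2.1
  have h2 := t.2.2
  have e : ((aff half 1 t : UI) : ℝ) = (1 + t) / 2 := by simp [aff, half]; ring
  by_cases ht : t = 0
  · subst ht
    have := congrFun (cat_left p q) 1
    simp only [comp, aff_one, aff_zero] at this ⊢
    rw [this, h]
  have hpos : 0 < (t : ℝ) := lt_of_le_of_ne h1 (fun hc => ht (Subtype.ext hc.symm))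
  have h : ¬ ((aff half 1 t : UI) : ℝ) ≤ 1 / 2 := by rw [e]; linarith
  simp only [comp, cat, h, if_false]
  congr 1
  rw [projIcc_of_mem _ (by rw [e]; exact ⟨by linarith, by linarith⟩)]
  ext; simp [e]; ring

lemma cat_inj {p q : UI → Strip} (hp : Injective p) (hq : Injective q)
    (h : ∀ s t, p s = q t → s = 1 ∧ t = 0) : Injective (cat p q) := by
  intro a b hab
  rcases cat_mem p q a with ⟨s, hs, ha, es⟩ | ⟨s, hs, ha, es⟩ <;>
  rcases cat_mem p q b with ⟨t, ht, hb, et⟩ | ⟨t, ht, hb, et⟩ <;>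
  rw [hs, ht] at hab
  · have := hp hab; subst this; ext; linarith
  · have := h _ _ hab
    rw [this.2] at et; simp at et; linarith
  · have := h _ _ hab.symm
    rw [this.2] at es; simp at es; linarith
  · have := hq hab; subst this; ext; linarith

lemma cat_range_sub (p q : UI → Strip) (t : UI) : cat p q t ∈ range p ∪ range q := by
  rcases cat_mem p q t with ⟨s, hs, -⟩ | ⟨s, hs, -⟩
  · left; exact ⟨s, hs.symm⟩
  · right; exact ⟨s, hs.symm⟩

/-- for `t ≠ 1` a concatenation is in `range p` or `q s` with `s ≠ 1` -/
lemma cat_ne_one {p q : UI → Strip} {S : Set Strip} (hp : ∀ s, p s ∈ S) (hq : ∀ s, s ≠ 1 → q s ∈ S)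
    {t : UI} (ht : t ≠ 1) : cat p q t ∈ S := by
  rcases cat_mem p q t with ⟨s, hs, -⟩ | ⟨s, hs, h1, h2⟩
  · rw [hs]; exact hp s
  · rw [hs]; apply hq; rintro rfl; apply ht; apply Subtype.ext; show (t : ℝ) = 1; simp at h2; linarith

lemma Th_cat {p q : UI → Strip} (hp : Continuous p) (hq : Continuous q) (h : p 1 = q 0) {w : Strip}
    (hw1 : w ∉ range p) (hw2 : w ∉ range q) :
    Th (cat p q) w = Th p w + vlog (fun t => cc w - cc (q t)) := by
  have hw : w ∉ range (cat p q) := by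
    rintro ⟨t, rfl⟩
    rcases cat_range_sub p q t with h | h <;> contradiction
  rw [Th_split (cat_cont hp hq h) hw half, cat_left]
  have := cat_right p q h
  congr 2
  funext t
  rw [← congrFun this t]; rfl

end OAB


open Set Function MeasureTheory Filter Topology

namespace OAB

instance instLPC_II : LocallyPathConnectedSpace II := by
  have : IsQuotientMap (projIcc (-1 : ℝ) 1 (by norm_num)) :=
    IsQuotientMap.of_inverse (g := projIcc (-1 : ℝ) 1 (by norm_num)) (f := Subtype.val)
      continuous_subtype_val continuous_projIcc (fun x => projIcc_val _ x)
  exact this.locallyPathConnectedSpace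

instance instLPC_circ : LocallyPathConnectedSpace (AddCircle (1 : ℝ)) :=
  inferInstanceAs (LocallyPathConnectedSpace (Quotient _))

@[fun_prop] lemma pr_cont : Continuous pr := by
  unfold pr
  exact ((AddCircle.continuous_mk' (1:ℝ)).comp continuous_fst).prodMk continuous_snd

@[fun_prop] lemma shift_cont (k : ℤ) : Continuous (shiftPt k) := by
  unfold shiftPt; fun_prop

@[simp] lemma shift_fst (k : ℤ) (z : Strip) : (shiftPt k z).1 = z.1 + k := rfl
@[simp] lemma shift_snd (k : ℤ) (z : Strip) : (shiftPt k z).2 = z.2 := rfl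

@[simp] lemma shift_shift (k l : ℤ) (z : Strip) : shiftPt k (shiftPt l z) = shiftPt (l + k) z := by
  apply strip_ext <;> simp [add_assoc]

@[simp] lemma shift_zero (z : Strip) : shiftPt 0 z = z := by apply strip_ext <;> simp

lemma coe_eq_iff {a b : ℝ} : (a : AddCircle (1 : ℝ)) = b ↔ ∃ k : ℤ, a = b + k := by
  constructor
  · intro h
    have h' := (QuotientAddGroup.eq (s := AddSubgroup.zmultiples (1 : ℝ))).1 h.symm
    obtain ⟨n, hn⟩ := AddSubgroup.mem_zmultiples_iff.1 h'
    exact ⟨n, by simp at hn; linarith⟩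
  · rintro ⟨k, rfl⟩
    have : ((k : ℝ) : AddCircle (1 : ℝ)) = 0 := by
      have := AddCircle.coe_zsmul (p := (1 : ℝ)) (n := k) (x := 1)
      rw [AddCircle.coe_period, smul_zero] at this
      simp
    rw [AddCircle.coe_add, this, add_zero]

lemma pr_eq_iff {z w : Strip} : pr z = pr w ↔ ∃ k : ℤ, z = shiftPt k w := by
  unfold pr
  rw [Prod.mk.injEq, coe_eq_iff]
  constructor
  · rintro ⟨⟨k, hk⟩, h⟩
    exact ⟨k, Prod.ext hk h⟩
  · rintro ⟨k, rfl⟩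
    exact ⟨⟨k, rfl⟩, rfl⟩

@[simp] lemma pr_shift (k : ℤ) (z : Strip) : pr (shiftPt k z) = pr z := pr_eq_iff.2 ⟨k, rfl⟩

lemma pr_surj : Surjective pr := by
  rintro ⟨a, b⟩
  obtain ⟨x, rfl⟩ := QuotientAddGroup.mk_surjective a
  exact ⟨(x, b), rfl⟩

lemma pr_open : IsOpenMap pr :=
  IsOpenMap.prodMap (QuotientAddGroup.isOpenMap_coe) IsOpenMap.id

/-- integer-valued continuous functions are constant -/
lemma const_of_coe {Y : Type*} [TopologicalSpace Y] [PreconnectedSpace Y] {h : Y → ℝ}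
    (hc : Continuous h) (h0 : ∀ y, (h y : AddCircle (1 : ℝ)) = 0) (y y' : Y) : h y = h y' := by
  have := const_of_exp_const (f := fun y => (2 * Real.pi * Complex.I * (h y : ℂ))) (by fun_prop)
    (c := 1) (fun y => by
      obtain ⟨k, hk⟩ := coe_eq_iff.1 ((h0 y).trans (AddCircle.coe_zero (p := (1 : ℝ))).symm)
      rw [hk, Complex.exp_eq_one_iff]
      exact ⟨k, by push_cast; ring⟩) y y'
  have hne : (2 * Real.pi * Complex.I : ℂ) ≠ 0 := Complex.two_pi_I_ne_zero
  exact_mod_cast mul_left_cancel₀ hne this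

section EAC

variable {X Um Up : Set Ann}

lemma Up_open (hX : IsEAC X Um Up) : IsOpen Up := by
  rw [hX.hUp]; exact hX.compact.isClosed.isOpen_compl.connectedComponentIn
lemma Um_open (hX : IsEAC X Um Up) : IsOpen Um := by
  rw [hX.hUm]; exact hX.compact.isClosed.isOpen_compl.connectedComponentIn

lemma Up_Um_disj (hX : IsEAC X Um Up) : Disjoint Up Um := by
  rw [Set.disjoint_left]
  intro a h1 h2
  apply hX.ne
  rw [hX.hUp] at h1
  rw [hX.hUm] at h2
  rw [hX.hUp, hX.hUm, connectedComponentIn_eq h1, connectedComponentIn_eq h2]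

lemma circle_sub (hX : IsEAC X Um Up) (c : II) (hc : (c : ℝ) = 1 ∨ (c : ℝ) = -1) (a : AddCircle (1 : ℝ)) :
    (a, c) ∈ connectedComponentIn Xᶜ ((0 : AddCircle (1 : ℝ)), c) := by
  have h1 : IsPreconnected ((fun a : AddCircle (1 : ℝ) => (a, c)) '' univ) :=
    isPreconnected_univ.image _ (by fun_prop)
  refine h1.subset_connectedComponentIn ⟨0, mem_univ _, rfl⟩ ?_ ⟨a, mem_univ _, rfl⟩
  rintro _ ⟨b, -, rfl⟩ hb
  have := hX.inInterior _ hb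
  rcases hc with hc | hc <;> simp [hc] at this

lemma top_sub (hX : IsEAC X Um Up) (p : Ann) (h : (p.2 : ℝ) = 1) : p ∈ Up := by
  rw [hX.hUp]
  have : p = (p.1, (⟨1, by norm_num, le_rfl⟩ : II)) := Prod.ext rfl (Subtype.ext h)
  rw [this]
  exact circle_sub hX _ (Or.inl rfl) _

lemma bot_sub (hX : IsEAC X Um Up) (p : Ann) (h : (p.2 : ℝ) = -1) : p ∈ Um := by
  rw [hX.hUm]
  have : p = (p.1, (⟨-1, le_rfl, by norm_num⟩ : II)) := Prod.ext rfl (Subtype.ext h)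
  rw [this]
  exact circle_sub hX _ (Or.inr rfl) _

lemma no_section (hX : IsEAC X Um Up) (c : X → ℝ) (hc : Continuous c)
    (hl : ∀ a : X, (c a : AddCircle (1 : ℝ)) = a.1.1) : False := by
  classical
  obtain ⟨C, hC⟩ := ContinuousMap.exists_restrict_eq (Y := ℝ) hX.compact.isClosed ⟨c, hc⟩
  have hC' : ∀ a (ha : a ∈ X), C a = c ⟨a, ha⟩ := fun a ha => by
    have := congrArg (fun g : C(X, ℝ) => g ⟨a, ha⟩) hC
    simpa using this
  let g : Ann → AddCircle (1 : ℝ) := Up.piecewise (fun a => a.1 - (C a : AddCircle (1 : ℝ))) 0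
  have hg : Continuous g := by
    apply Continuous.piecewise
    · intro a ha
      have haX : a ∈ X := by
        by_contra hn
        have : a ∈ Um ∪ Up := hX.cover ▸ hn
        rw [(Up_open hX).frontier_eq] at ha
        rcases this with h | h
        · obtain ⟨b, hb1, hb2⟩ := mem_closure_iff.1 ha.1 Um (Um_open hX) h
          exact disjoint_left.1 (Up_Um_disj hX) hb2 hb1
        · exact ha.2 h
      simp [hC' a haX, hl]
    · exact continuous_fst.sub ((AddCircle.continuous_mk' (1:ℝ)).comp C.continuous)
    · exact continuous_const
  let pp : ℝ × ℝ → Strip := fun q => (q.1, projIcc (-1 : ℝ) 1 (by norm_num) q.2)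
  have hpp : Continuous pp := continuous_fst.prodMk (continuous_projIcc.comp continuous_snd)
  have hG : Continuous fun q => g (pr (pp q)) := hg.comp (pr_cont.comp hpp)
  obtain ⟨e₀, he₀⟩ := QuotientAddGroup.mk_surjective (g (pr (pp 0)))
  obtain ⟨G, ⟨-, hGl⟩, -⟩ := (AddCircle.isCoveringMap_coe (1 : ℝ)).existsUnique_continuousMap_lifts
    (⟨_, hG⟩ : C(ℝ × ℝ, AddCircle (1 : ℝ))) 0 e₀ he₀
  have hGl' : ∀ q, (G q : AddCircle (1 : ℝ)) = g (pr (pp q)) := fun q => congrFun hGl q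
  have hGc := G.continuous
  have h1 := const_of_coe (h := fun q : ℝ × ℝ => G (q.1 + 1, q.2) - G q) (by fun_prop) (fun q => by
    rw [AddCircle.coe_sub, hGl', hGl']
    have : pr (pp (q.1 + 1, q.2)) = pr (pp q) := pr_eq_iff.2 ⟨1, by simp [pp, shiftPt]⟩
    rw [this, sub_self]) (0, 1) (0, -1)
  have p1 : ∀ x : ℝ, pp (x, 1) = (x, ⟨1, by norm_num, le_rfl⟩) := fun x => by
    simp only [pp]; rw [projIcc_of_right_le _ le_rfl]
  have p2 : ∀ x : ℝ, pp (x, -1) = (x, ⟨-1, le_rfl, by norm_num⟩) := fun x => by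
    simp only [pp]; rw [projIcc_of_le_left _ le_rfl]
  have hCc := C.continuous
  have h2 := const_of_coe (h := fun x : ℝ => G (x, 1) - (x - C (pr (pp (x, 1))))) (by fun_prop)
    (fun x => by
      rw [AddCircle.coe_sub, hGl']
      have : pr (pp (x, 1)) ∈ Up := top_sub hX _ (by rw [p1]; rfl)
      simp only [g]
      rw [piecewise_eq_of_mem _ _ _ this, AddCircle.coe_sub, p1]
      simp [pr]) 0 (0 + 1)
  have h3 := const_of_coe (h := fun x : ℝ => G (x, -1)) (by fun_prop)
    (fun x => by
      rw [hGl']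
      have : pr (pp (x, -1)) ∉ Up := disjoint_right.1 (Up_Um_disj hX)
        (bot_sub hX _ (by rw [p2]; rfl))
      simp only [g]
      rw [piecewise_eq_of_notMem _ _ _ this]; rfl) 0 (0 + 1)
  have h4 : pr (pp (0 + 1, 1)) = pr (pp (0, 1)) := pr_eq_iff.2 ⟨1, by simp [pp, shiftPt]⟩
  simp only [h4] at h1 h2 h3
  rw [← h3] at h1
  linarith

lemma key (hX : IsEAC X Um Up) {S : Set Strip} (hS : S ⊆ pr ⁻¹' X) (hc : IsCompact S) {O : Set Strip} (hO : IsOpen O)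
    (hSO : S = pr ⁻¹' X ∩ O) : S = ∅ := by
  by_contra hne
  rw [← ne_eq, ← nonempty_iff_ne_empty] at hne
  have hcov : X ⊆ pr '' S := by
    have hcl : IsClosed (pr '' S) := (hc.image pr_cont).isClosed
    have hop : IsOpen (pr '' O) := pr_open _ hO
    have e : X ∩ pr '' O ⊆ pr '' S := by
      rintro _ ⟨h1, z, h2, rfl⟩
      exact ⟨z, by rw [hSO]; exact ⟨h1, h2⟩, rfl⟩
    have hpre := hX.connected.isPreconnected
    by_contra hcon
    rw [not_subset] at hcon
    obtain ⟨a, ha, ha'⟩ := hcon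
    obtain ⟨s, hs⟩ := hne
    obtain ⟨b, hb, hb1, hb2⟩ := hpre (pr '' O) (pr '' S)ᶜ hop hcl.isOpen_compl
      (fun b hb => by
        by_cases h : b ∈ pr '' S
        · left; exact image_mono (hSO ▸ inter_subset_right) h
        · right; exact h)
      ⟨pr s, hS hs, s, by rw [hSO] at hs; exact hs.2, rfl⟩ ⟨a, ha, ha'⟩
    exact hb2 (e ⟨hb, hb1⟩)
  obtain ⟨N, hN⟩ := (hc.image continuous_fst).isBounded.exists_norm_le
  have hN' : ∀ s ∈ S, |s.1| ≤ N := fun s hs => hN _ ⟨s, hs, rfl⟩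
  let C : Set Strip := S ∩ ⋂ k : ℕ, {s | shiftPt (k + 1) s ∉ O}
  have hCc : IsCompact C := by
    apply hc.inter_right
    apply isClosed_iInter
    intro k
    exact (hO.preimage (shift_cont (k + 1))).isClosed_compl
  have hCS : ∀ s ∈ C, ∀ k : ℤ, 0 < k → shiftPt k s ∉ S := by
    rintro s ⟨-, hs2⟩ k hk hkS
    rw [mem_iInter] at hs2
    have := hs2 (k - 1).toNat
    rw [hSO] at hkS
    apply this
    have : (((k - 1).toNat : ℤ) + 1) = k := by omega
    rw [this]; exact hkS.2
  have hCX : ∀ a ∈ X, ∃ s ∈ C, pr s = a := by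
    intro a ha
    obtain ⟨s, hs, rfl⟩ := hcov ha
    obtain ⟨k, hk1, hk2⟩ := Int.exists_greatest_of_bdd (P := fun k => shiftPt k s ∈ S)
      ⟨⌈2 * N⌉, fun k hk => by
        have h1 := hN' _ hk
        have h2 := hN' _ hs
        simp at h1
        rw [abs_le] at h1 h2
        have : (k : ℝ) ≤ ⌈2 * N⌉ := le_trans (by linarith) (Int.le_ceil _)
        exact_mod_cast this⟩ ⟨0, by simpa using hs⟩
    refine ⟨shiftPt k s, ⟨hk1, ?_⟩, by simp⟩
    rw [mem_iInter]
    intro j hj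
    have : shiftPt (k + (j + 1)) s ∈ S := by
      rw [hSO]
      refine ⟨by simpa using ha, by simpa using hj⟩
    have := hk2 _ this
    omega
  have hinj : ∀ s ∈ C, ∀ t ∈ C, pr s = pr t → s = t := by
    intro s hs t ht h
    obtain ⟨k, hk⟩ := pr_eq_iff.1 h
    rcases lt_trichotomy k 0 with h0 | h0 | h0
    · exfalso
      refine hCS s hs (-k) (by omega) ?_
      rw [hk]; simpa using ht.1
    · simpa [h0] using hk
    · exfalso
      exact hCS t ht k h0 (hk ▸ hs.1)
  have : CompactSpace C := isCompact_iff_compactSpace.1 hCc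
  let e : C ≃ X := Equiv.ofBijective (fun s => ⟨pr s, hS s.2.1⟩)
    ⟨fun s t h => Subtype.ext (hinj s s.2 t t.2 (congrArg Subtype.val h)),
      fun a => by
        obtain ⟨s, hs, h⟩ := hCX a a.2
        exact ⟨⟨s, hs⟩, Subtype.ext h⟩⟩
  have he : Continuous e := by
    apply Continuous.subtype_mk
    fun_prop
  let e' := he.homeoOfEquivCompactToT2 (f := e)
  refine no_section hX (fun a => (e'.symm a).1.1) (by fun_prop) (fun a => ?_)
  have : e' (e'.symm a) = a := e'.apply_symm_apply a
  have h2 : pr (e'.symm a).1 = a.1 := congrArg Subtype.val this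
  exact congrArg Prod.fst h2

lemma joinedL (hX : IsEAC X Um Up) {u : Strip} (hu : pr u ∈ Up) :
    ∃ p : UI → Strip, Continuous p ∧ (∀ t, pr (p t) ∈ Up) ∧ ((p 0).2 : ℝ) = 1 ∧ p 1 = u := by
  have hc : IsConnected Up := by
    rw [hX.hUp, isConnected_connectedComponentIn_iff]
    have := top_sub hX ((0 : AddCircle (1 : ℝ)), (⟨1, by norm_num, le_rfl⟩ : II)) rfl
    rw [hX.hUp] at this
    exact connectedComponentIn_subset _ _ this
  have hpc : IsPathConnected Up := ((Up_open hX).isConnected_iff_isPathConnected).1 hc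
  obtain ⟨γ, hγ⟩ := hpc.joinedIn _ hu _
    (top_sub hX ((0 : AddCircle (1 : ℝ)), (⟨1, by norm_num, le_rfl⟩ : II)) rfl)
  obtain ⟨Γ, hΓ, hΓ0⟩ := (AddCircle.isCoveringMap_coe (1 : ℝ)).exists_path_lifts
    ⟨fun t => (γ t).1, by fun_prop⟩ u.1 (by show (γ 0).1 = _; rw [γ.source]; rfl)
  have hpr : ∀ t, pr (Γ t, (γ t).2) = γ t := fun t => Prod.ext (congrFun hΓ t) rfl
  refine ⟨fun t => (Γ (unitInterval.symm t), (γ (unitInterval.symm t)).2), by fun_prop,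
    fun t => by rw [hpr]; exact hγ _, by simp, ?_⟩
  simp only [unitInterval.symm_one, hΓ0]
  rw [γ.source]; rfl

end EAC

/-- abstract context -/
structure Ctx (U Xt : Set Strip) : Prop where
  openU : IsOpen U
  closedX : IsClosed Xt
  disj : ∀ z ∈ U, z ∉ Xt
  shiftU : ∀ k z, shiftPt k z ∈ U ↔ z ∈ U
  shiftX : ∀ k z, shiftPt k z ∈ Xt ↔ z ∈ Xt
  ltone : ∀ z ∈ Xt, (z.2 : ℝ) < 1
  top : ∀ z : Strip, (z.2 : ℝ) = 1 → z ∈ U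
  joined : ∀ u ∈ U, ∃ p : UI → Strip, Continuous p ∧ (∀ t, p t ∈ U) ∧ ((p 0).2 : ℝ) = 1 ∧ p 1 = u
  clU : closure U ⊆ U ∪ Xt
  key : ∀ S ⊆ Xt, IsCompact S → ∀ O, IsOpen O → S = Xt ∩ O → S = ∅

lemma IsEAC.ctx {X Um Up : Set Ann} (hX : IsEAC X Um Up) : Ctx (pr ⁻¹' Up) (pr ⁻¹' X) where
  openU := (Up_open hX).preimage pr_cont
  closedX := hX.compact.isClosed.preimage pr_cont
  disj := fun z hz hz' => by
    have : pr z ∈ Xᶜ := by rw [hX.cover]; exact Or.inr hz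
    exact this hz'
  shiftU := by simp
  shiftX := by simp
  ltone := fun z hz => (hX.inInterior _ hz).2
  top := fun z hz => top_sub hX _ hz
  joined := fun u hu => joinedL hX hu
  clU := fun z hz => by
    by_contra hn
    rw [mem_union, not_or] at hn
    have : pr z ∈ Um ∪ Up := hX.cover ▸ hn.2
    rcases this with h | h
    · obtain ⟨b, hb1, hb2⟩ := mem_closure_iff.1 hz (pr ⁻¹' Um) ((Um_open hX).preimage pr_cont) h
      exact disjoint_left.1 (Up_Um_disj hX) hb2 hb1
    · exact hn.1 h
  key := fun S hS hc O hO h => key hX hS hc hO h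

end OAB


open Set Function MeasureTheory Filter Topology

namespace OAB

open Complex

lemma isCompact_of_bdd {S : Set Strip} (hcl : IsClosed S) (N : ℝ) (h : ∀ s ∈ S, |s.1| ≤ N) :
    IsCompact S := by
  have : IsCompact (Icc (-N) N ×ˢ (univ : Set II)) := isCompact_Icc.prod isCompact_univ
  exact this.of_isClosed_subset hcl (fun s hs => ⟨abs_le.1 (h s hs), mem_univ _⟩)

lemma range_bdd {p : UI → Strip} (hp : Continuous p) : ∃ N, ∀ t, |(p t).1| < N := by
  obtain ⟨N, hN⟩ := ((isCompact_range (f := fun t => (p t).1) (by fun_prop)).isBounded).exists_norm_le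
  exact ⟨N + 1, fun t => lt_of_le_of_lt (hN _ ⟨t, rfl⟩) (by linarith)⟩

lemma range_closed {p : UI → Strip} (hp : Continuous p) : IsClosed (range p) :=
  (isCompact_range hp).isClosed

/-- local constancy of the comparison -/
lemma Th_locconst {p q : UI → Strip} (hp : Continuous p) (hq : Continuous q)
    (hp0 : ((p 0).2 : ℝ) = 1) (hq0 : ((q 0).2 : ℝ) = 1) (h1 : p 1 = q 1) {w : Strip}
    (hwp : w ∉ range p) (hwq : w ∉ range q) :
    ∀ᶠ w' in 𝓝 w, (Th p w' = Th q w' ↔ Th p w = Th q w) := by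
  have cp := Th_cont hp hp0 hwp
  have cq := Th_cont hq hq0 hwq
  by_cases h : Th p w = Th q w
  · have : ∀ᶠ w' in 𝓝 w, Th p w' = Th q w' := by
      refine eventually_eq_of_exp cp cq (by simp [h, Real.pi_pos]) ?_
      filter_upwards [(range_closed hp).isOpen_compl.mem_nhds hwp,
        (range_closed hq).isOpen_compl.mem_nhds hwq] with y h2 h3
      rw [Th_exp hp h2, Th_exp hq h3, h1]
    filter_upwards [this] with y hy
    simp [hy, h]
  · filter_upwards [(cp.sub cq).eventually_ne (sub_ne_zero.2 h)] with y hy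
    have := sub_ne_zero.1 hy
    simp [this, h]

lemma Th_far {p q : UI → Strip} (hp : Continuous p) (hq : Continuous q) (h1 : p 1 = q 1) :
    ∃ N, ∀ w : Strip, Th p w ≠ Th q w → |w.1| ≤ N := by
  obtain ⟨N, hN⟩ := range_bdd hp
  obtain ⟨M, hM⟩ := range_bdd hq
  refine ⟨max N M, fun w hw => ?_⟩
  by_contra hc
  rw [not_le, max_lt_iff] at hc
  apply hw
  rcases lt_abs.1 hc.1 with h | h
  · have hMw : M < w.1 := by
      rcases lt_abs.1 hc.2 with h' | h'
      · exact h'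
      · have := abs_nonneg (p 0).1; have := hN 0; have := abs_nonneg (q 0).1; have := hM 0; linarith
    rw [Th_far_right hp (fun t => by have := (abs_lt.1 (hN t)).2; linarith),
      Th_far_right hq (fun t => by have := (abs_lt.1 (hM t)).2; linarith), h1]
  · have hMw : M < -w.1 := by
      rcases lt_abs.1 hc.2 with h' | h'
      · have := abs_nonneg (p 0).1; have := hN 0; have := abs_nonneg (q 0).1; have := hM 0; linarith
      · exact h'
    rw [Th_far_left hp (fun t => by have := (abs_lt.1 (hN t)).1; linarith),
      Th_far_left hq (fun t => by have := (abs_lt.1 (hM t)).1; linarith), h1]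

variable {U Xt : Set Strip}

/-- access paths -/
structure Acc (U Xt : Set Strip) (γ : UI → Strip) : Prop where
  cont : Continuous γ
  start : ((γ 0).2 : ℝ) = 1
  inU : ∀ t, t ≠ 1 → γ t ∈ U
  fin : γ 1 ∈ Xt
  tail : ∃ s : UI, s < 1 ∧ InjOn γ (Icc s 1)

lemma Acc.notMem (h : Ctx U Xt) {γ : UI → Strip} (hγ : Acc U Xt γ) {w : Strip} (hw : w ∈ Xt)
    (hne : w ≠ γ 1) : w ∉ range γ := by
  rintro ⟨t, rfl⟩
  by_cases ht : t = 1
  · exact hne (by rw [ht])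
  · exact h.disj _ (hγ.inU t ht) hw

/-- where the two angular functions differ -/
def Sdiff (Xt : Set Strip) (γ δ : UI → Strip) : Set Strip := {w | w ∈ Xt ∧ w ≠ γ 1 ∧ Th γ w ≠ Th δ w}

/-- a set which is open in `Xt`, closed after adding `x`, and bounded -/
structure Lam (Xt S : Set Strip) (x : Strip) : Prop where
  sub : S ⊆ Xt
  xX : x ∈ Xt
  xS : x ∉ S
  opn : ∃ O, IsOpen O ∧ S = Xt ∩ O
  cl : IsClosed (S ∪ {x})
  bdd : ∃ N, ∀ s ∈ S, |s.1| ≤ N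

lemma relopen {S Xt : Set Strip} (hS : S ⊆ Xt) (h : ∀ s ∈ S, ∀ᶠ w in 𝓝 s, w ∈ Xt → w ∈ S) :
    ∃ O, IsOpen O ∧ S = Xt ∩ O := by
  refine ⟨interior {w | w ∈ Xt → w ∈ S}, isOpen_interior, Subset.antisymm ?_ ?_⟩
  · intro s hs
    exact ⟨hS hs, mem_interior_iff_mem_nhds.2 (h s hs)⟩
  · rintro s ⟨h1, h2⟩
    exact interior_subset h2 h1

lemma lam_Sdiff (h : Ctx U Xt) {γ δ : UI → Strip} (hγ : Acc U Xt γ) (hδ : Acc U Xt δ)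
    (h1 : γ 1 = δ 1) : Lam Xt (Sdiff Xt γ δ) (γ 1) where
  sub := fun w hw => hw.1
  xX := hγ.fin
  xS := fun hw => hw.2.1 rfl
  opn := by
    refine relopen (fun w hw => hw.1) (fun s hs => ?_)
    filter_upwards [Th_locconst hγ.cont hδ.cont hγ.start hδ.start h1 (hγ.notMem h hs.1 hs.2.1)
      (hδ.notMem h hs.1 (h1 ▸ hs.2.1)), isOpen_ne.mem_nhds hs.2.1] with w hw hw2 hwX
    exact ⟨hwX, hw2, fun hc => hs.2.2 (hw.1 hc)⟩
  cl := by
    rw [← isOpen_compl_iff, isOpen_iff_mem_nhds]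
    intro w hw
    rw [mem_compl_iff, mem_union, not_or] at hw
    have hne : w ≠ γ 1 := hw.2
    by_cases hwX : w ∈ Xt
    · have he : Th γ w = Th δ w := by
        by_contra hc
        exact hw.1 ⟨hwX, hne, hc⟩
      filter_upwards [Th_locconst hγ.cont hδ.cont hγ.start hδ.start h1 (hγ.notMem h hwX hne)
        (hδ.notMem h hwX (h1 ▸ hne)), isOpen_ne.mem_nhds hne] with w' hw' hw2'
      rw [mem_compl_iff, mem_union, not_or]
      exact ⟨fun hc => hc.2.2 (hw'.2 he), hw2'⟩
    · filter_upwards [h.closedX.isOpen_compl.mem_nhds hwX, isOpen_ne.mem_nhds hne] with w' h1' h2'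
      rw [mem_compl_iff, mem_union, not_or]
      exact ⟨fun hc => h1' hc.1, h2'⟩
  bdd := by
    obtain ⟨N, hN⟩ := Th_far hγ.cont hδ.cont h1
    exact ⟨N, fun s hs => hN s hs.2.2⟩

lemma star (h : Ctx U Xt) {p q : UI → Strip} (hp : Continuous p) (hq : Continuous q)
    (hp0 : ((p 0).2 : ℝ) = 1) (hq0 : ((q 0).2 : ℝ) = 1) (h1 : p 1 = q 1)
    (hpU : ∀ t, p t ∈ U) (hqU : ∀ t, q t ∈ U) {w : Strip} (hw : w ∈ Xt) : Th p w = Th q w := by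
  have n1 : ∀ w ∈ Xt, w ∉ range p := by
    rintro _ hw ⟨t, rfl⟩; exact h.disj _ (hpU t) hw
  have n2 : ∀ w ∈ Xt, w ∉ range q := by
    rintro _ hw ⟨t, rfl⟩; exact h.disj _ (hqU t) hw
  let S : Set Strip := {w | w ∈ Xt ∧ Th p w ≠ Th q w}
  have hop : ∃ O, IsOpen O ∧ S = Xt ∩ O := by
    refine relopen (fun w hw => hw.1) (fun s hs => ?_)
    filter_upwards [Th_locconst hp hq hp0 hq0 h1 (n1 s hs.1) (n2 s hs.1)] with w hw hwX
    exact ⟨hwX, fun hc => hs.2 (hw.1 hc)⟩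
  have hcl : IsClosed S := by
    rw [← isOpen_compl_iff, isOpen_iff_mem_nhds]
    intro w hw
    by_cases hwX : w ∈ Xt
    · have he : Th p w = Th q w := by
        by_contra hc
        exact hw ⟨hwX, hc⟩
      filter_upwards [Th_locconst hp hq hp0 hq0 h1 (n1 w hwX) (n2 w hwX)] with w' hw' hc
      exact hc.2 (hw'.2 he)
    · filter_upwards [h.closedX.isOpen_compl.mem_nhds hwX] with w' h1' hc
      exact h1' hc.1
  obtain ⟨N, hN⟩ := Th_far hp hq h1
  obtain ⟨O, hO, hSO⟩ := hop
  have hS0 := h.key S (fun w hw => hw.1) (isCompact_of_bdd hcl N (fun s hs => hN s hs.2)) O hO hSO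
  by_contra hc
  have : w ∈ S := ⟨hw, hc⟩
  rw [hS0] at this
  exact this

/-- equivalence of access paths -/
def TEq (Xt : Set Strip) (γ δ : UI → Strip) : Prop :=
  γ 1 = δ 1 ∧ ∀ w ∈ Xt, w ≠ γ 1 → Th γ w = Th δ w

lemma TEq.Aa_left {γ γ' δ : UI → Strip} (e : TEq Xt γ γ') (hδ : δ 1 ∈ Xt)
    (hne : γ 1 ≠ δ 1) : Aa γ δ = Aa γ' δ := by
  unfold Aa; rw [e.1, e.2 _ hδ hne.symm]

lemma TEq.Aa_right {γ γ' δ : UI → Strip} (e : TEq Xt γ γ') (hδ : δ 1 ∈ Xt)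
    (hne : γ 1 ≠ δ 1) : Aa δ γ = Aa δ γ' := by
  rw [Aa_anti, Aa_anti γ', e.Aa_left hδ hne]

lemma aff_lt_one {r t : UI} (hr : r < 1) (ht : t ≠ 1) : aff r 1 t < 1 := by
  have h1 : (t : ℝ) < 1 := lt_of_le_of_ne t.2.2 (fun hc => ht (Subtype.ext hc))
  have h2 : (r : ℝ) < 1 := hr
  show (1 - (t : ℝ)) * r + t * 1 < 1
  nlinarith

lemma le_aff {r t : UI} : r ≤ aff r 1 t := by
  show (r : ℝ) ≤ (1 - (t : ℝ)) * r + t * 1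
  nlinarith [t.2.1, r.2.2]

lemma aff_inj {r : UI} (hr : r < 1) : Injective (aff r 1) := by
  intro s t hst
  have h2 : (r : ℝ) < 1 := hr
  have : (1 - (s : ℝ)) * r + s * 1 = (1 - (t : ℝ)) * r + t * 1 := congrArg Subtype.val hst
  have h3 : ((s : ℝ) - t) * (1 - r) = 0 := by linarith
  rcases mul_eq_zero.1 h3 with h | h
  · exact Subtype.ext (by linarith)
  · linarith

lemma aff_zero_inj {r : UI} (hr : 0 < r) : Injective (aff 0 r) := by
  intro s t hst
  have h2 : (0 : ℝ) < r := hr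
  have : (1 - (s : ℝ)) * 0 + s * r = (1 - (t : ℝ)) * 0 + t * r := congrArg Subtype.val hst
  have h3 : ((s : ℝ) - t) * r = 0 := by linarith
  rcases mul_eq_zero.1 h3 with h | h
  · exact Subtype.ext (by linarith)
  · linarith

lemma aff_aff (r t s : UI) : aff r 1 (aff t 1 s) = aff (aff r 1 t) 1 s := by
  ext; simp [aff]; ring

lemma aff_zero_le {r t : UI} : aff 0 r t ≤ r := by
  show (1 - (t : ℝ)) * 0 + t * r ≤ r
  nlinarith [t.2.2, r.2.1]

/-- replace the beginning of an access path -/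
lemma rebase (h : Ctx U Xt) {γ p : UI → Strip} (hγ : Acc U Xt γ) {r : UI} (hr : r < 1)
    (hp : Continuous p) (hp0 : ((p 0).2 : ℝ) = 1) (hpU : ∀ t, p t ∈ U) (hp1 : p 1 = γ r) :
    Acc U Xt (cat p (γ ∘ aff r 1)) ∧ TEq Xt γ (cat p (γ ∘ aff r 1)) := by
  have hc2 : Continuous (γ ∘ aff r 1) := hγ.cont.comp (aff_continuous _ _)
  have hj : p 1 = (γ ∘ aff r 1) 0 := by simp [hp1]
  refine ⟨⟨cat_cont hp hc2 hj, by simpa using hp0, fun t ht => ?_, by simpa using hγ.fin, ?_⟩,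
    by simp, fun w hw hne => ?_⟩
  · exact cat_ne_one hpU (fun s hs => hγ.inU _ (aff_lt_one hr hs).ne) ht
  · obtain ⟨s, hs1, hs2⟩ := hγ.tail
    let σ : UI := max half s
    have h1 : (1 / 2 : ℝ) < 1 := by norm_num
    have hσ : σ < 1 := max_lt h1 hs1
    refine ⟨aff half 1 σ, aff_lt_one h1 hσ.ne, ?_⟩
    have key : ∀ t ∈ Icc (aff half 1 σ) 1, ∃ u, t = aff half 1 u ∧ s ≤ aff r 1 u ∧
        cat p (γ ∘ aff r 1) t = γ (aff r 1 u) := by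
      intro t ht
      have e1 : (1 - (σ : ℝ)) * (1 / 2) + σ * 1 ≤ t := ht.1
      have e2 : (t : ℝ) ≤ 1 := ht.2
      have e0 := σ.2.1
      let u : UI := ⟨2 * t - 1, by linarith, by linarith⟩
      have hu : t = aff half 1 u := by
        apply Subtype.ext; show (t : ℝ) = (1 - (2 * (t : ℝ) - 1)) * (1 / 2) + (2 * t - 1) * 1; ring
      refine ⟨u, hu, ?_, ?_⟩
      · have e3 : (s : ℝ) ≤ σ := le_max_right half s
        show (s : ℝ) ≤ (1 - (2 * (t : ℝ) - 1)) * r + (2 * t - 1) * 1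
        nlinarith [r.2.1]
      · have := congrFun (cat_right p (γ ∘ aff r 1) hj) u
        rw [hu]; exact this
    intro a ha b hb hab
    obtain ⟨u, rfl, hu2, hu3⟩ := key a ha
    obtain ⟨v, rfl, hv2, hv3⟩ := key b hb
    rw [hu3, hv3] at hab
    have := aff_inj hr (hs2 ⟨hu2, unitInterval.le_one'⟩ ⟨hv2, unitInterval.le_one'⟩ hab)
    rw [this]
  · have hw1 : w ∉ range γ := hγ.notMem h hw hne
    rw [Th_split hγ.cont hw1 r, Th_cat hp hc2 hj]
    · congr 1
      refine star h (hγ.cont.comp (aff_continuous _ _)) hp (by simpa using hγ.start) hp0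
        (by simp [hp1]) (fun t => hγ.inU _ (lt_of_le_of_lt aff_zero_le hr).ne) hpU hw
    · rintro ⟨t, rfl⟩; exact h.disj _ (hpU t) hw
    · rintro ⟨t, rfl⟩; exact hw1 ⟨_, rfl⟩

end OAB


open Set Function MeasureTheory Filter Topology

namespace OAB

open Complex

variable {U Xt : Set Strip} {x0 : Strip}

/-- straight segments -/
noncomputable def seg (z w : Strip) (t : UI) : Strip :=
  ((1 - (t : ℝ)) * z.1 + t * w.1, ⟨(1 - (t : ℝ)) * z.2 + t * w.2, by
    have := t.2.1; have := t.2.2; have := z.2.2.1; have := z.2.2.2; have := w.2.2.1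
    have := w.2.2.2
    constructor <;> nlinarith⟩)

@[simp] lemma seg_zero (z w : Strip) : seg z w 0 = z := by apply strip_ext <;> simp [seg]
@[simp] lemma seg_one (z w : Strip) : seg z w 1 = w := by apply strip_ext <;> simp [seg]
@[simp] lemma seg_fst (z w : Strip) (t : UI) : (seg z w t).1 = (1 - (t : ℝ)) * z.1 + t * w.1 := rfl
@[simp] lemma seg_snd (z w : Strip) (t : UI) :
    ((seg z w t).2 : ℝ) = (1 - (t : ℝ)) * z.2 + t * w.2 := rfl

lemma seg_cont_param : Continuous (fun q : Strip × Strip × UI => seg q.1 q.2.1 q.2.2) := by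
  unfold seg; fun_prop

lemma seg_cont (z w : Strip) : Continuous (seg z w) := by
  unfold seg; fun_prop

lemma seg_inj {z w : Strip} (h : z ≠ w) : Injective (seg z w) := by
  intro s t hst
  have h1 : (1 - (s : ℝ)) * z.1 + s * w.1 = (1 - (t : ℝ)) * z.1 + t * w.1 := congrArg Prod.fst hst
  have h2 : (1 - (s : ℝ)) * z.2 + s * w.2 = (1 - (t : ℝ)) * z.2 + t * w.2 :=
    congrArg (fun q : Strip => (q.2 : ℝ)) hst
  have e1 : ((s : ℝ) - t) * (w.1 - z.1) = 0 := by linarith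
  have e2 : ((s : ℝ) - t) * (w.2 - z.2) = 0 := by linarith
  by_contra hne
  have hne' : (s : ℝ) - t ≠ 0 := fun hc => hne (Subtype.ext (by linarith))
  have f1 := (mul_eq_zero.1 e1).resolve_left hne'
  have f2 := (mul_eq_zero.1 e2).resolve_left hne'
  exact h (strip_ext (by linarith) (by linarith))

/-- top point -/
noncomputable def tp (a : ℝ) : Strip := (a, ⟨1, by norm_num, le_rfl⟩)
@[simp] lemma tp_fst (a : ℝ) : (tp a).1 = a := rfl
@[simp] lemma tp_snd (a : ℝ) : ((tp a).2 : ℝ) = 1 := rfl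

lemma eq_tp {z : Strip} (h : (z.2 : ℝ) = 1) : z = tp z.1 := strip_ext rfl h

structure Base (Xt : Set Strip) (x0 : Strip) : Prop where
  mem : x0 ∈ Xt
  fst : x0.1 = 0
  mx : ∀ z ∈ Xt, z.1 = 0 → (z.2 : ℝ) ≤ x0.2

/-- the vertical arcs -/
noncomputable def be (x0 : Strip) (i : ℤ) : UI → Strip := seg (tp i) (shiftPt i x0)

def Bc (x0 : Strip) (s : Set ℤ) : Set Strip := {z | (∃ i ∈ s, z.1 = (i : ℝ)) ∧ (x0.2 : ℝ) ≤ z.2}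

lemma Bc_closed (x0 : Strip) (s : Set ℤ) : IsClosed (Bc x0 s) := by
  have h1 : IsClosed ((fun n : ℤ => (n : ℝ)) '' s) :=
    Int.isClosedEmbedding_coe_real.isClosedMap _ (isClosed_discrete s)
  have h2 : Bc x0 s = Prod.fst ⁻¹' ((fun n : ℤ => (n : ℝ)) '' s) ∩
      {z : Strip | (x0.2 : ℝ) ≤ z.2} := by
    ext z
    simp only [Bc, mem_ofPred_eq, mem_inter_iff, mem_preimage, mem_image]
    constructor
    · rintro ⟨⟨i, h, e⟩, h'⟩; exact ⟨⟨i, h, e.symm⟩, h'⟩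
    · rintro ⟨⟨i, h, e⟩, h'⟩; exact ⟨⟨i, h, e.symm⟩, h'⟩
  rw [h2]
  exact (h1.preimage continuous_fst).inter (isClosed_le (by fun_prop) (by fun_prop))

lemma Xt_Bc (h : Ctx U Xt) (b : Base Xt x0) {s : Set ℤ} {w : Strip} (hw : w ∈ Xt)
    (hB : w ∈ Bc x0 s) : ∃ i ∈ s, w = shiftPt i x0 := by
  obtain ⟨⟨i, hi, e⟩, h2⟩ := hB
  refine ⟨i, hi, strip_ext (by simp [b.fst, e]) ?_⟩
  have := b.mx (shiftPt (-i) w) ((h.shiftX _ _).2 hw) (by simp [e])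
  exact le_antisymm this h2

lemma be_zero (x0 : Strip) (i : ℤ) : be x0 i 0 = tp i := by simp [be]
lemma be_one (x0 : Strip) (i : ℤ) : be x0 i 1 = shiftPt i x0 := by simp [be]

lemma be_fst (b : Base Xt x0) (i : ℤ) (t : UI) : (be x0 i t).1 = i := by
  simp [be, b.fst]; ring

lemma be_snd (x0 : Strip) (i : ℤ) (t : UI) : ((be x0 i t).2 : ℝ) = (1 - t) + t * x0.2 := by
  simp [be]

lemma be_Bc (b : Base Xt x0) (i : ℤ) (t : UI) : be x0 i t ∈ Bc x0 {i} := by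
  refine ⟨⟨i, rfl, be_fst b i t⟩, ?_⟩
  rw [be_snd]
  nlinarith [t.2.1, t.2.2, height_le x0]

lemma vert_inU (h : Ctx U Xt) (b : Base Xt x0) {z : Strip} {i : ℤ} (h1 : z.1 = i)
    (h2 : (x0.2 : ℝ) < z.2) : z ∈ U := by
  have hpre : IsPreconnected (range (seg (tp i) z)) := isPreconnected_range (seg_cont _ _)
  have hnX : ∀ t, seg (tp i) z t ∉ Xt := by
    intro t ht
    have := b.mx _ ((h.shiftX (-i) _).2 ht) (by simp [h1]; ring)
    simp at this
    nlinarith [t.2.1, t.2.2, height_le z]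
  have hsub := hpre.subset_of_closure_inter_subset h.openU
    ⟨tp i, ⟨0, by simp⟩, h.top _ rfl⟩ (by
      rintro _ ⟨h3, t, rfl⟩
      rcases h.clU h3 with h4 | h4
      · exact h4
      · exact absurd h4 (hnX t))
  exact hsub ⟨1, by simp⟩

lemma be_acc (h : Ctx U Xt) (b : Base Xt x0) (i : ℤ) : Acc U Xt (be x0 i) where
  cont := seg_cont _ _
  start := by simp [be]
  inU := fun t ht => by
    refine vert_inU h b (be_fst b i t) ?_
    rw [be_snd]
    have h1 : (t : ℝ) < 1 := lt_of_le_of_ne t.2.2 (fun hc => ht (Subtype.ext hc))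
    have h2 := h.ltone _ b.mem
    nlinarith
  fin := by rw [be_one]; exact (h.shiftX _ _).2 b.mem
  tail := ⟨0, by simp, (seg_inj (fun hc => by
    have := congrArg (fun z : Strip => (z.2 : ℝ)) hc
    have h2 := h.ltone _ b.mem
    simp at this; linarith)).injOn⟩

lemma be_inj (h : Ctx U Xt) (b : Base Xt x0) (i : ℤ) : Injective (be x0 i) :=
  seg_inj (fun hc => by
    have := congrArg (fun z : Strip => (z.2 : ℝ)) hc
    have h2 := h.ltone _ b.mem
    simp at this; linarith)

lemma exists_pos_near {P : UI → Prop} (h : ∀ᶠ s in 𝓝 (0 : UI), P s) : ∃ s, 0 < s ∧ P s := by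
  obtain ⟨ε, hε, hb⟩ := Metric.mem_nhds_iff.1 h
  have hm : 0 < min (ε / 2) 1 := lt_min (by linarith) one_pos
  let s : UI := ⟨min (ε / 2) 1, hm.le, min_le_right _ _⟩
  refine ⟨s, hm, hb ?_⟩
  rw [Metric.mem_ball, Subtype.dist_eq, Real.dist_eq]
  show |min (ε / 2) 1 - 0| < ε
  rw [sub_zero, abs_of_pos hm]
  exact lt_of_le_of_lt (min_le_left _ _) (by linarith)

lemma aff_gt {r t : UI} (hr : r < 1) (ht : 0 < t) : r < aff r 1 t := by
  have h1 : (r : ℝ) < 1 := hr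
  have h2 : (0 : ℝ) < t := ht
  show (r : ℝ) < (1 - (t : ℝ)) * r + t * 1
  nlinarith

lemma sidepath (h : Ctx U Xt) (b : Base Xt x0) (s : Set ℤ) {u : Strip} (hu : u ∈ U)
    (hB : u ∉ Bc x0 s) : ∃ p : UI → Strip, Continuous p ∧ (∀ t, p t ∈ U ∧ p t ∉ Bc x0 s) ∧
      ((p 0).2 : ℝ) = 1 ∧ p 1 = u := by
  obtain ⟨q, hq, hqU, hq0, hq1⟩ := h.joined u hu
  by_cases hne : ∃ t, q t ∈ Bc x0 s
  swap
  · push Not at hne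
    exact ⟨q, hq, fun t => ⟨hqU t, hne t⟩, hq0, hq1⟩
  have hK : IsCompact {t | q t ∈ Bc x0 s} := ((Bc_closed x0 s).preimage hq).isCompact
  obtain ⟨t₀, ht₀, hmax⟩ := hK.exists_isGreatest hne
  have ht₀1 : t₀ < 1 := by
    refine lt_of_le_of_ne unitInterval.le_one' ?_
    rintro rfl
    exact hB (hq1 ▸ ht₀)
  obtain ⟨⟨i, hi, ei⟩, hle⟩ := ht₀
  have hlt : (x0.2 : ℝ) < (q t₀).2 := by
    refine lt_of_le_of_ne hle (fun hc => ?_)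
    have : q t₀ = shiftPt i x0 := strip_ext (by simp [b.fst, ei]) hc.symm
    exact h.disj _ (hqU t₀) (this ▸ (h.shiftX _ _).2 b.mem)
  have ev1 : ∀ᶠ t in 𝓝 t₀, ∀ v ∈ (univ : Set UI), seg (tp (q t).1) (q t) v ∈ U := by
    apply isCompact_univ.eventually_forall_of_forall_eventually
    intro v _
    have hc : Continuous (fun p : UI × UI => seg (tp (q p.1).1) (q p.1) p.2) := by
      unfold seg tp; fun_prop
    apply (h.openU.preimage hc).mem_nhds
    refine vert_inU h b (i := i) (by simp [ei]; ring) ?_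
    simp
    nlinarith [v.2.1, v.2.2, height_le (q t₀)]
  have ev2 : ∀ᶠ t in 𝓝 t₀, (x0.2 : ℝ) < (q t).2 := by
    have : Continuous (fun t => ((q t).2 : ℝ)) := by fun_prop
    exact this.continuousAt.eventually (lt_mem_nhds hlt)
  have htend : Tendsto (aff t₀ 1) (𝓝 0) (𝓝 t₀) := by
    have := (aff_continuous t₀ 1).tendsto 0
    rwa [aff_zero] at this
  obtain ⟨v, hv0, hv1, hv2⟩ := exists_pos_near (htend.eventually (ev1.and ev2))
  set t := aff t₀ 1 v with ht
  have htt : t₀ < t := aff_gt ht₀1 hv0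
  have hnB : ∀ t' , t ≤ t' → q t' ∉ Bc x0 s := fun t' h1 h2 => absurd (hmax h2) (not_le.2 (lt_of_lt_of_le htt h1))
  have hj : seg (tp (q t).1) (q t) 1 = (q ∘ aff t 1) 0 := by simp
  refine ⟨cat (seg (tp (q t).1) (q t)) (q ∘ aff t 1),
    cat_cont (seg_cont _ _) (hq.comp (aff_continuous _ _)) hj, ?_, by simp, by simp [hq1]⟩
  intro a
  rcases cat_range_sub (seg (tp (q t).1) (q t)) (q ∘ aff t 1) a with ⟨c, hc⟩ | ⟨c, hc⟩
  · rw [← hc]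
    refine ⟨hv1 c (mem_univ _), ?_⟩
    rintro ⟨⟨j, hj1, hj2⟩, -⟩
    refine hnB t le_rfl ⟨⟨j, hj1, ?_⟩, hv2.le⟩
    rw [← hj2]; simp; ring
  · rw [← hc]
    exact ⟨hqU _, hnB _ le_aff⟩

/-- good tail together with a good initial path -/
lemma rep0 (h : Ctx U Xt) (b : Base Xt x0) (s : Set ℤ) {γ : UI → Strip} (hγ : Acc U Xt γ)
    (hs : ∀ i ∈ s, γ 1 ≠ shiftPt i x0) :
    ∃ r : UI, r < 1 ∧ InjOn γ (Icc r 1) ∧ (∀ t, r ≤ t → γ t ∉ Bc x0 s ∧ ((γ t).2 : ℝ) < 1) ∧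
      ∃ p : UI → Strip, Continuous p ∧ (∀ t, p t ∈ U ∧ p t ∉ Bc x0 s) ∧
      ((p 0).2 : ℝ) = 1 ∧ p 1 = γ r := by
  have hw : γ 1 ∉ Bc x0 s := fun hc => by
    obtain ⟨i, hi, e⟩ := Xt_Bc h b hγ.fin hc
    exact hs i hi e
  obtain ⟨s₁, hs1, hs2⟩ := hγ.tail
  have ev : ∀ᶠ t in 𝓝 (1 : UI), γ t ∉ Bc x0 s ∧ ((γ t).2 : ℝ) < 1 := by
    have c1 := hγ.cont
    have : Continuous (fun t => ((γ t).2 : ℝ)) := by fun_prop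
    exact (hγ.cont.continuousAt.eventually ((Bc_closed x0 s).isOpen_compl.mem_nhds hw)).and
      (this.continuousAt.eventually (gt_mem_nhds (h.ltone _ hγ.fin)))
  obtain ⟨r0, hr0, hr0'⟩ := exists_Ioc_subset_of_mem_nhds ev ⟨0, by simp⟩
  obtain ⟨r1, hr1, hr1'⟩ := exists_between hr0
  let r := max r1 s₁
  have hr : r < 1 := max_lt hr1' hs1
  have hall : ∀ t, r ≤ t → γ t ∉ Bc x0 s ∧ ((γ t).2 : ℝ) < 1 := fun t ht =>
    hr0' ⟨lt_of_lt_of_le hr1 ((le_max_left _ _).trans ht), unitInterval.le_one'⟩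
  obtain ⟨p, hp, hpU, hp0, hp1⟩ := sidepath h b s (hγ.inU r hr.ne) (hall r le_rfl).1
  exact ⟨r, hr, hs2.mono (Icc_subset_Icc_left (le_max_right _ _)), hall, p, hp, hpU, hp0, hp1⟩

lemma cat_avoid {p γ : UI → Strip} {r : UI} {B : Set Strip} (hp : ∀ t, p t ∉ B)
    (hγ : ∀ t, r ≤ t → γ t ∉ B) (t : UI) : cat p (γ ∘ aff r 1) t ∉ B := by
  rcases cat_range_sub p (γ ∘ aff r 1) t with ⟨c, hc⟩ | ⟨c, hc⟩
  · rw [← hc]; exact hp c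
  · rw [← hc]; exact hγ _ le_aff

lemma rep (h : Ctx U Xt) (b : Base Xt x0) (s : Set ℤ) {γ : UI → Strip} (hγ : Acc U Xt γ)
    (hs : ∀ i ∈ s, γ 1 ≠ shiftPt i x0) :
    ∃ γ', Acc U Xt γ' ∧ TEq Xt γ γ' ∧ ∀ t, γ' t ∉ Bc x0 s := by
  obtain ⟨r, hr, -, hall, p, hp, hpU, hp0, hp1⟩ := rep0 h b s hγ hs
  obtain ⟨h1, h2⟩ := rebase h hγ hr hp hp0 (fun t => (hpU t).1) hp1
  exact ⟨_, h1, h2, cat_avoid (fun t => (hpU t).2) (fun t ht => (hall t ht).1)⟩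

/-- position of a path avoiding `be i` -/
lemma Aa_be_left (b : Base Xt x0) {γ : UI → Strip} (hc : Continuous γ)
    (h0 : ((γ 0).2 : ℝ) = 1) {i : ℤ} (hB : ∀ t, γ t ∉ Bc x0 {i}) (hlt : (γ 0).1 < i) :
    Aa γ (be x0 i) = Real.pi * I := by
  refine Aa_disjoint hc (seg_cont _ _) h0 (by simp [be]) ?_ (by simpa [be] using hlt)
  rw [Set.disjoint_left]
  rintro _ ⟨t, rfl⟩ ⟨t', e⟩
  exact hB t (e ▸ be_Bc b i t')

lemma Aa_be_right (b : Base Xt x0) {γ : UI → Strip} (hc : Continuous γ)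
    (h0 : ((γ 0).2 : ℝ) = 1) {i : ℤ} (hB : ∀ t, γ t ∉ Bc x0 {i}) (hlt : (i : ℝ) < (γ 0).1) :
    Aa γ (be x0 i) = -(Real.pi * I) := by
  rw [Aa_anti, Aa_disjoint (γ := be x0 i) (seg_cont _ _) hc (by simp [be]) h0 _ (by simpa [be] using hlt)]
  rw [Set.disjoint_right]
  rintro _ ⟨t, rfl⟩ ⟨t', e⟩
  exact hB t (e ▸ be_Bc b i t')

lemma piI_ne : (Real.pi * I : ℂ) ≠ -(Real.pi * I) := by
  intro hc
  have := congrArg Complex.im hc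
  simp at this
  linarith [Real.pi_pos]

lemma start_ne {γ : UI → Strip} (h0 : ((γ 0).2 : ℝ) = 1) {s : Set ℤ} {i : ℤ} (hi : i ∈ s)
    (hB : γ 0 ∉ Bc x0 s) : (γ 0).1 ≠ i := fun hc =>
  hB ⟨⟨i, hi, hc⟩, by rw [h0]; exact height_le x0⟩

lemma side (h : Ctx U Xt) (b : Base Xt x0) {γ : UI → Strip} (hγ : Acc U Xt γ) {i : ℤ}
    (hne : γ 1 ≠ shiftPt i x0) : Aa γ (be x0 i) = Real.pi * I ∨ Aa γ (be x0 i) = -(Real.pi * I) := by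
  obtain ⟨γ', h1, h2, h3⟩ := rep h b {i} hγ (by rintro j rfl; exact hne)
  rw [h2.Aa_left (be_acc h b i).fin (by rw [be_one]; exact hne)]
  rcases lt_or_gt_of_ne (start_ne h1.start (mem_singleton i) (h3 0)) with h4 | h4
  · left; exact Aa_be_left b h1.cont h1.start h3 h4
  · right; exact Aa_be_right b h1.cont h1.start h3 h4

lemma rep_side (h : Ctx U Xt) (b : Base Xt x0) {γ γ' : UI → Strip} (h1 : Acc U Xt γ')
    (h2 : TEq Xt γ γ') {i : ℤ} (hne : γ 1 ≠ shiftPt i x0) (h3 : ∀ t, γ' t ∉ Bc x0 {i}) :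
    (Aa γ (be x0 i) = Real.pi * I → (γ' 0).1 < i) ∧
    (Aa γ (be x0 i) = -(Real.pi * I) → (i : ℝ) < (γ' 0).1) := by
  rw [h2.Aa_left (be_acc h b i).fin (by rw [be_one]; exact hne)]
  rcases lt_or_gt_of_ne (start_ne h1.start (mem_singleton i) (h3 0)) with h4 | h4
  · refine ⟨fun _ => h4, fun hc => ?_⟩
    rw [Aa_be_left b h1.cont h1.start h3 h4] at hc
    exact absurd hc piI_ne
  · refine ⟨fun hc => ?_, fun _ => h4⟩
    rw [Aa_be_right b h1.cont h1.start h3 h4] at hc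
    exact absurd hc.symm piI_ne

lemma nocross (h : Ctx U Xt) (b : Base Xt x0) {i : ℤ} {p : UI → Strip} (hp : Continuous p)
    (hpU : ∀ t, p t ∈ U ∧ p t ∉ Bc x0 {i}) (h0 : ((p 0).2 : ℝ) = 1) (h1 : ((p 1).2 : ℝ) = 1)
    (hl : (p 0).1 < i) (hr : (i : ℝ) < (p 1).1) : False := by
  have hj : p 1 = seg (p 1) (tp (i + 1 : ℤ)) 0 := by simp
  have hpc : Continuous (cat p (seg (p 1) (tp (i + 1 : ℤ)))) := cat_cont hp (seg_cont _ _) hj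
  have hin : ∀ t, cat p (seg (p 1) (tp (i + 1 : ℤ))) t ∈ U ∧
      cat p (seg (p 1) (tp (i + 1 : ℤ))) t ∉ Bc x0 {i} := by
    intro t
    rcases cat_range_sub p (seg (p 1) (tp (i + 1 : ℤ))) t with ⟨c, hc⟩ | ⟨c, hc⟩
    · rw [← hc]; exact hpU c
    · rw [← hc]
      refine ⟨h.top _ (by simp [h1]), ?_⟩
      rintro ⟨⟨j, hj1, hj2⟩, -⟩
      rw [mem_singleton_iff] at hj1
      subst hj1
      simp at hj2
      have := c.2.1
      have := c.2.2
      rcases eq_or_lt_of_le c.2.1 with h0 | h0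
      · rw [← h0] at hj2; linarith
      · nlinarith
  have hba := be_acc h b (i + 1)
  obtain ⟨a1, a2⟩ := rebase h hba (r := 0) (by simp) hpc (by simpa using h0) (fun t => (hin t).1)
    (by simp [be_zero])
  have hne : be x0 (i + 1) 1 ≠ shiftPt i x0 := by
    rw [be_one]; intro hc
    have := congrArg Prod.fst hc
    simp at this
  have hav : ∀ t, be x0 (i + 1) t ∉ Bc x0 {i} := by
    rintro t ⟨⟨j, hj1, hj2⟩, -⟩
    rw [mem_singleton_iff] at hj1
    rw [be_fst b, hj1] at hj2
    push_cast at hj2; linarith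
  have := (rep_side h b a1 a2 hne (cat_avoid (fun t => (hin t).2) (fun t _ => hav t))).2
    (Aa_be_right b hba.cont hba.start hav (by simp [be_zero]))
  simp at this
  linarith

lemma nocross' (h : Ctx U Xt) (b : Base Xt x0) {i : ℤ} {p q : UI → Strip} (hp : Continuous p)
    (hq : Continuous q) (hpU : ∀ t, p t ∈ U ∧ p t ∉ Bc x0 {i}) (hqU : ∀ t, q t ∈ U ∧ q t ∉ Bc x0 {i})
    (h0 : ((p 0).2 : ℝ) = 1) (h1 : ((q 0).2 : ℝ) = 1) (he : p 1 = q 1)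
    (hl : (p 0).1 < i) (hr : (i : ℝ) < (q 0).1) : False := by
  have hj : p 1 = (q ∘ unitInterval.symm) 0 := by simp [he]
  refine nocross h b (p := cat p (q ∘ unitInterval.symm)) (i := i)
    (cat_cont hp (hq.comp unitInterval.continuous_symm) hj) ?_ (by simpa using h0)
    (by simpa using h1) (by simpa using hl) (by simpa using hr)
  intro t
  rcases cat_range_sub p (q ∘ unitInterval.symm) t with ⟨c, hc⟩ | ⟨c, hc⟩
  · rw [← hc]; exact hpU c
  · rw [← hc]; exact hqU _

lemma Tr (h : Ctx U Xt) (b : Base Xt x0) {γ δ : UI → Strip} (hγ : Acc U Xt γ) (hδ : Acc U Xt δ)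
    {i : ℤ} (h1 : γ 1 ≠ shiftPt i x0) (h2 : δ 1 ≠ shiftPt i x0) (h3 : γ 1 ≠ δ 1)
    (hR : Aa γ (be x0 i) = -(Real.pi * I)) (hL : Aa δ (be x0 i) = Real.pi * I) :
    Aa δ γ = Real.pi * I := by
  obtain ⟨γ', a1, a2, a3⟩ := rep h b {i} hγ (by rintro j rfl; exact h1)
  obtain ⟨δ', b1, b2, b3⟩ := rep h b {i} hδ (by rintro j rfl; exact h2)
  have hg := (rep_side h b a1 a2 h1 a3).2 hR
  have hd := (rep_side h b b1 b2 h2 b3).1 hL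
  rw [a2.Aa_right hδ.fin h3, b2.Aa_left a1.fin (by rw [← a2.1]; exact h3.symm)]
  refine Aa_disjoint b1.cont a1.cont b1.start a1.start ?_ (hd.trans hg)
  rw [Set.disjoint_left]
  rintro _ ⟨s, rfl⟩ ⟨t, e⟩
  by_cases hs : s = 1
  · subst hs
    by_cases ht : t = 1
    · subst ht; rw [← a2.1, ← b2.1] at e; exact h3 e
    · exact h.disj _ (a1.inU t ht) (e ▸ b1.fin)
  · by_cases ht : t = 1
    · subst ht; exact h.disj _ (b1.inU s hs) (e ▸ a1.fin)
    · have hs' : s < 1 := lt_of_le_of_ne unitInterval.le_one' hs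
      have ht' : t < 1 := lt_of_le_of_ne unitInterval.le_one' ht
      exact nocross' h b (i := i) (p := δ' ∘ aff 0 s) (q := γ' ∘ aff 0 t)
        (b1.cont.comp (aff_continuous _ _)) (a1.cont.comp (aff_continuous _ _))
        (fun v => ⟨b1.inU _ (lt_of_le_of_lt aff_zero_le hs').ne, b3 _⟩)
        (fun v => ⟨a1.inU _ (lt_of_le_of_lt aff_zero_le ht').ne, a3 _⟩)
        (by simpa using b1.start) (by simpa using a1.start) (by simp [e]) (by simpa using hd)
        (by simpa using hg)

lemma far_right (b : Base Xt x0) {γ : UI → Strip} (hγ : Acc U Xt γ) :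
    ∃ N : ℤ, ∀ i, i ≤ N → Aa γ (be x0 i) = -(Real.pi * I) ∧ γ 1 ≠ shiftPt i x0 := by
  obtain ⟨M, hM⟩ := range_bdd hγ.cont
  refine ⟨⌊-M⌋, fun i hi => ?_⟩
  have h1 : (i : ℝ) ≤ -M := le_trans (by exact_mod_cast hi) (Int.floor_le _)
  have h2 : ∀ t, (i : ℝ) < (γ t).1 := fun t => by have := (abs_lt.1 (hM t)).1; linarith
  refine ⟨Aa_be_right b hγ.cont hγ.start ?_ (h2 0), fun hc => ?_⟩
  · rintro t ⟨⟨j, hj1, hj2⟩, -⟩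
    rw [mem_singleton_iff] at hj1
    rw [hj1] at hj2
    linarith [h2 t]
  · have := congrArg Prod.fst hc
    simp [b.fst] at this
    linarith [h2 1]

lemma far_left (b : Base Xt x0) {γ : UI → Strip} (hγ : Acc U Xt γ) :
    ∃ N : ℤ, ∀ i, N ≤ i → Aa γ (be x0 i) = Real.pi * I ∧ γ 1 ≠ shiftPt i x0 := by
  obtain ⟨M, hM⟩ := range_bdd hγ.cont
  refine ⟨⌈M⌉, fun i hi => ?_⟩
  have h1 : M ≤ (i : ℝ) := le_trans (Int.le_ceil _) (by exact_mod_cast hi)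
  have h2 : ∀ t, (γ t).1 < (i : ℝ) := fun t => by have := (abs_lt.1 (hM t)).2; linarith
  refine ⟨Aa_be_left b hγ.cont hγ.start ?_ (h2 0), fun hc => ?_⟩
  · rintro t ⟨⟨j, hj1, hj2⟩, -⟩
    rw [mem_singleton_iff] at hj1
    rw [hj1] at hj2
    linarith [h2 t]
  · have := congrArg Prod.fst hc
    simp [b.fst] at this
    linarith [h2 1]

end OAB


open Set Function MeasureTheory Filter Topology

namespace OAB

open Complex

variable {U Xt : Set Strip} {x0 : Strip}

lemma splice {α τ : UI → Strip} (hα : Continuous α) (hτ : Continuous τ) (iα : Injective α)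
    (iτ : Injective τ) (hj : α 1 = τ 0) (hne : α 0 ≠ τ 1) :
    ∃ σ : UI → Strip, Continuous σ ∧ Injective σ ∧ σ 0 = α 0 ∧ σ 1 = τ 1 ∧
      ∀ t, σ t ∈ range α ∪ range τ := by
  have hK : IsCompact {s | α s ∈ range τ} := ((isCompact_range hτ).isClosed.preimage hα).isCompact
  obtain ⟨s₁, ⟨t₁, e⟩, hmin⟩ := hK.exists_isLeast ⟨1, ⟨0, hj.symm⟩⟩
  by_cases hs : s₁ = 0
  · have ht : t₁ < 1 := lt_of_le_of_ne unitInterval.le_one' (by rintro rfl; rw [hs] at e; exact hne e.symm)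
    exact ⟨τ ∘ aff t₁ 1, hτ.comp (aff_continuous _ _), iτ.comp (aff_inj ht), by simp [e, hs], by simp,
      fun t => Or.inr ⟨_, rfl⟩⟩
  have hs0 : 0 < s₁ := lt_of_le_of_ne unitInterval.nonneg' (Ne.symm hs)
  by_cases ht : t₁ = 1
  · exact ⟨α ∘ aff 0 s₁, hα.comp (aff_continuous _ _), iα.comp (aff_zero_inj hs0), by simp,
      by simp [← e, ht], fun t => Or.inl ⟨_, rfl⟩⟩
  have ht1 : t₁ < 1 := lt_of_le_of_ne unitInterval.le_one' ht
  refine ⟨cat (α ∘ aff 0 s₁) (τ ∘ aff t₁ 1), cat_cont (hα.comp (aff_continuous _ _))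
    (hτ.comp (aff_continuous _ _)) (by simp [e]), cat_inj (iα.comp (aff_zero_inj hs0))
    (iτ.comp (aff_inj ht1)) ?_, by simp, by simp, ?_⟩
  · intro s t hst
    have h1 : s₁ ≤ aff 0 s₁ s := hmin ⟨_, hst.symm⟩
    have h2 : aff 0 s₁ s = aff 0 s₁ 1 := by rw [aff_one]; exact le_antisymm aff_zero_le h1
    refine ⟨aff_zero_inj hs0 h2, ?_⟩
    simp only [comp_apply, h2, aff_one, ← e] at hst
    apply aff_inj ht1
    rw [aff_zero]; exact (iτ hst).symm
  · intro t
    rcases cat_range_sub (α ∘ aff 0 s₁) (τ ∘ aff t₁ 1) t with ⟨c, hc⟩ | ⟨c, hc⟩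
    · exact Or.inl ⟨_, hc⟩
    · exact Or.inr ⟨_, hc⟩

lemma seg_ball {u v w : Strip} {ε : ℝ} (hv : v ∈ Metric.ball u ε) (hw : w ∈ Metric.ball u ε) (t : UI) :
    seg v w t ∈ Metric.ball u ε := by
  rw [Metric.mem_ball, Prod.dist_eq, max_lt_iff, Subtype.dist_eq, Real.dist_eq, Real.dist_eq] at *
  rw [seg_fst, seg_snd]
  have h1 := t.2.1
  have h2 := t.2.2
  simp only [abs_lt] at *
  obtain ⟨⟨a1, a2⟩, a3, a4⟩ := hv
  obtain ⟨⟨b1, b2⟩, b3, b4⟩ := hw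
  have aux : ∀ a b c : ℝ, a < c → b < c → (1 - (t : ℝ)) * a + t * b < c := by
    intro a b c ha hb
    rcases eq_or_lt_of_le h1 with h | h
    · rw [← h]; linarith
    · nlinarith [mul_nonneg (sub_nonneg.2 h2) (sub_nonneg.2 ha.le)]
  refine ⟨⟨?_, ?_⟩, ?_, ?_⟩
  · linarith [aux (u.1 - v.1) (u.1 - w.1) ε (by linarith) (by linarith)]
  · linarith [aux (v.1 - u.1) (w.1 - u.1) ε (by linarith) (by linarith)]
  · linarith [aux (u.2 - v.2) (u.2 - w.2) ε (by linarith) (by linarith)]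
  · linarith [aux (v.2 - u.2) (w.2 - u.2) ε (by linarith) (by linarith)]

/-- points reachable by an arc -/
def Rch (W : Set Strip) (b u : Strip) : Prop :=
  u = b ∨ ∃ α : UI → Strip, Continuous α ∧ Injective α ∧ α 0 = b ∧ α 1 = u ∧ ∀ t, α t ∈ W

lemma Rch.step {W : Set Strip} {b c v u : Strip} {ε : ℝ} (hW : Metric.ball c ε ⊆ W)
    (hv : v ∈ Metric.ball c ε) (hu : u ∈ Metric.ball c ε) (h : Rch W b v) : Rch W b u := by
  by_cases hub : u = b
  · exact Or.inl hub
  by_cases huv : u = v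
  · rw [huv]; exact h
  right
  have hsW : ∀ t, seg v u t ∈ W := fun t => hW (seg_ball hv hu t)
  rcases h with rfl | ⟨α, h1, h2, h3, h4, h5⟩
  · exact ⟨seg v u, seg_cont _ _, seg_inj (Ne.symm huv), by simp, by simp, hsW⟩
  · obtain ⟨σ, a1, a2, a3, a4, a5⟩ := splice h1 (seg_cont v u) h2 (seg_inj (Ne.symm huv)) (by simp [h4])
      (by simp [h3]; exact Ne.symm hub)
    refine ⟨σ, a1, a2, by rw [a3, h3], by simp [a4], fun t => ?_⟩
    rcases a5 t with ⟨c, hc⟩ | ⟨c, hc⟩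
    · rw [← hc]; exact h5 c
    · rw [← hc]; exact hsW c

lemma arc_exists {W : Set Strip} (hW : IsOpen W) {p : UI → Strip} (hp : Continuous p)
    (hpW : ∀ t, p t ∈ W) (hne : p 0 ≠ p 1) :
    ∃ α : UI → Strip, Continuous α ∧ Injective α ∧ α 0 = p 0 ∧ α 1 = p 1 ∧ ∀ t, α t ∈ W := by
  have key : ∀ t : UI, ∀ᶠ s in 𝓝 t, (Rch W (p 0) (p s) ↔ Rch W (p 0) (p t)) := by
    intro t
    obtain ⟨ε, hε, hb⟩ := Metric.isOpen_iff.1 hW (p t) (hpW t)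
    filter_upwards [hp.continuousAt (Metric.ball_mem_nhds (p t) hε)] with s hs
    have h0 : p t ∈ Metric.ball (p t) ε := Metric.mem_ball_self hε
    exact ⟨fun h => h.step hb hs h0, fun h => h.step hb h0 hs⟩
  have hcl : IsClopen {t | Rch W (p 0) (p t)} := by
    constructor
    · rw [← isOpen_compl_iff, isOpen_iff_mem_nhds]
      intro t ht
      filter_upwards [key t] with s hs
      exact fun hc => ht (hs.1 hc)
    · rw [isOpen_iff_mem_nhds]
      intro t ht
      filter_upwards [key t] with s hs
      exact hs.2 ht
  have : {t | Rch W (p 0) (p t)} = univ := hcl.eq_univ ⟨0, Or.inl rfl⟩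
  have h1 : (1 : UI) ∈ {t | Rch W (p 0) (p t)} := by rw [this]; trivial
  rcases h1 with h | ⟨α, h1, h2, h3, h4, h5⟩
  · exact absurd h.symm hne
  · exact ⟨α, h1, h2, h3, h4, h5⟩

/-- injective representative avoiding a vertical -/
lemma rep_arc (h : Ctx U Xt) (b : Base Xt x0) (s : Set ℤ) {γ : UI → Strip} (hγ : Acc U Xt γ)
    (hs : ∀ i ∈ s, γ 1 ≠ shiftPt i x0) :
    ∃ γ', Acc U Xt γ' ∧ TEq Xt γ γ' ∧ (∀ t, γ' t ∉ Bc x0 s) ∧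
    ∃ σ, IsArcTo U σ (γ 1) ∧ σ 0 = γ' 0 ∧ ∀ t, σ t ∉ Bc x0 s := by
  obtain ⟨r, hr, hinj, hall, p, hp, hpU, hp0, hp1⟩ := rep0 h b s hγ hs
  obtain ⟨h1, h2⟩ := rebase h hγ hr hp hp0 (fun t => (hpU t).1) hp1
  refine ⟨_, h1, h2, cat_avoid (fun t => (hpU t).2) (fun t ht => (hall t ht).1), ?_⟩
  have hne : p 0 ≠ p 1 := fun hc => by
    have := (hall r le_rfl).2
    rw [← hp1, ← hc, hp0] at this
    exact lt_irrefl _ this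
  obtain ⟨α, a1, a2, a3, a4, a5⟩ := arc_exists (W := U \ Bc x0 s)
    (h.openU.sdiff (Bc_closed x0 s)) hp hpU hne
  have it : Injective (γ ∘ aff r 1) := fun u v huv =>
    aff_inj hr (hinj ⟨le_aff, unitInterval.le_one'⟩ ⟨le_aff, unitInterval.le_one'⟩ huv)
  obtain ⟨σ, b1, b2, b3, b4, b5⟩ := splice (τ := γ ∘ aff r 1) a1 (hγ.cont.comp (aff_continuous _ _))
    a2 it (by simp [a4, hp1]) (by
      intro hc
      simp at hc
      exact h.disj _ (a5 0).1 (hc ▸ hγ.fin))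
  refine ⟨σ, ⟨b1, b2, fun t ht => ?_, by simpa using b4⟩, by rw [b3, a3, cat_zero], fun t => ?_⟩
  · rcases b5 t with ⟨c, hc⟩ | ⟨c, hc⟩
    · rw [← hc]; exact (a5 c).1
    · rw [← hc]
      by_cases h1 : c = 1
      · exfalso; apply ht; apply b2; rw [← hc, b4, h1]
      · exact hγ.inU _ (aff_lt_one hr h1).ne
  · rcases b5 t with ⟨c, hc⟩ | ⟨c, hc⟩
    · rw [← hc]; exact (a5 c).2
    · rw [← hc]; exact (hall _ le_aff).1

lemma be_arc (h : Ctx U Xt) (b : Base Xt x0) (i : ℤ) : IsArcTo U (be x0 i) (shiftPt i x0) :=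
  ⟨(be_acc h b i).cont, be_inj h b i, (be_acc h b i).inU, be_one x0 i⟩

lemma prec_right (h : Ctx U Xt) (b : Base Xt x0) {γ : UI → Strip} (hγ : Acc U Xt γ) {i : ℤ}
    (hne : γ 1 ≠ shiftPt i x0) (hA : Aa γ (be x0 i) = -(Real.pi * I)) :
    PrecB 1 U (shiftPt i x0) (γ 1) := by
  obtain ⟨γ', h1, h2, h3, σ, h4, h5, h6⟩ := rep_arc h b {i} hγ (by rintro j rfl; exact hne)
  refine ⟨be x0 i, σ, be_arc h b i, h4, (be_acc h b i).start, by rw [h5]; exact h1.start, ?_, ?_⟩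
  · rw [Set.disjoint_left]
    rintro _ ⟨t, rfl⟩ ⟨t', e⟩
    exact h6 t' (e ▸ be_Bc b i t)
  · rw [h5, be_zero]; exact (rep_side h b h1 h2 hne h3).2 hA

lemma prec_left (h : Ctx U Xt) (b : Base Xt x0) {γ : UI → Strip} (hγ : Acc U Xt γ) {i : ℤ}
    (hne : γ 1 ≠ shiftPt i x0) (hA : Aa γ (be x0 i) = Real.pi * I) :
    PrecB 1 U (γ 1) (shiftPt i x0) := by
  obtain ⟨γ', h1, h2, h3, σ, h4, h5, h6⟩ := rep_arc h b {i} hγ (by rintro j rfl; exact hne)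
  refine ⟨σ, be x0 i, h4, be_arc h b i, by rw [h5]; exact h1.start, (be_acc h b i).start, ?_, ?_⟩
  · rw [Set.disjoint_left]
    rintro _ ⟨t', rfl⟩ ⟨t, e⟩
    exact h6 t' (e ▸ be_Bc b i t)
  · rw [h5, be_zero]; exact (rep_side h b h1 h2 hne h3).1 hA

lemma acc_of_arc (h : Ctx U Xt) {γ : UI → Strip} {z : Strip} (hz : z ∈ Xt) (hγ : IsArcTo U γ z) :
    ∃ γ', Acc U Xt γ' ∧ γ' 1 = z := by
  obtain ⟨h1, h2, h3, h4⟩ := hγ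
  obtain ⟨p, hp, hpU, hp0, hp1⟩ := h.joined (γ 0) (h3 0 (by simp))
  refine ⟨cat p γ, ⟨cat_cont hp h1 hp1, by simpa using hp0, fun t ht => cat_ne_one hpU h3 ht,
    by simp [h4, hz], half, ?_, ?_⟩, by simp [h4]⟩
  · show (1 / 2 : ℝ) < 1; norm_num
  · intro s hs t ht hst
    have e := cat_right p γ hp1
    have key : ∀ s : UI, half ≤ s → ∃ s', s = aff half 1 s' := by
      intro s hs
      have hs' : (1 / 2 : ℝ) ≤ s := hs
      refine ⟨⟨2 * s - 1, by linarith, by linarith [s.2.2]⟩, ?_⟩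
      ext; simp [aff, half]; ring
    obtain ⟨s', rfl⟩ := key s hs.1
    obtain ⟨t', rfl⟩ := key t ht.1
    have e1 := congrFun e s'
    have e2 := congrFun e t'
    simp only [comp_apply] at e1 e2
    rw [e1, e2] at hst
    rw [h2 hst]

lemma shiftx0_inj {i j : ℤ} (h : shiftPt i x0 = shiftPt j x0) : i = j := by
  have := congrArg Prod.fst h
  simp at this
  exact this

lemma be_be {i j : ℤ} (b : Base Xt x0) (hij : i < j) :
    Aa (be x0 i) (be x0 j) = Real.pi * I := by
  refine Aa_be_left (γ := be x0 i) b (seg_cont _ _) (by simp [be]) ?_ (by simp [be]; exact_mod_cast hij)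
  rintro t ⟨⟨l, hl1, hl2⟩, -⟩
  rw [mem_singleton_iff] at hl1
  rw [be_fst b, hl1] at hl2
  have : i = j := by exact_mod_cast hl2
  omega

lemma be_be' {i j : ℤ} (b : Base Xt x0) (hij : j < i) :
    Aa (be x0 i) (be x0 j) = -(Real.pi * I) := by
  rw [Aa_anti, be_be b hij]

/-- monotonicity in the index -/
lemma mono_left (h : Ctx U Xt) (b : Base Xt x0) {γ : UI → Strip} (hγ : Acc U Xt γ) {i j : ℤ}
    (hij : i ≤ j) (h1 : γ 1 ≠ shiftPt i x0) (h2 : γ 1 ≠ shiftPt j x0)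
    (hA : Aa γ (be x0 i) = Real.pi * I) : Aa γ (be x0 j) = Real.pi * I := by
  rcases eq_or_lt_of_le hij with rfl | hlt
  · exact hA
  exact Tr h b (be_acc h b j) hγ (by rw [be_one]; exact fun hc => hlt.ne' (shiftx0_inj hc)) h1
    (by rw [be_one]; exact h2.symm) (be_be' b hlt) hA

lemma mono_right (h : Ctx U Xt) (b : Base Xt x0) {γ : UI → Strip} (hγ : Acc U Xt γ) {i j : ℤ}
    (hij : i ≤ j) (h1 : γ 1 ≠ shiftPt i x0) (h2 : γ 1 ≠ shiftPt j x0)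
    (hA : Aa γ (be x0 j) = -(Real.pi * I)) : Aa γ (be x0 i) = -(Real.pi * I) := by
  rcases side h b hγ h1 with h3 | h3
  · rw [mono_left h b hγ hij h1 h2 h3] at hA; exact absurd hA piI_ne
  · exact h3

/-- discrete intermediate value -/
lemma dIVT {P : ℤ → Prop} {a c : ℤ} (hac : a ≤ c) (ha : P a) (hc : ¬ P c) :
    ∃ j, a ≤ j ∧ j < c ∧ P j ∧ ¬ P (j + 1) := by
  classical
  obtain ⟨j, ⟨h1, h2, h3⟩, h4⟩ := Int.exists_greatest_of_bdd (P := fun j => a ≤ j ∧ j < c ∧ P j)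
    ⟨c, fun z hz => hz.2.1.le⟩ ⟨a, le_rfl, lt_of_le_of_ne hac (by rintro rfl; exact hc ha), ha⟩
  refine ⟨j, h1, h2, h3, fun hP => ?_⟩
  by_cases hj : j + 1 < c
  · have := h4 (j + 1) ⟨by omega, hj, hP⟩; omega
  · have : j + 1 = c := by omega
    exact hc (this ▸ hP)

lemma idx (h : Ctx U Xt) (b : Base Xt x0) {γ : UI → Strip} (hγ : Acc U Xt γ) :
    ∃ k, AccIdxB 1 U (γ 1) x0 k ∧
      ((∀ i, γ 1 ≠ shiftPt i x0) → ∀ i, Aa γ (be x0 i) = -(Real.pi * I) → i ≤ k) := by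
  by_cases hex : ∃ k, γ 1 = shiftPt k x0
  · obtain ⟨k, hk⟩ := hex
    refine ⟨k, ⟨Or.inl hk.symm, ?_⟩, fun hc => absurd hk (hc k)⟩
    have := prec_left h b (be_acc h b k) (i := k + 1)
      (by rw [be_one]; intro hc; have := shiftx0_inj hc; omega) (be_be b (by omega))
    rwa [be_one, ← hk] at this
  · push Not at hex
    obtain ⟨N, hN⟩ := far_right b hγ
    obtain ⟨M, hM⟩ := far_left b hγ
    have hlt : N ≤ M := by
      by_contra hc
      have h1 := (hM N (by omega)).1
      rw [(hN N le_rfl).1] at h1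
      exact piI_ne h1.symm
    obtain ⟨j, h1, h2, h3, h4⟩ := dIVT (P := fun i => Aa γ (be x0 i) = -(Real.pi * I)) hlt (hN N le_rfl).1
      (by rw [(hM M le_rfl).1]; exact piI_ne)
    have h5 := (side h b hγ (hex (j + 1))).resolve_right h4
    refine ⟨j, ⟨Or.inr (prec_right h b hγ (hex j) h3), prec_left h b hγ (hex _) h5⟩, ?_⟩
    rintro - i hi
    by_contra hc
    rw [mono_left h b hγ (by omega : j + 1 ≤ i) (hex _) (hex _) h5] at hi
    exact piI_ne hi

end OAB


open Set Function MeasureTheory Filter Topology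

namespace OAB

open Complex

variable {U Xt : Set Strip} {x0 : Strip}

/-- the open fundamental domain -/
def Cc (U : Set Strip) (η : ℝ) : Set Strip :=
  connectedComponentIn (U \ (betaP η ∪ shiftSet 1 (betaP η))) topSeg

lemma mem_shiftSet {k : ℤ} {S : Set Strip} {z : Strip} : z ∈ shiftSet k S ↔ shiftPt (-k) z ∈ S := by
  constructor
  · rintro ⟨w, hw, rfl⟩; simpa using hw
  · intro h; exact ⟨_, h, by simp⟩

lemma V_mem (h : Ctx U Xt) {η : ℝ} {k : ℤ} {z : Strip} :
    z ∈ shiftSet k (Vset U η) ↔ z ∈ U ∧ shiftPt (-k) z ∈ closure (Cc U η) := by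
  rw [mem_shiftSet]
  show _ ∧ _ ↔ _
  rw [h.shiftU]; rfl

lemma topSeg_eq : topSeg = tp (1 / 2) := rfl

lemma dom_iff {η : ℝ} {z : Strip} : z ∈ U \ (betaP η ∪ shiftSet 1 (betaP η)) ↔
    z ∈ U ∧ ((z.1 = 0 ∨ z.1 = 1) → (z.2 : ℝ) ≤ η) := by
  rw [Set.mem_sdiff, mem_union, mem_shiftSet]
  show _ ∧ ¬ ((z.1 = 0 ∧ η < (z.2 : ℝ)) ∨ (z.1 + ((-1 : ℤ) : ℝ) = 0 ∧ η < (z.2 : ℝ))) ↔ _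
  have : z.1 + ((-1 : ℤ) : ℝ) = 0 ↔ z.1 = 1 := by
    push_cast; constructor <;> intro h <;> linarith
  rw [this, ← or_and_right, not_and, not_lt]

lemma top_dom (h : Ctx U Xt) {η : ℝ} {a : ℝ} (h0 : 0 < a) (h1 : a < 1) :
    tp a ∈ U \ (betaP η ∪ shiftSet 1 (betaP η)) := by
  rw [dom_iff]
  refine ⟨h.top _ rfl, ?_⟩
  rintro (hc | hc) <;> simp at hc <;> linarith

lemma Cc_of_preconn (h : Ctx U Xt) {η : ℝ} {Q : Set Strip} (hQ : IsPreconnected Q)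
    (hsub : Q ⊆ U \ (betaP η ∪ shiftSet 1 (betaP η))) {a : ℝ} (h0 : 0 < a) (h1 : a < 1)
    (ha : tp a ∈ Q) : Q ⊆ Cc U η := by
  have h2 : IsPreconnected (range (seg (tp a) topSeg)) := isPreconnected_range (seg_cont _ _)
  have h3 := IsPreconnected.union (tp a) ha (t := range (seg (tp a) topSeg)) ⟨0, by simp⟩ hQ h2
  refine subset_union_left.trans (h3.subset_connectedComponentIn (Or.inr ⟨1, by simp⟩) ?_)
  refine union_subset hsub ?_
  rintro _ ⟨t, rfl⟩
  have : seg (tp a) topSeg t = tp ((1 - t) * a + t * (1 / 2)) := by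
    apply strip_ext
    · simp [topSeg_eq]
    · simp [topSeg_eq]
  rw [this]
  have h4 := t.2.1
  have h5 := t.2.2
  apply top_dom h
  · rcases eq_or_lt_of_le h4 with h | h
    · rw [← h]; linarith
    · nlinarith
  · rcases eq_or_lt_of_le h4 with h | h
    · rw [← h]; linarith
    · nlinarith

lemma AccV (h : Ctx U Xt) (b : Base Xt x0) {γ : UI → Strip} (hγ : Acc U Xt γ) {j : ℤ}
    (hn1 : γ 1 ≠ shiftPt j x0) (hn2 : γ 1 ≠ shiftPt (j + 1) x0)
    (hA1 : Aa γ (be x0 j) = -(Real.pi * I)) (hA2 : Aa γ (be x0 (j + 1)) = Real.pi * I) :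
    AccFrom (shiftSet j (Vset U x0.2)) (γ 1) := by
  obtain ⟨r, hr, hinj, hall, p, hp, hpU, hp0, hp1⟩ := rep0 h b {j, j + 1} hγ
    (by rintro i (rfl | rfl); exacts [hn1, hn2])
  obtain ⟨a1, a2⟩ := rebase h hγ hr hp hp0 (fun t => (hpU t).1) hp1
  have hav := cat_avoid (B := Bc x0 {j, j + 1}) (γ := γ) (r := r) (fun t => (hpU t).2)
    (fun t ht => (hall t ht).1)
  have hsub1 : Bc x0 {j} ⊆ Bc x0 {j, j + 1} := by
    rintro z ⟨⟨i, hi, e⟩, h'⟩; exact ⟨⟨i, Or.inl hi, e⟩, h'⟩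
  have hsub2 : Bc x0 {j + 1} ⊆ Bc x0 {j, j + 1} := by
    rintro z ⟨⟨i, hi, e⟩, h'⟩; exact ⟨⟨i, Or.inr hi, e⟩, h'⟩
  have s1 := (rep_side h b a1 a2 hn1 (fun t hc => hav t (hsub1 hc))).2 hA1
  have s2 := (rep_side h b a1 a2 hn2 (fun t hc => hav t (hsub2 hc))).1 hA2
  set γ' := cat p (γ ∘ aff r 1) with hγ'
  have hpre : IsPreconnected ((fun t => shiftPt (-j) (γ' t)) '' Iio 1) :=
    isPreconnected_Iio.image _ ((shift_cont _).comp a1.cont).continuousOn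
  push_cast at s2
  have hcc := Cc_of_preconn h (η := x0.2) hpre (a := (γ' 0).1 - j) (by
    rintro _ ⟨t, ht, rfl⟩
    rw [dom_iff]
    refine ⟨(h.shiftU _ _).2 (a1.inU t (ne_of_lt ht)), fun hc => ?_⟩
    by_contra hcon
    apply hav t
    rw [not_le] at hcon
    rcases hc with hc | hc
    · refine ⟨⟨j, Or.inl rfl, ?_⟩, hcon.le⟩
      simp at hc; show (γ' t).1 = j; linarith
    · refine ⟨⟨j + 1, Or.inr rfl, ?_⟩, hcon.le⟩
      simp at hc; show (γ' t).1 = _; push_cast; linarith) (by linarith) (by linarith)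
    ⟨0, by simp, strip_ext (by simp; ring) (a1.start)⟩
  refine ⟨γ ∘ aff r 1, hγ.cont.comp (aff_continuous _ _), fun u v huv =>
    aff_inj hr (hinj ⟨le_aff, unitInterval.le_one'⟩ ⟨le_aff, unitInterval.le_one'⟩ huv), ?_, by simp⟩
  intro t ht
  rw [V_mem h]
  refine ⟨hγ.inU _ (aff_lt_one hr ht).ne, subset_closure (hcc ?_)⟩
  refine ⟨aff half 1 t, aff_lt_one (by show (1 / 2 : ℝ) < 1; norm_num) ht, ?_⟩
  have := congrFun (cat_right p (γ ∘ aff r 1) (by simp [hp1])) t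
  simp only [comp_apply] at this ⊢
  rw [hγ', this]

lemma colU (h : Ctx U Xt) (b : Base Xt x0) (i : ℤ) {y : II} (hy : (x0.2 : ℝ) < y) :
    ∀ᶠ a in 𝓝 (i : ℝ), ∀ v ∈ (univ : Set UI), seg (tp a) (a, y) v ∈ U := by
  apply isCompact_univ.eventually_forall_of_forall_eventually
  intro v _
  have hc : Continuous (fun p : ℝ × UI => seg (tp p.1) (p.1, y) p.2) := by
    unfold seg tp; fun_prop
  apply (h.openU.preimage hc).mem_nhds
  refine vert_inU h b (i := i) (by simp; ring) ?_
  rw [seg_snd]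
  show (x0.2 : ℝ) < (1 - v) * 1 + v * y
  nlinarith [v.2.1, v.2.2, y.2.2]

lemma col_Cc (h : Ctx U Xt) {a : ℝ} {y : II} (h0 : 0 < a) (h1 : a < 1)
    (hv : ∀ v ∈ (univ : Set UI), seg (tp a) (a, y) v ∈ U) (η : ℝ) : (a, y) ∈ Cc U η := by
  refine Cc_of_preconn h (isPreconnected_range (seg_cont (tp a) (a, y))) ?_ h0 h1
    ⟨0, by simp⟩ ⟨1, by simp⟩
  rintro _ ⟨v, rfl⟩
  rw [dom_iff]
  refine ⟨hv v trivial, ?_⟩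
  have e : (seg (tp a) (a, y) v).1 = a := by simp; ring
  rw [e]
  rintro (hc | hc) <;> linarith

lemma col_clos0 (h : Ctx U Xt) (b : Base Xt x0) {y : II} (hy : (x0.2 : ℝ) < y) (η : ℝ) :
    ((0 : ℝ), y) ∈ closure (Cc U η) := by
  have h1 := colU h b 0 hy
  rw [Int.cast_zero] at h1
  have h2 : ∀ᶠ a : ℝ in 𝓝[>] 0, (a, y) ∈ Cc U η := by
    have h3 : ∀ᶠ a : ℝ in 𝓝[>] 0, a ∈ Ioo (0 : ℝ) 1 := Ioo_mem_nhdsGT one_pos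
    have h4 : ∀ᶠ a : ℝ in 𝓝[>] 0, ∀ v ∈ (univ : Set UI), seg (tp a) (a, y) v ∈ U :=
      nhdsWithin_le_nhds h1
    filter_upwards [h3, h4] with a h3 h4
    exact col_Cc h h3.1 h3.2 h4 η
  have h5 : Tendsto (fun a : ℝ => (a, y)) (𝓝[>] 0) (𝓝 ((0 : ℝ), y)) :=
    (Continuous.tendsto (by fun_prop) 0).mono_left nhdsWithin_le_nhds
  exact mem_closure_of_tendsto h5 h2

lemma col_clos1 (h : Ctx U Xt) (b : Base Xt x0) {y : II} (hy : (x0.2 : ℝ) < y) (η : ℝ) :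
    ((1 : ℝ), y) ∈ closure (Cc U η) := by
  have h1 := colU h b 1 hy
  rw [Int.cast_one] at h1
  have h2 : ∀ᶠ a : ℝ in 𝓝[<] 1, (a, y) ∈ Cc U η := by
    have h3 : ∀ᶠ a : ℝ in 𝓝[<] 1, a ∈ Ioo (0 : ℝ) 1 := Ioo_mem_nhdsLT one_pos
    have h4 : ∀ᶠ a : ℝ in 𝓝[<] 1, ∀ v ∈ (univ : Set UI), seg (tp a) (a, y) v ∈ U :=
      nhdsWithin_le_nhds h1
    filter_upwards [h3, h4] with a h3 h4
    exact col_Cc h h3.1 h3.2 h4 η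
  have h5 : Tendsto (fun a : ℝ => (a, y)) (𝓝[<] 1) (𝓝 ((1 : ℝ), y)) :=
    (Continuous.tendsto (by fun_prop) 1).mono_left nhdsWithin_le_nhds
  exact mem_closure_of_tendsto h5 h2

lemma be_high (h : Ctx U Xt) (b : Base Xt x0) (i : ℤ) {t : UI} (ht : t ≠ 1) :
    (x0.2 : ℝ) < (be x0 i t).2 := by
  rw [be_snd]
  have h1 : (t : ℝ) < 1 := lt_of_le_of_ne t.2.2 (fun hc => ht (Subtype.ext hc))
  have h2 := h.ltone _ b.mem
  nlinarith

lemma accV_base0 (h : Ctx U Xt) (b : Base Xt x0) (i : ℤ) :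
    AccFrom (shiftSet i (Vset U x0.2)) (shiftPt i x0) := by
  refine ⟨be x0 i, (be_acc h b i).cont, be_inj h b i, fun t ht => ?_, be_one x0 i⟩
  rw [V_mem h]
  refine ⟨(be_acc h b i).inU t ht, ?_⟩
  have := col_clos0 h b (be_high h b i ht) x0.2
  convert this using 1
  exact strip_ext (by simp [be_fst b]) rfl

lemma accV_base1 (h : Ctx U Xt) (b : Base Xt x0) (i : ℤ) :
    AccFrom (shiftSet i (Vset U x0.2)) (shiftPt (i + 1) x0) := by
  refine ⟨be x0 (i + 1), (be_acc h b _).cont, be_inj h b _, fun t ht => ?_, be_one x0 _⟩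
  rw [V_mem h]
  refine ⟨(be_acc h b _).inU t ht, ?_⟩
  have := col_clos1 h b (be_high h b (i + 1) ht) x0.2
  convert this using 1
  exact strip_ext (by simp [be_fst b]) rfl

lemma accV_acc (h : Ctx U Xt) (b : Base Xt x0) {k i : ℤ} (hi : i = k ∨ i = k + 1) {w : Strip}
    (hw : w ∈ Xt) (hacc : AccFrom (shiftSet k (Vset U x0.2)) w) (hne : w ≠ shiftPt i x0) :
    ∃ γ, Acc U Xt γ ∧ γ 1 = w ∧ (∀ t, γ t ∉ Bc x0 {i}) ∧ (γ 0).1 = k + 1 / 2 := by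
  obtain ⟨α, c1, c2, c3, c4⟩ := hacc
  have hwB : w ∉ Bc x0 {i} := fun hc => by
    obtain ⟨j, hj, e⟩ := Xt_Bc h b hw hc
    rw [mem_singleton_iff] at hj
    exact hne (hj ▸ e)
  have ev : ∀ᶠ t in 𝓝 (1 : UI), α t ∉ Bc x0 {i} :=
    c1.continuousAt.eventually ((Bc_closed x0 _).isOpen_compl.mem_nhds (by rw [c4]; exact hwB))
  obtain ⟨r0, hr0, hr0'⟩ := exists_Ioc_subset_of_mem_nhds ev ⟨0, by simp⟩
  obtain ⟨r, hr1, hr⟩ := exists_between hr0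
  have hall : ∀ t, r ≤ t → α t ∉ Bc x0 {i} := fun t ht =>
    hr0' ⟨lt_of_lt_of_le hr1 ht, unitInterval.le_one'⟩
  have hu := (V_mem h).1 (c3 r hr.ne)
  set W := U \ Bc x0 {i} with hW
  have hWo : IsOpen W := h.openU.sdiff (Bc_closed x0 _)
  set S := (fun z => shiftPt k z) '' Cc U x0.2 with hS
  have hSp : IsPreconnected S := isPreconnected_connectedComponentIn.image _ (shift_cont k).continuousOn
  have hSW : S ⊆ W := by
    rintro _ ⟨z, hz, rfl⟩
    have hz' := connectedComponentIn_subset _ _ hz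
    rw [dom_iff] at hz'
    have hzU : shiftPt k z ∈ U := (h.shiftU _ _).2 hz'.1
    refine ⟨hzU, ?_⟩
    rintro ⟨⟨j, hj1, hj2⟩, hj3⟩
    rw [mem_singleton_iff] at hj1
    subst hj1
    have e : (z.2 : ℝ) ≤ x0.2 := by
      apply hz'.2
      simp at hj2
      rcases hi with rfl | rfl
      · left; linarith
      · right; push_cast at hj2; linarith
    have : shiftPt k z = shiftPt j x0 := strip_ext (by rw [hj2]; simp [b.fst]) (le_antisymm e hj3)
    exact h.disj _ hzU (this ▸ (h.shiftX _ _).2 b.mem)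
  have hcl : α r ∈ closure S := by
    have h1 := mem_image_of_mem (fun z => shiftPt k z) hu.2
    have h2 := image_closure_subset_closure_image (shift_cont k) h1
    simpa using h2
  have huW : α r ∈ W := ⟨hu.1, hall r le_rfl⟩
  obtain ⟨v, hv1, hv2⟩ := mem_closure_iff.1 hcl _ (hWo.connectedComponentIn (x := α r))
    (mem_connectedComponentIn huW)
  have htS : shiftPt k topSeg ∈ S := ⟨topSeg, mem_connectedComponentIn (by
    rw [topSeg_eq]; exact top_dom h (by norm_num) (by norm_num)), rfl⟩
  have hmem : shiftPt k topSeg ∈ connectedComponentIn W (α r) := by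
    have := hSp.subset_connectedComponentIn hv2 hSW htS
    rwa [← connectedComponentIn_eq hv1] at this
  have hpc : IsPathConnected (connectedComponentIn W (α r)) := by
    rw [← (hWo.connectedComponentIn).isConnected_iff_isPathConnected]
    exact isConnected_connectedComponentIn_iff.2 huW
  obtain ⟨p, hp⟩ := hpc.joinedIn _ hmem _ (mem_connectedComponentIn huW)
  have hpW : ∀ t, p t ∈ W := fun t => connectedComponentIn_subset _ _ (hp t)
  have it : Injective (α ∘ aff r 1) := c2.comp (aff_inj hr)
  have hj : p 1 = (α ∘ aff r 1) 0 := by simp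
  refine ⟨cat p (α ∘ aff r 1), ⟨cat_cont p.continuous (c1.comp (aff_continuous _ _)) hj, ?_, ?_, ?_, ?_⟩,
    by simp [c4], cat_avoid (fun t => (hpW t).2) hall, ?_⟩
  · rw [cat_zero, p.source]; rfl
  · intro t ht
    refine cat_ne_one (fun s => (hpW s).1) (fun s hs => ?_) ht
    exact ((V_mem h).1 (c3 _ (aff_lt_one hr hs).ne)).1
  · simp [c4, hw]
  · refine ⟨half, by show (1 / 2 : ℝ) < 1; norm_num, ?_⟩
    intro s hs t ht hst
    have e := cat_right p (α ∘ aff r 1) hj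
    have key : ∀ s : UI, half ≤ s → ∃ s', s = aff half 1 s' := by
      intro s hs
      have hs' : (1 / 2 : ℝ) ≤ s := hs
      refine ⟨⟨2 * s - 1, by linarith, by linarith [s.2.2]⟩, ?_⟩
      ext; simp [aff, half]; ring
    obtain ⟨s', rfl⟩ := key s hs.1
    obtain ⟨t', rfl⟩ := key t ht.1
    have e1 := congrFun e s'
    have e2 := congrFun e t'
    rw [comp_apply] at e1 e2
    rw [e1, e2] at hst
    rw [it hst]
  · rw [cat_zero, p.source]; simp [topSeg_eq]; ring

lemma accV_right (h : Ctx U Xt) (b : Base Xt x0) {k : ℤ} {w : Strip}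
    (hw : w ∈ Xt) (hacc : AccFrom (shiftSet k (Vset U x0.2)) w) (hne : w ≠ shiftPt k x0) :
    ∃ γ, Acc U Xt γ ∧ γ 1 = w ∧ Aa γ (be x0 k) = -(Real.pi * I) := by
  obtain ⟨γ, h1, h2, h3, h4⟩ := accV_acc h b (Or.inl rfl) hw hacc hne
  exact ⟨γ, h1, h2, Aa_be_right b h1.cont h1.start h3 (by rw [h4]; linarith)⟩

lemma accV_left (h : Ctx U Xt) (b : Base Xt x0) {k : ℤ} {w : Strip}
    (hw : w ∈ Xt) (hacc : AccFrom (shiftSet k (Vset U x0.2)) w) (hne : w ≠ shiftPt (k + 1) x0) :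
    ∃ γ, Acc U Xt γ ∧ γ 1 = w ∧ Aa γ (be x0 (k + 1)) = Real.pi * I := by
  obtain ⟨γ, h1, h2, h3, h4⟩ := accV_acc h b (Or.inr rfl) hw hacc hne
  exact ⟨γ, h1, h2, Aa_be_left b h1.cont h1.start h3 (by rw [h4]; push_cast; linarith)⟩

end OAB


open Set Function MeasureTheory Filter Topology

namespace OAB

open Complex

/-- small circles -/
noncomputable def circ (z : Strip) (ε : ℝ) (h : |ε| ≤ 1 - |(z.2 : ℝ)|) (t : UI) : Strip :=
  (z.1 + ε * Real.cos (2 * Real.pi * t), ⟨z.2 + ε * Real.sin (2 * Real.pi * t), by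
    have h1 : |ε * Real.sin (2 * Real.pi * t)| ≤ |ε| := by
      rw [abs_mul]
      exact mul_le_of_le_one_right (abs_nonneg _) (Real.abs_sin_le_one _)
    have h2 := neg_abs_le (z.2 : ℝ)
    have h3 := le_abs_self (z.2 : ℝ)
    have h4 := abs_le.1 h1
    constructor <;> linarith [h4.1, h4.2]⟩)

lemma circ_cont (z : Strip) (ε : ℝ) (h : |ε| ≤ 1 - |(z.2 : ℝ)|) : Continuous (circ z ε h) := by
  unfold circ; fun_prop

lemma circ_cc (z : Strip) (ε : ℝ) (h : |ε| ≤ 1 - |(z.2 : ℝ)|) (t : UI) :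
    cc (circ z ε h t) - cc z = ε * exp ((2 * Real.pi * (t : ℝ) : ℝ) * I) := by
  rw [Complex.exp_mul_I, ← Complex.ofReal_cos, ← Complex.ofReal_sin]
  apply Complex.ext <;>
    simp only [sub_re, sub_im, cc_re, cc_im, circ, mul_re, mul_im, ofReal_re, ofReal_im, add_re, add_im,
      I_re, I_im] <;> ring

lemma circ_closed (z : Strip) (ε : ℝ) (h : |ε| ≤ 1 - |(z.2 : ℝ)|) : circ z ε h 1 = circ z ε h 0 := by
  apply cc_inj
  have h1 := circ_cc z ε h 1
  have h0 := circ_cc z ε h 0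
  have : cc (circ z ε h 1) - cc z = cc (circ z ε h 0) - cc z := by
    rw [h1, h0]; congr 1; simp
  exact sub_left_injective this

lemma bm_vlog_zero {g : UI → ℂ} (hg : Continuous g) (h : ∀ t, g t ≠ 0) (hc : g 1 = g 0)
    (hi : (∀ t, (g t).im ≤ 0) ∨ (∀ t, 0 ≤ (g t).im)) : vlog g = 0 := by
  rcases hi with hi | hi
  · rw [bm_vlog hg h hi, hc, sub_self]
  · rw [← vlog_neg hg h, bm_vlog (g := fun t => - g t) hg.neg (fun t => neg_ne_zero.2 (h t))
      (fun t => by simpa using hi t), hc, sub_self]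

lemma fam_int {Φ : ℝ → Strip → Strip} (hΦ : Continuous (fun p : ℝ × Strip => Φ p.1 p.2))
    (hinj : ∀ s, Injective (Φ s)) {a : ℝ} (ha : Φ a = id) {z : Strip} (hz : |(z.2 : ℝ)| < 1) (s : ℝ) :
    |((Φ s z).2 : ℝ)| < 1 := by
  have hε : |(1 - |(z.2 : ℝ)|)| ≤ 1 - |(z.2 : ℝ)| := by rw [abs_of_nonneg (by linarith)]
  set ε := 1 - |(z.2 : ℝ)| with hεd
  have hε0 : 0 < ε := by linarith
  set c := circ z ε hε with hc
  have hcne : ∀ t, c t ≠ z := fun t hh => by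
    have := circ_cc z ε hε t
    rw [← hc, hh, sub_self] at this
    have h2 : (ε : ℂ) * exp ((2 * Real.pi * (t : ℝ) : ℝ) * I) ≠ 0 :=
      mul_ne_zero (by exact_mod_cast hε0.ne') (Complex.exp_ne_zero _)
    exact h2 this.symm
  have hcc : Continuous c := circ_cont z ε hε
  let g : ℝ → UI → ℂ := fun s t => cc (Φ s (c t)) - cc (Φ s z)
  have hg0 : ∀ s t, g s t ≠ 0 := fun s t => cc_sub_ne (fun h => hcne t (hinj s h))
  have hg : Continuous (fun p : ℝ × UI => g p.1 p.2) := by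
    have h1 : Continuous (fun p : ℝ × UI => Φ p.1 (c p.2)) :=
      hΦ.comp (continuous_fst.prodMk (hcc.comp continuous_snd))
    have h2 : Continuous (fun p : ℝ × UI => Φ p.1 z) :=
      hΦ.comp (continuous_fst.prodMk continuous_const)
    exact (cc_cont.comp h1).sub (cc_cont.comp h2)
  have hgs : ∀ s, Continuous (g s) := fun s => hg.comp (by fun_prop : Continuous fun t : UI => (s, t))
  have hgc : ∀ s, g s 1 = g s 0 := fun s => by
    show cc (Φ s (c 1)) - _ = cc (Φ s (c 0)) - _
    rw [hc, circ_closed]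
  have hconst := const_of_exp_const (f := fun s => vlog (g s))
    (continuous_iff_continuousAt.2 fun s => vlog_continuousAt hg (hg0 s)) (c := 1)
    (fun s => by rw [exp_vlog (hgs s) (hg0 s), hgc, div_self (hg0 s 0)]) s a
  have hva : vlog (g a) = 2 * Real.pi * I := by
    rw [vlog_eq (l := fun t => (Real.log ε : ℂ) + ((2 * Real.pi * (t : ℝ) : ℝ) * I))
      (by fun_prop) (fun t => ?_)]
    · simp
    · show _ = cc (Φ a (c t)) - cc (Φ a z)
      rw [ha, id, id, hc, circ_cc, Complex.exp_add, ← Complex.ofReal_exp, Real.exp_log hε0]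
  have hb := (Φ s z).2.2
  by_contra hcon
  have hcase : ((Φ s z).2 : ℝ) = 1 ∨ ((Φ s z).2 : ℝ) = -1 := by
    rw [not_lt, le_abs] at hcon
    rcases hcon with h | h
    · left; linarith [hb.2]
    · right; linarith [hb.1]
  have hv0 : vlog (g s) = 0 := by
    refine bm_vlog_zero (hgs s) (hg0 s) (hgc s) ?_
    rcases hcase with h | h
    · left; intro t
      show (cc (Φ s (c t)) - cc (Φ s z)).im ≤ 0
      rw [sub_im, cc_im, cc_im, h]; linarith [(Φ s (c t)).2.2.2]
    · right; intro t
      show 0 ≤ (cc (Φ s (c t)) - cc (Φ s z)).im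
      rw [sub_im, cc_im, cc_im, h]; linarith [(Φ s (c t)).2.2.1]
  have : (0 : ℂ) = 2 * Real.pi * I := by rw [← hv0, ← hva]; exact hconst
  exact Complex.two_pi_I_ne_zero this.symm

lemma coe_sub_zero {a b : ℝ} (h : (a : AddCircle (1 : ℝ)) = b) : ((a - b : ℝ) : AddCircle (1 : ℝ)) = 0 := by
  rw [AddCircle.coe_sub, h, sub_self]

lemma fam_lift {H : ℝ → Ann → Ann} (hH : Continuous (fun p : ℝ × Ann => H p.1 p.2))
    (hinj : ∀ s, Injective (H s)) {a : ℝ} (ha : H a = id) :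
    ∃ Φ : ℝ → Strip → Strip, Continuous (fun p : ℝ × Strip => Φ p.1 p.2) ∧ (∀ s, Injective (Φ s)) ∧
      Φ a = id ∧ (∀ s z, pr (Φ s z) = H s (pr z)) ∧
      (∀ s k z, Φ s (shiftPt k z) = shiftPt k (Φ s z)) := by
  have hle : (-1 : ℝ) ≤ 1 := by norm_num
  have hG : Continuous (fun q : ℝ × ℝ × ℝ => (H q.1 (pr (q.2.1, projIcc (-1) 1 hle q.2.2))).1) := by
    refine continuous_fst.comp (hH.comp (continuous_fst.prodMk (pr_cont.comp ?_)))
    exact (by fun_prop : Continuous fun q : ℝ × ℝ × ℝ => q.2.1).prodMk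
      (continuous_projIcc.comp (by fun_prop))
  obtain ⟨L, ⟨hL0, hL⟩, -⟩ := (AddCircle.isCoveringMap_coe (1 : ℝ)).existsUnique_continuousMap_lifts
    (⟨_, hG⟩ : C(ℝ × ℝ × ℝ, AddCircle (1 : ℝ))) (a, 0, 0) 0 (by simp [ha, pr])
  have hL' : ∀ q : ℝ × ℝ × ℝ, ((L q : ℝ) : AddCircle (1 : ℝ)) =
      (H q.1 (pr (q.2.1, projIcc (-1) 1 hle q.2.2))).1 := fun q => congrFun hL q
  let Φ : ℝ → Strip → Strip := fun s z => (L (s, z.1, z.2), (H s (pr z)).2)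
  have hpr : ∀ s z, pr (Φ s z) = H s (pr z) := by
    intro s z
    refine Prod.ext ?_ rfl
    show ((L (s, z.1, z.2) : ℝ) : AddCircle (1 : ℝ)) = _
    rw [hL']; simp [projIcc_val]
  have hsh : ∀ s k z, Φ s (shiftPt k z) = shiftPt k (Φ s z) := by
    intro s k z
    have hc := const_of_coe (Y := ℝ × ℝ × ℝ) (h := fun q => L (q.1, q.2.1 + k, q.2.2) - L q - k)
      (by fun_prop) (fun q => by
        have : ((k : ℝ) : AddCircle (1 : ℝ)) = 0 := by
          rw [← AddCircle.coe_zero (p := (1 : ℝ)), coe_eq_iff]; exact ⟨k, by simp⟩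
        rw [AddCircle.coe_sub, this, sub_zero]
        apply coe_sub_zero
        rw [hL', hL']
        have e : pr (q.2.1 + k, projIcc (-1) 1 hle q.2.2) = pr (q.2.1, projIcc (-1) 1 hle q.2.2) :=
          pr_shift k (q.2.1, projIcc (-1) 1 hle q.2.2)
        simp only [e])
    have hbase : ∀ q : ℝ × ℝ, L (a, q.1, q.2) - q.1 = 0 := by
      intro q
      have h1 := const_of_coe (Y := ℝ × ℝ) (h := fun q => L (a, q.1, q.2) - q.1)
        (by fun_prop) (fun q => by
          apply coe_sub_zero
          rw [hL']; simp [ha, pr]) q (0, 0)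
      simp only at h1
      rw [h1]; simp [hL0]
    have h2 := hc (s, z.1, z.2) (a, 0, 0)
    simp only at h2
    have b1 := hbase (0 + k, 0)
    have b2 := hbase (0, 0)
    simp only at b1 b2
    refine Prod.ext ?_ ?_
    · show L (s, z.1 + k, z.2) = L (s, z.1, z.2) + k
      linarith
    · show (H s (pr (shiftPt k z))).2 = (H s (pr z)).2
      rw [pr_shift]
  refine ⟨Φ, ?_, ?_, ?_, hpr, hsh⟩
  · refine Continuous.prodMk ?_ ?_
    · exact L.continuous.comp (by fun_prop : Continuous fun p : ℝ × Strip => (p.1, p.2.1, (p.2.2 : ℝ)))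
    · exact continuous_snd.comp (hH.comp (continuous_fst.prodMk (pr_cont.comp continuous_snd)))
  · intro s z w hzw
    have h1 : H s (pr z) = H s (pr w) := by rw [← hpr, ← hpr, hzw]
    obtain ⟨k, rfl⟩ := pr_eq_iff.1 (hinj s h1)
    rw [hsh] at hzw
    have := congrArg Prod.fst hzw
    simp at this
    rw [this]; simp
  · funext z
    have h1 := const_of_coe (Y := ℝ × ℝ) (h := fun q => L (a, q.1, q.2) - q.1)
        (by fun_prop) (fun q => by
          apply coe_sub_zero
          rw [hL']; simp [ha, pr]) (z.1, z.2) (0, 0)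
    simp only [hL0] at h1
    refine Prod.ext ?_ ?_
    · show L (a, z.1, z.2) = z.1
      linarith
    · show (H a (pr z)).2 = z.2
      rw [ha]; rfl

lemma ann_int {H : ℝ → Ann → Ann} (hH : Continuous (fun p : ℝ × Ann => H p.1 p.2))
    (hinj : ∀ s, Injective (H s)) {a : ℝ} (ha : H a = id) {p : Ann} (hp : |(p.2 : ℝ)| < 1) (s : ℝ) :
    |((H s p).2 : ℝ)| < 1 := by
  obtain ⟨Φ, h1, h2, h3, h4, h5⟩ := fam_lift hH hinj ha
  obtain ⟨z, rfl⟩ := pr_surj p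
  rw [← h4]
  exact fam_int h1 h2 h3 (z := z) hp s

lemma ann_bd {H : ℝ → Ann → Ann} (hH : Continuous (fun p : ℝ × Ann => H p.1 p.2))
    (hbij : ∀ s, Bijective (H s)) (h0 : H 0 = id) {p : Ann} (hp : ¬ |(p.2 : ℝ)| < 1) (s : ℝ) :
    ((H s p).2 : ℝ) = p.2 := by
  have hHs : ∀ s, Continuous (H s) := fun s => hH.comp (by fun_prop : Continuous fun q : Ann => (s, q))
  have hb : ∀ s, ¬ |((H s p).2 : ℝ)| < 1 := by
    intro s hc
    let e : Ann ≃ₜ Ann := Continuous.homeoOfEquivCompactToT2 (f := Equiv.ofBijective (H s) (hbij s)) (hHs s)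
    have he : ∀ q, H s (e.symm q) = q := fun q => e.apply_symm_apply q
    have := ann_int (H := fun r q => H r (e.symm q)) (a := s) (p := H s p)
      (hH.comp (continuous_fst.prodMk (e.symm.continuous.comp continuous_snd)))
      (fun r => (hbij r).1.comp e.symm.injective) (funext fun q => he q) hc 0
    rw [h0] at this
    have e2 : e.symm (H s p) = p := e.symm_apply_apply p
    simp only [id, e2] at this
    exact hp this
  have hsq : ∀ s, ((H s p).2 : ℝ) = 1 ∨ ((H s p).2 : ℝ) = -1 := by
    intro s
    have h1 := hb s
    rw [not_lt, le_abs] at h1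
    rcases h1 with h | h
    · left; linarith [(H s p).2.2.2]
    · right; linarith [(H s p).2.2.1]
  have hcont : Continuous (fun s => ((H s p).2 : ℝ)) := by
    have : Continuous (fun s => H s p) := hH.comp (by fun_prop : Continuous fun s : ℝ => (s, p))
    fun_prop
  have hk := const_of_coe (h := fun s => ((H s p).2 : ℝ)) hcont (fun s => by
    rw [← AddCircle.coe_zero (p := (1 : ℝ)), coe_eq_iff]
    rcases hsq s with h | h
    · exact ⟨1, by rw [h]; simp⟩
    · exact ⟨-1, by rw [h]; simp⟩) s 0
  simp only [h0] at hk
  exact hk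

end OAB


open Set Function MeasureTheory Filter Topology

namespace OAB

open Complex

variable {U Xt : Set Strip} {x0 : Strip}

structure Good (U Xt : Set Strip) (F : Strip ≃ₜ Strip) : Prop where
  top : ∀ z, ((F z).2 : ℝ) = 1 ↔ (z.2 : ℝ) = 1
  inU : ∀ z, F z ∈ U ↔ z ∈ U
  inX : ∀ z, F z ∈ Xt ↔ z ∈ Xt
  comm : ∀ k z, F (shiftPt k z) = shiftPt k (F z)
  aa : ∀ γ δ : UI → Strip, Continuous γ → Continuous δ → ((γ 0).2 : ℝ) = 1 → ((δ 0).2 : ℝ) = 1 →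
    δ 1 ∉ range γ → γ 1 ∉ range δ → Aa (F ∘ γ) (F ∘ δ) = Aa γ δ

lemma comp_notMem {F : Strip ≃ₜ Strip} {γ : UI → Strip} {w : Strip} (h : w ∉ range γ) :
    F w ∉ range (F ∘ γ) := by
  rintro ⟨t, e⟩
  exact h ⟨t, F.injective e⟩

lemma Good.mul {F G : Strip ≃ₜ Strip} (hF : Good U Xt F) (hG : Good U Xt G) : Good U Xt (F * G) where
  top := fun z => (hF.top (G z)).trans (hG.top z)
  inU := fun z => (hF.inU (G z)).trans (hG.inU z)
  inX := fun z => (hF.inX (G z)).trans (hG.inX z)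
  comm := fun k z => by
    show F (G (shiftPt k z)) = shiftPt k (F (G z))
    rw [hG.comm, hF.comm]
  aa := fun γ δ h1 h2 h3 h4 h5 h6 => by
    rw [← hG.aa γ δ h1 h2 h3 h4 h5 h6]
    exact hF.aa (G ∘ γ) (G ∘ δ) (G.continuous.comp h1) (G.continuous.comp h2) ((hG.top _).2 h3)
      ((hG.top _).2 h4) (comp_notMem h5) (comp_notMem h6)

lemma Good.one : Good U Xt 1 where
  top := fun z => Iff.rfl
  inU := fun z => Iff.rfl
  inX := fun z => Iff.rfl
  comm := fun k z => rfl
  aa := fun γ δ h1 h2 h3 h4 h5 h6 => rfl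

lemma Good.inv {F : Strip ≃ₜ Strip} (hF : Good U Xt F) : Good U Xt F⁻¹ where
  top := fun z => by
    have := hF.top (F⁻¹ z)
    rw [show F (F⁻¹ z) = z from F.apply_symm_apply z] at this
    exact this.symm
  inU := fun z => by
    have := hF.inU (F⁻¹ z)
    rw [show F (F⁻¹ z) = z from F.apply_symm_apply z] at this
    exact this.symm
  inX := fun z => by
    have := hF.inX (F⁻¹ z)
    rw [show F (F⁻¹ z) = z from F.apply_symm_apply z] at this
    exact this.symm
  comm := fun k z => by
    apply F.injective
    rw [hF.comm, show ∀ z, F (F⁻¹ z) = z from F.apply_symm_apply,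
      show ∀ z, F (F⁻¹ z) = z from F.apply_symm_apply]
  aa := fun γ δ h1 h2 h3 h4 h5 h6 => by
    have e : ∀ γ : UI → Strip, F ∘ (⇑(F⁻¹) ∘ γ) = γ := fun γ => funext fun t => F.apply_symm_apply _
    have ht : ∀ z : Strip, (z.2 : ℝ) = 1 → ((F⁻¹ z).2 : ℝ) = 1 := fun z hz => by
      rw [← hF.top, show ∀ z, F (F⁻¹ z) = z from F.apply_symm_apply]; exact hz
    have := hF.aa (⇑(F⁻¹) ∘ γ) (⇑(F⁻¹) ∘ δ) ((F⁻¹).continuous.comp h1) ((F⁻¹).continuous.comp h2)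
      (ht _ h3) (ht _ h4) (comp_notMem h5) (comp_notMem h6)
    rw [e, e] at this
    exact this.symm

lemma Good.pow {F : Strip ≃ₜ Strip} (hF : Good U Xt F) (n : ℕ) : Good U Xt (F ^ n) := by
  induction n with
  | zero => rw [pow_zero]; exact Good.one
  | succ n ih => rw [pow_succ]; exact ih.mul hF

lemma Good.zpow {F : Strip ≃ₜ Strip} (hF : Good U Xt F) (n : ℤ) : Good U Xt (F ^ n) := by
  cases n with
  | ofNat n => rw [Int.ofNat_eq_natCast, zpow_natCast]; exact hF.pow n
  | negSucc n => rw [zpow_negSucc]; exact (hF.pow _).inv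

lemma Good.acc {F : Strip ≃ₜ Strip} (hF : Good U Xt F) {γ : UI → Strip} (hγ : Acc U Xt γ) :
    Acc U Xt (F ∘ γ) where
  cont := F.continuous.comp hγ.cont
  start := (hF.top _).2 hγ.start
  inU := fun t ht => (hF.inU _).2 (hγ.inU t ht)
  fin := (hF.inX _).2 hγ.fin
  tail := by
    obtain ⟨s, h1, h2⟩ := hγ.tail
    exact ⟨s, h1, fun u hu v hv huv => h2 hu hv (F.injective huv)⟩

lemma Good.aa' (h : Ctx U Xt) {F : Strip ≃ₜ Strip} (hF : Good U Xt F) {γ δ : UI → Strip}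
    (hγ : Acc U Xt γ) (hδ : Acc U Xt δ) (hne : γ 1 ≠ δ 1) : Aa (F ∘ γ) (F ∘ δ) = Aa γ δ :=
  hF.aa γ δ hγ.cont hδ.cont hγ.start hδ.start (hγ.notMem h hδ.fin hne.symm) (hδ.notMem h hγ.fin hne)

lemma Aa_shift (k : ℤ) (γ δ : UI → Strip) : Aa (shiftPt k ∘ γ) (shiftPt k ∘ δ) = Aa γ δ := by
  have e : ∀ z w, cc (shiftPt k z) - cc (shiftPt k w) = cc z - cc w := fun z w => by
    apply Complex.ext <;> simp
  simp only [Aa, Th, comp_apply, e]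

lemma mk_good {f : Ann ≃ₜ Ann} (hf : IsotopicToId ⇑f)
    {F : Strip ≃ₜ Strip} (hF : IsLift ⇑f ⇑F)
    {X Um Up : Set Ann} (hX : IsEAC X Um Up) (hinv : ⇑f '' X = X) :
    Good (pr ⁻¹' Up) (pr ⁻¹' X) F := by
  have : PreconnectedSpace II := Subtype.preconnectedSpace isPreconnected_Icc
  obtain ⟨H, hH, hbij, h0, h1⟩ := hf
  obtain ⟨Φ, p1, p2, p3, p4, p5⟩ := fam_lift hH (fun s => (hbij s).1) h0
  have hΦs : ∀ s, Continuous (Φ s) := fun s => p1.comp (by fun_prop : Continuous fun z : Strip => (s, z))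
  have hsame : ∀ z, pr (F z) = pr (Φ 1 z) := fun z => by rw [hF.1, p4, h1]
  have hk : ∃ k : ℤ, ∀ z, F z = shiftPt k (Φ 1 z) := by
    obtain ⟨k, hk⟩ := pr_eq_iff.1 (hsame (0, ⟨0, by norm_num, by norm_num⟩))
    refine ⟨k, fun z => ?_⟩
    have hc := const_of_coe (h := fun z => (F z).1 - (Φ 1 z).1)
      ((continuous_fst.comp F.continuous).sub (continuous_fst.comp (hΦs 1)))
      (fun z => coe_sub_zero (congrArg Prod.fst (hsame z))) z (0, ⟨0, by norm_num, by norm_num⟩)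
    refine Prod.ext ?_ (congrArg Prod.snd (hsame z) :)
    simp only [hk] at hc
    simp at hc ⊢
    linarith
  obtain ⟨k, hk⟩ := hk
  have hinvX : ∀ p, f p ∈ X ↔ p ∈ X := fun p => by
    constructor
    · intro h
      rw [← hinv] at h
      obtain ⟨q, hq, e⟩ := h
      rwa [← f.injective e]
    · intro h
      rw [← hinv]; exact ⟨p, h, rfl⟩
  have hbd : ∀ p : Ann, ¬ |(p.2 : ℝ)| < 1 → ((f p).2 : ℝ) = p.2 := fun p hp => by
    rw [← h1]; exact ann_bd hH hbij h0 hp 1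
  have hintg : ∀ p : Ann, |(p.2 : ℝ)| < 1 → |((f p).2 : ℝ)| < 1 := fun p hp => by
    rw [← h1]; exact ann_int hH (fun s => (hbij s).1) h0 hp 1
  have hUp : ∀ p ∈ Up, f p ∈ Up := by
    intro p hp
    let q : Ann := (0, ⟨1, by norm_num, le_rfl⟩)
    have hq : q ∈ Up := top_sub hX q rfl
    have hfq : f q ∈ Up := top_sub hX _ (by rw [hbd q (by simp [q])])
    have hpre : IsPreconnected (f '' Up) := by
      rw [hX.hUp]; exact isPreconnected_connectedComponentIn.image _ f.continuous.continuousOn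
    have hsub : f '' Up ⊆ Xᶜ := by
      rintro _ ⟨r, hr, rfl⟩ hc
      have : r ∈ Xᶜ := by rw [hX.cover]; exact Or.inr hr
      exact this ((hinvX r).1 hc)
    have := hpre.subset_connectedComponentIn ⟨q, hq, rfl⟩ hsub ⟨p, hp, rfl⟩
    rw [hX.hUp] at hfq ⊢
    rwa [← connectedComponentIn_eq hfq] at this
  have hUm : ∀ p ∈ Um, f p ∈ Um := by
    intro p hp
    let q : Ann := (0, ⟨-1, le_rfl, by norm_num⟩)
    have hq : q ∈ Um := bot_sub hX q rfl
    have hfq : f q ∈ Um := bot_sub hX _ (by rw [hbd q (by simp [q])])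
    have hpre : IsPreconnected (f '' Um) := by
      rw [hX.hUm]; exact isPreconnected_connectedComponentIn.image _ f.continuous.continuousOn
    have hsub : f '' Um ⊆ Xᶜ := by
      rintro _ ⟨r, hr, rfl⟩ hc
      have : r ∈ Xᶜ := by rw [hX.cover]; exact Or.inl hr
      exact this ((hinvX r).1 hc)
    have := hpre.subset_connectedComponentIn ⟨q, hq, rfl⟩ hsub ⟨p, hp, rfl⟩
    rw [hX.hUm] at hfq ⊢
    rwa [← connectedComponentIn_eq hfq] at this
  refine ⟨?_, ?_, ?_, ?_, ?_⟩
  · intro z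
    have e : ((F z).2 : ℝ) = (f (pr z)).2 := by rw [← hF.1]; rfl
    rw [e]
    by_cases hz : |((pr z).2 : ℝ)| < 1
    · have := hintg _ hz
      constructor
      · intro hc; rw [hc] at this; simp at this
      · intro hc; have h2 : |(z.2 : ℝ)| < 1 := hz; rw [hc] at h2; simp at h2
    · rw [hbd _ hz]; rfl
  · intro z
    rw [mem_preimage, mem_preimage, hF.1]
    refine ⟨fun h => ?_, hUp _⟩
    have hn : pr z ∈ Xᶜ := by
      intro hc
      have h2 : f (pr z) ∈ Xᶜ := by rw [hX.cover]; exact Or.inr h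
      exact h2 ((hinvX _).2 hc)
    rw [hX.cover] at hn
    rcases hn with hn | hn
    · exact absurd (hUm _ hn) (disjoint_left.1 (Up_Um_disj hX) h)
    · exact hn
  · intro z
    rw [mem_preimage, mem_preimage, hF.1, hinvX]
  · intro l z
    rw [hk, hk, p5, shift_shift, shift_shift, add_comm]
  · intro γ δ c1 c2 s1 s2 n1 n2
    have eF : ∀ γ : UI → Strip, F ∘ γ = shiftPt k ∘ (Φ 1 ∘ γ) := fun γ => funext fun t => hk _
    rw [eF, eF, Aa_shift]
    have htop : ∀ s (z : Strip), (z.2 : ℝ) = 1 → ((Φ s z).2 : ℝ) = 1 := by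
      intro s z hz
      have e : ((Φ s z).2 : ℝ) = (H s (pr z)).2 := by rw [← p4]; rfl
      rw [e, ann_bd hH hbij h0 (p := pr z) (by show ¬ |(z.2 : ℝ)| < 1; rw [hz]; simp) s]
      exact hz
    have hnm : ∀ s (γ : UI → Strip) w, w ∉ range γ → Φ s w ∉ range (fun t => Φ s (γ t)) := by
      rintro s γ w hw ⟨t, e⟩
      exact hw ⟨t, p2 s e⟩
    have hcomp : ∀ γ : UI → Strip, Continuous γ → Continuous (fun p : ℝ × UI => Φ p.1 (γ p.2)) :=
      fun γ hγ => p1.comp (continuous_fst.prodMk (hγ.comp continuous_snd))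
    have hpt : ∀ w, Continuous (fun s : ℝ => Φ s w) := fun w =>
      p1.comp (by fun_prop : Continuous fun s : ℝ => (s, w))
    have hconst := const_of_exp_const (f := fun s : ℝ => Aa (fun t => Φ s (γ t)) (fun t => Φ s (δ t)))
      (c := -1) (continuous_iff_continuousAt.2 fun s =>
        (Th_cont_param (Γ := fun s t => Φ s (γ t)) (w := fun s => Φ s (δ 1)) (hcomp γ c1) (hpt _)
          (htop _ _ s1) (hnm _ _ _ n1)).sub
        (Th_cont_param (Γ := fun s t => Φ s (δ t)) (w := fun s => Φ s (γ 1)) (hcomp δ c2) (hpt _)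
          (htop _ _ s2) (hnm _ _ _ n2)))
      (fun s => Aa_exp ((hΦs s).comp c1) ((hΦs s).comp c2) (hnm _ _ _ n1) (hnm _ _ _ n2)) 1 0
    simp only [p3, id] at hconst
    exact hconst

end OAB


open Set Function MeasureTheory Filter Topology

namespace OAB

open Complex

/-- Krylov–Bogoliubov. -/
lemma KB {f : Ann → Ann} (hf : Continuous f) {X : Set Ann} (hX : IsClosed X)
    {φ : Ann → ℝ} (hφ : Continuous φ) {C : ℝ}
    (h : ∃ᶠ N : ℕ in atTop, ∃ q, (∀ i, f^[i] q ∈ X) ∧ ∑ i ∈ Finset.range N, φ (f^[i] q) ≤ C) :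
    ∃ μ : Measure Ann, IsProbabilityMeasure μ ∧ Measure.map f μ = μ ∧ μ Xᶜ = 0 ∧ ∫ a, φ a ∂μ ≤ 0 := by
  classical
  have h' : ∀ N : ℕ, ∃ q : Ann, (∃ q, (∀ i, f^[i] q ∈ X) ∧ ∑ i ∈ Finset.range N, φ (f^[i] q) ≤ C) →
      (∀ i, f^[i] q ∈ X) ∧ ∑ i ∈ Finset.range N, φ (f^[i] q) ≤ C := fun N => by
    by_cases hh : ∃ q, (∀ i, f^[i] q ∈ X) ∧ ∑ i ∈ Finset.range N, φ (f^[i] q) ≤ C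
    · obtain ⟨q, hq⟩ := hh; exact ⟨q, fun _ => hq⟩
    · exact ⟨(0, ⟨0, by norm_num, by norm_num⟩), fun a => absurd a hh⟩
  choose q hq using h'
  let M0 : ℕ → Measure Ann := fun N => ((N + 1 : ℕ) : ENNReal)⁻¹ • ∑ i ∈ Finset.range (N + 1), Measure.dirac (f^[i] (q (N + 1)))
  have hM0 : ∀ N, IsProbabilityMeasure (M0 N) := fun N => ⟨by
    simp only [M0, Measure.smul_apply, Measure.coe_finsetSum, Finset.sum_apply, measure_univ,
      Finset.sum_const, Finset.card_range, smul_eq_mul, nsmul_eq_mul, mul_one]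
    exact ENNReal.inv_mul_cancel (by simp) (by simp)⟩
  let M : ℕ → ProbabilityMeasure Ann := fun N => ⟨M0 N, hM0 N⟩
  have hintg : ∀ (g : Ann → ℝ), Continuous g → ∀ N, ∫ a, g a ∂(M0 N) =
      ((N + 1 : ℕ) : ℝ)⁻¹ * ∑ i ∈ Finset.range (N + 1), g (f^[i] (q (N + 1))) := fun g hg N => by
    simp only [M0]
    rw [integral_smul_measure, integral_finsetSum_measure]
    · simp only [integral_dirac, ENNReal.toReal_inv, ENNReal.toReal_natCast, smul_eq_mul]
    · intro i _
      exact integrable_dirac (by simp)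
  have h1 : ∃ᶠ N : ℕ in atTop, ∃ q, (∀ i, f^[i] q ∈ X) ∧ ∑ i ∈ Finset.range (N+1), φ (f^[i] q) ≤ C := by
    rw [frequently_atTop] at h ⊢
    intro a
    obtain ⟨b, hb, hb'⟩ := h (a + 1)
    refine ⟨b - 1, by omega, ?_⟩
    rwa [show b - 1 + 1 = b by omega]
  have : NeBot (atTop ⊓ 𝓟 {N : ℕ | ∃ q, (∀ i, f^[i] q ∈ X) ∧ ∑ i ∈ Finset.range (N+1), φ (f^[i] q) ≤ C}) :=
    frequently_mem_iff_neBot.1 h1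
  obtain ⟨𝒰, h𝒰⟩ := Ultrafilter.exists_le (atTop ⊓ 𝓟 {N : ℕ | ∃ q, (∀ i, f^[i] q ∈ X) ∧ ∑ i ∈ Finset.range (N+1), φ (f^[i] q) ≤ C})
  have hat : (𝒰 : Filter ℕ) ≤ atTop := h𝒰.trans inf_le_left
  have hev : ∀ᶠ N in (𝒰 : Filter ℕ), (∀ i, f^[i] (q (N+1)) ∈ X) ∧ ∑ i ∈ Finset.range (N+1), φ (f^[i] (q (N+1))) ≤ C := by
    have := h𝒰.trans inf_le_right (mem_principal_self _)
    filter_upwards [this] with N hN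
    exact hq _ hN
  obtain ⟨μ, -, hμ⟩ := isCompact_univ.ultrafilter_le_nhds (𝒰.map M) (by simp)
  have hlim : Tendsto M 𝒰 (𝓝 μ) := hμ
  have hlimg : ∀ g : Ann → ℝ, Continuous g →
      Tendsto (fun N : ℕ => ((N + 1 : ℕ) : ℝ)⁻¹ * ∑ i ∈ Finset.range (N + 1), g (f^[i] (q (N + 1)))) 𝒰
        (𝓝 (∫ a, g a ∂(μ : Measure Ann))) := fun g hg => by
    have := ProbabilityMeasure.tendsto_iff_forall_integral_tendsto.1 hlim (BoundedContinuousFunction.mkOfCompact ⟨g, hg⟩)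
    refine this.congr fun N => ?_
    exact hintg g hg N
  have hinv0 : Tendsto (fun N : ℕ => ((N + 1 : ℕ) : ℝ)⁻¹) 𝒰 (𝓝 0) := by
    have := (tendsto_inv_atTop_nhds_zero_nat (𝕜 := ℝ)).comp (tendsto_add_atTop_nat 1)
    exact this.mono_left hat
  refine ⟨μ, inferInstance, ?_, ?_, ?_⟩
  · have : IsFiniteMeasure (Measure.map f (μ : Measure Ann)) := inferInstance
    refine ext_of_forall_integral_eq_of_IsFiniteMeasure fun g => ?_
    rw [integral_map hf.measurable.aemeasurable g.continuous.aestronglyMeasurable]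
    have a1 := hlimg g g.continuous
    have a2 := hlimg (fun a => g (f a)) (g.continuous.comp hf)
    have a3 := a2.sub a1
    have a4 : Tendsto (fun N : ℕ => ((N + 1 : ℕ) : ℝ)⁻¹ * (g (f^[N+1] (q (N + 1))) - g (q (N+1)))) 𝒰 (𝓝 0) := by
      have hb : ∀ N : ℕ, |((N + 1 : ℕ) : ℝ)⁻¹ * (g (f^[N+1] (q (N + 1))) - g (q (N+1)))| ≤ ((N + 1 : ℕ) : ℝ)⁻¹ * (‖g‖ + ‖g‖) := fun N => by
        rw [abs_mul, abs_of_nonneg (by positivity)]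
        refine mul_le_mul_of_nonneg_left ?_ (by positivity)
        exact (abs_sub _ _).trans (add_le_add (g.norm_coe_le_norm _) (g.norm_coe_le_norm _))
      have hz := hinv0.mul_const (‖g‖ + ‖g‖)
      rw [zero_mul] at hz
      exact squeeze_zero_norm hb hz
    have a5 := tendsto_nhds_unique (a3.congr fun N => by
      rw [← mul_sub, ← Finset.sum_sub_distrib]
      congr 1
      have := Finset.sum_range_sub (fun i => g (f^[i] (q (N + 1)))) (N + 1)
      simp only [iterate_zero, id, iterate_succ_apply'] at this ⊢
      exact this) a4
    linarith
  · have := ProbabilityMeasure.le_liminf_measure_open_of_tendsto hlim hX.isOpen_compl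
    refine le_antisymm (this.trans ?_) (zero_le)
    have hz : ∀ᶠ N in (𝒰 : Filter ℕ), (M N : Measure Ann) Xᶜ = 0 := by
      filter_upwards [hev] with N hN
      show M0 N Xᶜ = 0
      simp only [M0, Measure.smul_apply, Measure.coe_finsetSum, Finset.sum_apply, smul_eq_mul]
      rw [Finset.sum_eq_zero, mul_zero]
      intro i _
      rw [Measure.dirac_apply' _ hX.isOpen_compl.measurableSet]
      simp [hN.1 i]
    rw [liminf_congr hz]
    simp
  · have hz := hinv0.mul_const C
    rw [zero_mul] at hz
    refine le_of_tendsto_of_tendsto (hlimg φ hφ) hz ?_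
    filter_upwards [hev] with N hN
    exact mul_le_mul_of_nonneg_left hN.2 (inv_nonneg.2 (Nat.cast_nonneg _))

lemma pow_app (F : Strip ≃ₜ Strip) (n : ℕ) : ⇑(F ^ n) = (⇑F)^[n] := by
  induction n with
  | zero => rfl
  | succ n ih => rw [pow_succ, iterate_succ, ← ih]; rfl

lemma mulz (F G : Strip ≃ₜ Strip) (z : Strip) : (F * G) z = F (G z) := rfl

lemma pr_pow {f : Ann ≃ₜ Ann} {F : Strip ≃ₜ Strip} (hF : IsLift ⇑f ⇑F) (n : ℕ) (z : Strip) :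
    pr ((F ^ n) z) = (⇑f)^[n] (pr z) := by
  rw [pow_app]
  induction n with
  | zero => rfl
  | succ n ih => rw [iterate_succ_apply', iterate_succ_apply', hF.1, ih]

lemma birk {f : Ann ≃ₜ Ann} {F : Strip ≃ₜ Strip} (hF : IsLift ⇑f ⇑F) {φ : Ann → ℝ}
    (hφ : ∀ z : Strip, φ (pr z) = (F z).1 - z.1) (N : ℕ) (z : Strip) :
    ∑ i ∈ Finset.range N, φ ((⇑f)^[i] (pr z)) = ((F ^ N) z).1 - z.1 := by
  have := Finset.sum_range_sub (fun i => ((F ^ i) z).1) N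
  simp only [pow_zero] at this
  rw [show ((1 : Strip ≃ₜ Strip) z) = z from rfl] at this
  rw [← this]
  refine Finset.sum_congr rfl fun i _ => ?_
  rw [← pr_pow hF, hφ, pow_succ', mulz]

lemma mes_pos {f : Ann ≃ₜ Ann} {φ : Ann → ℝ} {X : Set Ann}
    (hpos : 0 < sInf (rotMes ⇑f φ X)) {μ : Measure Ann} (h1 : IsProbabilityMeasure μ)
    (h2 : Measure.map f μ = μ) (h3 : μ Xᶜ = 0) (h4 : ∫ a, φ a ∂μ ≤ 0) : False := by
  have hb : BddBelow (rotMes ⇑f φ X) := by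
    by_contra hb
    rw [Real.sInf_of_not_bddBelow hb] at hpos
    exact lt_irrefl _ hpos
  have := csInf_le hb (show ∫ a, φ a ∂μ ∈ rotMes ⇑f φ X from ⟨μ, h1, h2, h3, rfl⟩)
  linarith

lemma mes_fwd {f : Ann ≃ₜ Ann} {F : Strip ≃ₜ Strip} (hF : IsLift ⇑f ⇑F) {φ : Ann → ℝ}
    (hφc : Continuous φ) (hφ : ∀ z : Strip, φ (pr z) = (F z).1 - z.1) {X : Set Ann}
    (hXc : IsClosed X) (hinv : ∀ p ∈ X, f p ∈ X) (hpos : 0 < sInf (rotMes ⇑f φ X))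
    {w : Strip} (hw : pr w ∈ X) (C : ℝ) : ∀ᶠ n : ℕ in atTop, C < ((F ^ n) w).1 := by
  by_contra hc
  rw [not_eventually] at hc
  obtain ⟨μ, h1, h2, h3, h4⟩ := KB f.continuous hXc hφc (C := C - w.1) (hc.mono fun N hN => ⟨pr w, fun i => by
    induction i with
    | zero => exact hw
    | succ i ih => rw [iterate_succ_apply']; exact hinv _ ih, by
    rw [birk hF hφ]; linarith⟩)
  exact mes_pos hpos h1 h2 h3 h4

lemma mes_bwd {f : Ann ≃ₜ Ann} {F : Strip ≃ₜ Strip} (hF : IsLift ⇑f ⇑F) {φ : Ann → ℝ}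
    (hφc : Continuous φ) (hφ : ∀ z : Strip, φ (pr z) = (F z).1 - z.1) {X : Set Ann}
    (hXc : IsClosed X) (hinv : ∀ p, f p ∈ X ↔ p ∈ X) (hpos : 0 < sInf (rotMes ⇑f φ X))
    {w : Strip} (hw : pr w ∈ X) (C : ℝ) : ∀ᶠ n : ℕ in atTop, (((F ^ n)⁻¹ : Strip ≃ₜ Strip) w).1 < C := by
  by_contra hc
  rw [not_eventually] at hc
  obtain ⟨μ, h1, h2, h3, h4⟩ := KB f.continuous hXc hφc (C := w.1 - C) (hc.mono fun N hN => by
    have e : (F ^ N) (((F ^ N)⁻¹ : Strip ≃ₜ Strip) w) = w := (F ^ N).apply_symm_apply w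
    refine ⟨pr (((F ^ N)⁻¹ : Strip ≃ₜ Strip) w), fun i => ?_, ?_⟩
    · have h0 : pr (((F ^ N)⁻¹ : Strip ≃ₜ Strip) w) ∈ X := by
        have hN : ∀ n p, (⇑f)^[n] p ∈ X ↔ p ∈ X := fun n p => by
          induction n with
          | zero => rfl
          | succ n ih => rw [iterate_succ_apply', hinv, ih]
        rw [← hN N, ← pr_pow hF, e]
        exact hw
      induction i with
      | zero => exact h0
      | succ i ih => rw [iterate_succ_apply']; exact (hinv _).2 ih
    · rw [birk hF hφ, e]; linarith)
  exact mes_pos hpos h1 h2 h3 h4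

structure Dyn (U Xt : Set Strip) (x0 : Strip) (F : Strip ≃ₜ Strip) : Prop where
  ctx : Ctx U Xt
  base : Base Xt x0
  good : Good U Xt F
  fwd : ∀ w ∈ Xt, ∀ C : ℝ, ∀ᶠ n : ℕ in atTop, C < ((F ^ n) w).1
  bwd : ∀ w ∈ Xt, ∀ C : ℝ, ∀ᶠ n : ℕ in atTop, (((F ^ n)⁻¹ : Strip ≃ₜ Strip) w).1 < C
  rot : ∃ ρ : ℝ, ρ < 0 ∧ PrimeEndRotB 1 U Xt F ρ

end OAB


open Set Function MeasureTheory Filter Topology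

namespace OAB

open Complex

variable {U Xt : Set Strip} {x0 : Strip} {F : Strip ≃ₜ Strip}

lemma idx2 (h : Ctx U Xt) (b : Base Xt x0) {γ : UI → Strip} (hγ : Acc U Xt γ) :
    ∃ k, AccIdxB 1 U (γ 1) x0 k ∧
      ((∀ i, γ 1 ≠ shiftPt i x0) → ∀ i, Aa γ (be x0 i) = -(Real.pi * I) → i ≤ k) ∧
      (∀ i, γ 1 = shiftPt i x0 → i ≤ k) := by
  by_cases hc : ∃ l, γ 1 = shiftPt l x0
  · obtain ⟨l, hl⟩ := hc
    refine ⟨l, ⟨Or.inl hl.symm, ?_⟩, fun hn => absurd hl (hn l), fun i hi => ?_⟩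
    · have := prec_left h b (be_acc h b l) (i := l + 1)
        (by rw [be_one]; intro e; have := shiftx0_inj e; omega) (be_be b (by omega))
      rw [be_one] at this
      rw [hl]; exact this
    · exact (shiftx0_inj (hi.symm.trans hl)).le
  · obtain ⟨k, h1, h2⟩ := idx h b hγ
    exact ⟨k, h1, h2, fun i hi => absurd ⟨i, hi⟩ hc⟩

lemma Dyn.ev (d : Dyn U Xt x0 F) {γ : UI → Strip} (hγ : Acc U Xt γ) :
    ∃ k : ℕ → ℤ, (∀ n, ((∀ i, (F ^ n) (γ 1) ≠ shiftPt i x0) →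
        ∀ i, Aa (⇑(F ^ n) ∘ γ) (be x0 i) = -(Real.pi * I) → i ≤ k n) ∧
      (∀ i, (F ^ n) (γ 1) = shiftPt i x0 → i ≤ k n)) ∧ ∀ i : ℤ, ∀ᶠ n in atTop, k n < i := by
  obtain ⟨ρ, hρ, hrot⟩ := d.rot
  choose k h1 h2 h3 using fun n : ℕ => idx2 d.ctx d.base ((d.good.pow n).acc hγ)
  refine ⟨k, fun n => ⟨h2 n, h3 n⟩, fun i => ?_⟩
  obtain ⟨-, -, -, -, σ, hσ, -⟩ := rep_arc d.ctx d.base ∅ hγ (by simp)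
  have hb := be_arc d.ctx d.base 0
  rw [shift_zero] at hb
  have ht := hrot (γ 1) hγ.fin x0 d.base.mem ⟨σ, hσ⟩ ⟨_, hb⟩ k (fun n => by
    rw [← pow_app]; exact h1 n)
  have e1 : ∀ᶠ n : ℕ in atTop, (k n : ℝ) / n < ρ / 2 := ht.eventually_lt_const (by linarith)
  have e2 : ∀ᶠ n : ℕ in atTop, (i : ℝ) / (ρ / 2) < n := by
    exact tendsto_natCast_atTop_atTop.eventually_gt_atTop _
  filter_upwards [e1, e2, eventually_gt_atTop 0] with n a1 a2 a3
  have hn : (0 : ℝ) < n := by exact_mod_cast a3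
  rw [div_lt_iff₀ hn] at a1
  rw [div_lt_iff_of_neg (by linarith)] at a2
  have : (k n : ℝ) < i := by linarith
  exact_mod_cast this

lemma Dyn.H1 (d : Dyn U Xt x0 F) {γ : UI → Strip} (hγ : Acc U Xt γ) (i : ℤ)
    (h : ∃ᶠ n : ℕ in atTop, (∀ j, (F ^ n) (γ 1) ≠ shiftPt j x0) ∧
      Aa (⇑(F ^ n) ∘ γ) (be x0 i) = -(Real.pi * I)) : False := by
  obtain ⟨k, h1, h2⟩ := d.ev hγ
  obtain ⟨n, ⟨a1, a2⟩, a3⟩ := (h.and_eventually (h2 i)).exists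
  have := (h1 n).1 a1 i a2
  omega

lemma Dyn.NP (d : Dyn U Xt x0 F) {n : ℕ} (hn : n ≠ 0) (i : ℤ) : (F ^ n) x0 ≠ shiftPt i x0 := by
  intro he
  obtain ⟨k, h1, h2⟩ := d.ev (be_acc d.ctx d.base 0)
  rw [be_one, shift_zero] at h1
  have hm : ∀ m : ℕ, (F ^ (n * m)) x0 = shiftPt (m * i) x0 := fun m => by
    induction m with
    | zero => simp [shift_zero]
    | succ m ih =>
      rw [Nat.mul_succ, pow_add, mulz, he, (d.good.pow _).comm, ih, shift_shift]
      push_cast; congr 1; ring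
  have ht : Tendsto (fun m : ℕ => n * m) atTop atTop :=
    tendsto_id.const_mul_atTop' (Nat.pos_of_ne_zero hn)
  obtain ⟨m, a1, a2⟩ := ((ht.eventually (d.fwd x0 d.base.mem 0)).and (ht.eventually (h2 0))).exists
  rw [hm, shift_fst, d.base.fst] at a1
  have := (h1 (n * m)).2 _ (hm m)
  have a3 : (0 : ℝ) < ((m * i : ℤ) : ℝ) := by linarith
  have : 0 < (m * i : ℤ) := by exact_mod_cast a3
  omega

lemma Dyn.NP' (d : Dyn U Xt x0 F) {n : ℕ} (hn : n ≠ 0) (i j : ℤ) :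
    (F ^ n) (shiftPt i x0) ≠ shiftPt j x0 := by
  intro he
  rw [(d.good.pow n).comm] at he
  refine d.NP hn (j - i) ?_
  have := congrArg (shiftPt (-i)) he
  rw [shift_shift, shift_shift] at this
  simpa [shift_zero, sub_eq_add_neg] using this

lemma lam_sub (h : Ctx U Xt) {S S' : Set Strip} {x x' : Strip} (hS : Lam Xt S x) (hS' : Lam Xt S' x')
    (h1 : x' ∈ S) (h2 : x ∉ S') : S' ⊆ S := by
  obtain ⟨O, hO, eO⟩ := hS.opn
  obtain ⟨O', hO', eO'⟩ := hS'.opn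
  obtain ⟨N, hN⟩ := hS'.bdd
  have e1 : S' \ S = Xt ∩ (O' ∩ (S ∪ {x})ᶜ) := by
    rw [← inter_assoc, ← eO']
    ext w
    constructor
    · rintro ⟨a, b⟩
      refine ⟨a, ?_⟩
      rintro (c | c)
      · exact b c
      · rw [mem_singleton_iff] at c; exact h2 (c ▸ a)
    · rintro ⟨a, b⟩
      exact ⟨a, fun c => b (Or.inl c)⟩
  have e2 : S' \ S = (S' ∪ {x'}) ∩ Oᶜ := by
    ext w
    constructor
    · rintro ⟨a, b⟩
      refine ⟨Or.inl a, fun c => b ?_⟩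
      rw [eO]; exact ⟨hS'.sub a, c⟩
    · rintro ⟨a | a, b⟩
      · refine ⟨a, fun c => b ?_⟩
        rw [eO] at c; exact c.2
      · rw [mem_singleton_iff] at a
        subst a
        rw [eO] at h1
        exact absurd h1.2 b
  have hcl : IsClosed (S' \ S) := by rw [e2]; exact hS'.cl.inter hO.isClosed_compl
  have := h.key (S' \ S) (fun w hw => hS'.sub hw.1) (isCompact_of_bdd hcl N fun s hs => hN s hs.1) _
    (hO'.inter hS.cl.isOpen_compl) e1
  exact sdiff_eq_empty.1 this

/-- Laminarity. -/
lemma laminar (h : Ctx U Xt) {S S' : Set Strip} {x x' : Strip} (hS : Lam Xt S x) (hS' : Lam Xt S' x')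
    (hne : x ≠ x') {p : Strip} (hp : p ∈ S ∪ {x}) (hp' : p ∈ S' ∪ {x'}) :
    (x' ∈ S ∧ S' ⊆ S) ∨ (x ∈ S' ∧ S ⊆ S') := by
  obtain ⟨O, hO, eO⟩ := hS.opn
  obtain ⟨O', hO', eO'⟩ := hS'.opn
  obtain ⟨N, hN⟩ := hS.bdd
  obtain ⟨N', hN'⟩ := hS'.bdd
  by_cases h1 : x' ∈ S
  · by_cases h2 : x ∈ S'
    · exfalso
      have e : S ∪ S' = (S ∪ {x}) ∪ (S' ∪ {x'}) := by
        ext w; simp only [mem_union, mem_singleton_iff]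
        constructor
        · rintro (a | a) <;> simp [a]
        · rintro ((a | rfl) | (a | rfl))
          · exact Or.inl a
          · exact Or.inr h2
          · exact Or.inr a
          · exact Or.inl h1
      have hcl : IsClosed (S ∪ S') := by rw [e]; exact hS.cl.union hS'.cl
      have := h.key (S ∪ S') (union_subset hS.sub hS'.sub) (isCompact_of_bdd hcl (max N N') (by
        rintro s (hs | hs)
        · exact (hN s hs).trans (le_max_left _ _)
        · exact (hN' s hs).trans (le_max_right _ _))) (O ∪ O') (hO.union hO') (by
          rw [inter_union_distrib_left, ← eO, ← eO'])
      have hm : x' ∈ S ∪ S' := Or.inl h1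
      rw [this] at hm; exact hm
    · exact Or.inl ⟨h1, lam_sub h hS hS' h1 h2⟩
  · by_cases h2 : x ∈ S'
    · exact Or.inr ⟨h2, lam_sub h hS' hS h2 h1⟩
    · exfalso
      have e : S ∩ S' = (S ∪ {x}) ∩ (S' ∪ {x'}) := by
        ext w; simp only [mem_inter_iff, mem_union, mem_singleton_iff]
        constructor
        · rintro ⟨a, b⟩; simp [a, b]
        · rintro ⟨a | rfl, b | rfl⟩
          · exact ⟨a, b⟩
          · exact absurd a h1
          · exact absurd b h2
          · exact absurd rfl hne
      have hcl : IsClosed (S ∩ S') := by rw [e]; exact hS.cl.inter hS'.cl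
      have := h.key (S ∩ S') (fun w hw => hS.sub hw.1) (isCompact_of_bdd hcl N fun s hs => hN s hs.1)
        (O ∩ O') (hO.inter hO') (by
          conv_lhs => rw [eO, eO']
          ext w; simp only [mem_inter_iff]; tauto)
      have hm : p ∈ S ∩ S' := e ▸ ⟨hp, hp'⟩
      rw [this] at hm; exact hm

end OAB


open Set Function MeasureTheory Filter Topology

namespace OAB

open Complex

variable {U Xt : Set Strip} {x0 : Strip} {F : Strip ≃ₜ Strip}

lemma Lam.bdd' {S : Set Strip} {x : Strip} (hS : Lam Xt S x) : ∃ N, ∀ s ∈ S ∪ {x}, |s.1| ≤ N := by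
  obtain ⟨N, hN⟩ := hS.bdd
  refine ⟨max N |x.1|, ?_⟩
  rintro s (hs | hs)
  · exact (hN s hs).trans (le_max_left _ _)
  · rw [mem_singleton_iff] at hs; subst hs; exact le_max_right _ _

lemma Lam.image {S : Set Strip} {x : Strip} (hS : Lam Xt S x) (G : Strip ≃ₜ Strip)
    (hG : ∀ z, G z ∈ Xt ↔ z ∈ Xt) : Lam Xt (G '' S) (G x) where
  sub := by rintro _ ⟨s, hs, rfl⟩; exact (hG s).2 (hS.sub hs)
  xX := (hG x).2 hS.xX
  xS := by rintro ⟨s, hs, e⟩; exact hS.xS (G.injective e ▸ hs)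
  opn := by
    obtain ⟨O, hO, e⟩ := hS.opn
    refine ⟨G '' O, G.isOpenMap _ hO, ?_⟩
    have : G '' Xt = Xt := by
      ext z; constructor
      · rintro ⟨w, hw, rfl⟩; exact (hG w).2 hw
      · intro hz; exact ⟨G.symm z, by rw [← hG, G.apply_symm_apply]; exact hz, G.apply_symm_apply z⟩
    rw [e, image_inter G.injective, this]
  cl := by
    rw [← image_singleton, ← image_union]
    exact G.isClosedMap _ hS.cl
  bdd := by
    obtain ⟨N, hN⟩ := hS.bdd'
    have hc := (isCompact_of_bdd hS.cl N hN).image (G.continuous.fst.abs)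
    obtain ⟨M, hM⟩ := hc.bddAbove
    refine ⟨M, ?_⟩
    rintro _ ⟨s, hs, rfl⟩
    exact hM ⟨s, Or.inl hs, rfl⟩

lemma trap (h : Ctx U Xt) {S : Set Strip} {x p : Strip} (hS : Lam Xt S x) (G : Strip ≃ₜ Strip)
    (hG : ∀ z, G z ∈ Xt ↔ z ∈ Xt) (hp : p ∈ S ∪ {x}) (hp' : G p ∈ S ∪ {x}) :
    (∀ n : ℕ, (G ^ n) x ∈ S ∪ {x}) ∨ (∀ n : ℕ, (((G ^ n)⁻¹ : Strip ≃ₜ Strip)) x ∈ S ∪ {x}) := by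
  by_cases hx : x = G x
  · left
    intro n
    induction n with
    | zero => exact Or.inr rfl
    | succ n ih => rw [pow_succ, mulz, ← hx]; exact ih
  rcases laminar h hS (hS.image G hG) hx hp' (by
    rw [← image_singleton, ← image_union]; exact ⟨p, hp, rfl⟩) with ⟨h1, h2⟩ | ⟨h1, h2⟩
  · left
    intro n
    induction n with
    | zero => exact Or.inr rfl
    | succ n ih =>
      rw [pow_succ', mulz]
      left
      rcases ih with ih | ih
      · exact h2 ⟨_, ih, rfl⟩
      · rw [mem_singleton_iff] at ih; rw [ih]; exact h1
  · right
    intro n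
    induction n with
    | zero => exact Or.inr rfl
    | succ n ih =>
      have e : (((G ^ (n + 1))⁻¹ : Strip ≃ₜ Strip)) x = G⁻¹ (((G ^ n)⁻¹ : Strip ≃ₜ Strip) x) := by
        rw [pow_succ, mul_inv_rev, mulz]
      have h3 : ∀ w, w ∈ G '' S → G⁻¹ w ∈ S := by
        rintro _ ⟨s, hs, rfl⟩
        rw [show G⁻¹ (G s) = s from G.symm_apply_apply s]; exact hs
      rw [e]
      left
      rcases ih with ih | ih
      · exact h3 _ (h2 ih)
      · rw [mem_singleton_iff] at ih; rw [ih]; exact h3 _ h1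

/-- Deck transformation as a homeomorphism. -/
def shH (m : ℤ) : Strip ≃ₜ Strip where
  toFun := shiftPt m
  invFun := shiftPt (-m)
  left_inv := fun z => by rw [shift_shift]; simp [shift_zero]
  right_inv := fun z => by rw [shift_shift]; simp [shift_zero]
  continuous_toFun := shift_cont m
  continuous_invFun := shift_cont (-m)

lemma shH_app (m : ℤ) (z : Strip) : shH m z = shiftPt m z := rfl
lemma shH_inv (m : ℤ) (z : Strip) : (shH m)⁻¹ z = shiftPt (-m) z := rfl

lemma shG_pow (hF : Good U Xt F) (m : ℤ) (n : ℕ) (z : Strip) :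
    ((shH m * F) ^ n) z = shiftPt (n * m) ((F ^ n) z) := by
  induction n with
  | zero => simp [shift_zero]
  | succ n ih =>
    rw [pow_succ', mulz, ih, mulz, shH_app, hF.comm, shift_shift, pow_succ' F, mulz]
    congr 1; push_cast; ring

lemma shG_inv (hF : Good U Xt F) (m : ℤ) (n : ℕ) (z : Strip) :
    (((shH m * F) ^ n)⁻¹ : Strip ≃ₜ Strip) z = shiftPt (-(n * m)) (((F ^ n)⁻¹ : Strip ≃ₜ Strip) z) := by
  apply ((shH m * F) ^ n).injective
  rw [show ((shH m * F) ^ n) ((((shH m * F) ^ n)⁻¹ : Strip ≃ₜ Strip) z) = z from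
    Homeomorph.apply_symm_apply _ z, shG_pow hF, (hF.pow n).comm, shift_shift,
    show (F ^ n) (((F ^ n)⁻¹ : Strip ≃ₜ Strip) z) = z from Homeomorph.apply_symm_apply _ z]
  simp [shift_zero]

lemma Dyn.trapF (d : Dyn U Xt x0 F) {S : Set Strip} {x p : Strip} (hS : Lam Xt S x) {m : ℤ} (hm : 0 ≤ m)
    (hp : p ∈ S ∪ {x}) (hp' : shiftPt m (F p) ∈ S ∪ {x}) : False := by
  obtain ⟨N, hN⟩ := hS.bdd'
  have hm' : (0 : ℝ) ≤ m := by exact_mod_cast hm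
  rcases trap d.ctx hS (shH m * F) (fun z => by
    rw [mulz, shH_app, d.ctx.shiftX, d.good.inX]) hp hp' with h | h
  · obtain ⟨n, hn⟩ := (d.fwd x hS.xX N).exists
    have := hN _ (h n)
    rw [shG_pow d.good, shift_fst] at this
    have h2 := (abs_le.1 this).2
    have : (0 : ℝ) ≤ n * m := by positivity
    push_cast at h2
    linarith
  · obtain ⟨n, hn⟩ := (d.bwd x hS.xX (-N)).exists
    have := hN _ (h n)
    rw [shG_inv d.good, shift_fst] at this
    have h2 := (abs_le.1 this).1
    have : (0 : ℝ) ≤ n * m := by positivity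
    push_cast at h2
    linarith

lemma trapT (h : Ctx U Xt) {S : Set Strip} {x p : Strip} (hS : Lam Xt S x)
    (hp : p ∈ S ∪ {x}) (hp' : shiftPt 1 p ∈ S ∪ {x}) : False := by
  obtain ⟨N, hN⟩ := hS.bdd'
  obtain ⟨n, hn⟩ := exists_nat_gt (N + |x.1|)
  rcases trap h hS (shH 1 * 1) (fun z => by
    rw [mulz, shH_app, h.shiftX]; rfl) hp hp' with h | h
  · have := hN _ (h n)
    rw [shG_pow (Good.one (U := U) (Xt := Xt)), shift_fst] at this
    have h2 := (abs_le.1 this).2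
    have h3 := neg_abs_le x.1
    simp at h2
    linarith
  · have := hN _ (h n)
    rw [shG_inv (Good.one (U := U) (Xt := Xt)), shift_fst] at this
    have h2 := (abs_le.1 this).1
    have h3 := le_abs_self x.1
    simp at h2
    linarith

end OAB


open Set Function MeasureTheory Filter Topology

namespace OAB

open Complex

variable {U Xt : Set Strip} {x0 : Strip} {F : Strip ≃ₜ Strip}

lemma anti_iff {γ δ : UI → Strip} : Aa γ δ = -(Real.pi * I) ↔ Aa δ γ = Real.pi * I := by
  rw [Aa_anti δ γ]; exact neg_inj

lemma anti_iff' {γ δ : UI → Strip} : Aa γ δ = Real.pi * I ↔ Aa δ γ = -(Real.pi * I) := anti_iff.symm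

lemma invF (F : Strip ≃ₜ Strip) (z : Strip) : F (F⁻¹ z) = z := F.apply_symm_apply z
lemma Finv (F : Strip ≃ₜ Strip) (z : Strip) : F⁻¹ (F z) = z := F.symm_apply_apply z

lemma invFc (F : Strip ≃ₜ Strip) (γ : UI → Strip) : ⇑F ∘ (⇑(F⁻¹) ∘ γ) = γ :=
  funext fun t => invF F (γ t)

/-- Moving a homeomorphism across. -/
lemma Good.conj (h : Ctx U Xt) (hF : Good U Xt F) {γ δ : UI → Strip}
    (hγ : Acc U Xt γ) (hδ : Acc U Xt δ) (hne : F (γ 1) ≠ δ 1) :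
    Aa (⇑F ∘ γ) δ = Aa γ (⇑(F⁻¹) ∘ δ) := by
  have := hF.aa' h hγ (hF.inv.acc hδ) (fun e => hne (by
    rw [e]; exact invF F _))
  rw [invFc] at this
  exact this

lemma Dyn.evne (d : Dyn U Xt x0 F) (w : Strip) : ∀ᶠ n : ℕ in atTop, ∀ j, (F ^ n) w ≠ shiftPt j x0 := by
  by_cases hc : ∃ (n : ℕ) (j : ℤ), (F ^ n) w = shiftPt j x0
  · obtain ⟨n, j, e⟩ := hc
    filter_upwards [eventually_gt_atTop n] with N hN i hi
    refine d.NP' (n := N - n) (by omega) j i ?_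
    rw [← e, ← mulz, ← pow_add, show N - n + n = N by omega]
    exact hi
  · push Not at hc
    exact Eventually.of_forall hc

lemma Dyn.H1' (d : Dyn U Xt x0 F) {γ : UI → Strip} (hγ : Acc U Xt γ) (i : ℤ) :
    ∀ᶠ n : ℕ in atTop, Aa (⇑(F ^ n) ∘ γ) (be x0 i) ≠ -(Real.pi * I) := by
  by_contra hc
  rw [not_eventually] at hc
  refine d.H1 hγ i ((hc.and_eventually (d.evne (γ 1))).mono fun n hn => ⟨hn.2, not_not.1 hn.1⟩)

/-- Case `k₂ < k₁` of the key inequality. -/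
lemma Dyn.dag1 (d : Dyn U Xt x0 F) (c : ℤ) : Aa (⇑F ∘ be x0 c) (be x0 c) = Real.pi * I := by
  have hb := be_acc d.ctx d.base c
  have np1 : F (shiftPt c x0) ≠ shiftPt c x0 := by
    have := d.NP' (n := 1) one_ne_zero c c
    rwa [pow_one] at this
  rcases side d.ctx d.base (d.good.acc hb) (i := c) (by
    rw [comp_apply, be_one]; exact np1) with h | h
  · exact h
  exfalso
  have hinv : Aa (⇑(F⁻¹) ∘ be x0 c) (be x0 c) = Real.pi * I := by
    rw [d.good.conj d.ctx hb hb (by rw [be_one]; exact np1)] at h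
    exact anti_iff.1 h
  have hn : ∀ n : ℕ, Aa (⇑(F ^ (n + 1)) ∘ be x0 c) (be x0 c) = -(Real.pi * I) := by
    intro n
    induction n with
    | zero => rw [zero_add, pow_one]; exact h
    | succ n ih =>
      have e0 : (⇑(F⁻¹) ∘ be x0 c) 1 = F⁻¹ (shiftPt c x0) := by rw [comp_apply, be_one]
      have e1 : (⇑(F ^ (n + 1)) ∘ be x0 c) 1 = (F ^ (n + 1)) (shiftPt c x0) := by rw [comp_apply, be_one]
      have n1 : (F ^ (n + 1)) (shiftPt c x0) ≠ F⁻¹ (shiftPt c x0) := by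
        intro e
        have := congrArg F e
        rw [invF, ← mulz, ← pow_succ'] at this
        exact d.NP' (by omega) c c this
      have := Tr d.ctx d.base (i := c) ((d.good.pow (n + 1)).acc hb) (d.good.inv.acc hb)
        (by rw [e1]; exact d.NP' (by omega) c c)
        (by rw [e0]; intro e; apply np1; have := congrArg F e; rw [invF] at this; exact this.symm)
        (by rw [e0, e1]; exact n1) ih hinv
      have h2 := d.good.aa' d.ctx (d.good.inv.acc hb) ((d.good.pow (n + 1)).acc hb) (by
        rw [e0, e1]; exact n1.symm)
      rw [invFc, this] at h2
      rw [anti_iff, ← h2]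
      congr 1
      rw [pow_succ' F (n + 1)]; rfl
  obtain ⟨N, hN⟩ := eventually_atTop.1 (d.H1' hb c)
  exact hN (N + 1) (by omega) (hn N)

lemma Dyn.dag1' (d : Dyn U Xt x0 F) {c j : ℤ} (hcj : c ≤ j) :
    Aa (⇑F ∘ be x0 c) (be x0 j) = Real.pi * I := by
  have np1 : ∀ j, F (shiftPt c x0) ≠ shiftPt j x0 := fun j => by
    have := d.NP' (n := 1) one_ne_zero c j
    rwa [pow_one] at this
  exact mono_left d.ctx d.base (d.good.acc (be_acc d.ctx d.base c)) hcj
    (by rw [comp_apply, be_one]; exact np1 c) (by rw [comp_apply, be_one]; exact np1 j) (d.dag1 c)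

lemma zpow_succ_app (F : Strip ≃ₜ Strip) (n : ℤ) (z : Strip) : (F ^ (n + 1)) z = F ((F ^ n) z) := by
  rw [add_comm, zpow_add, zpow_one, mulz]

/-- Case `k₁ ≤ k₂` of the key inequality. -/
lemma Dyn.dag2 (d : Dyn U Xt x0 F) {k₁ k₂ : ℤ} (hk : k₁ ≤ k₂) {γ : UI → Strip} (hγ : Acc U Xt γ)
    (hno : ∀ n j : ℤ, k₁ ≤ j → j ≤ k₂ → ¬ AccFrom (shiftSet j (Vset U x0.2)) ((F ^ n) (γ 1))) :
    Aa (⇑F ∘ be x0 (k₂ + 1)) (be x0 k₁) = Real.pi * I := by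
  have h := d.ctx
  have b := d.base
  have hg := fun n : ℤ => (d.good.zpow n).acc hγ
  have hne : ∀ n i : ℤ, k₁ ≤ i → i ≤ k₂ + 1 → (F ^ n) (γ 1) ≠ shiftPt i x0 := by
    intro n i h1 h2 e
    rcases eq_or_lt_of_le h2 with rfl | h3
    · exact hno n k₂ hk le_rfl (e ▸ accV_base1 h b k₂)
    · exact hno n i h1 (by omega) (e ▸ accV_base0 h b i)
  have np1 : ∀ c j, F (shiftPt c x0) ≠ shiftPt j x0 := fun c j => by
    have := d.NP' (n := 1) one_ne_zero c j
    rwa [pow_one] at this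
  have hdi : ∀ n : ℤ, ¬ Aa (⇑(F ^ n) ∘ γ) (be x0 (k₂ + 1)) = -(Real.pi * I) →
      Aa (⇑(F ^ n) ∘ γ) (be x0 k₁) = Real.pi * I := by
    intro n hn
    rcases side h b (hg n) (hne n k₁ le_rfl (by omega)) with h1 | h1
    · exact h1
    exfalso
    obtain ⟨j, j1, j2, j3, j4⟩ := dIVT (P := fun i => Aa (⇑(F ^ n) ∘ γ) (be x0 i) = -(Real.pi * I))
      (by omega : k₁ ≤ k₂ + 1) h1 hn
    refine hno n j j1 (by omega) (AccV h b (hg n) (hne n j j1 (by omega))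
      (hne n (j + 1) (by omega) (by omega)) j3 ?_)
    exact (side h b (hg n) (hne n (j + 1) (by omega) (by omega))).resolve_right j4
  have hex : ∃ n : ℤ, Aa (⇑(F ^ n) ∘ γ) (be x0 (k₂ + 1)) = -(Real.pi * I) := by
    by_contra hc
    push Not at hc
    obtain ⟨i, hi⟩ := far_right b hγ
    obtain ⟨hi1, hi2⟩ := hi i le_rfl
    have hb := be_acc h b k₁
    have key : ∀ n : ℕ, n ≠ 0 → Aa (⇑(F ^ n) ∘ be x0 k₁) (be x0 i) = -(Real.pi * I) := by
      intro n hn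
      have e1 : (⇑(F ^ n) ∘ be x0 k₁) 1 = (F ^ n) (shiftPt k₁ x0) := by rw [comp_apply, be_one]
      have hz : (F ^ n) (shiftPt k₁ x0) ≠ γ 1 := by
        intro e
        have := hne (-n) k₁ le_rfl (by omega)
        rw [← e, ← mulz, ← zpow_natCast, ← zpow_add] at this
        simp at this
      rcases side h b ((d.good.pow n).acc hb) (i := i) (by rw [e1]; exact d.NP' hn _ _) with h1 | h1
      swap; · exact h1
      exfalso
      have h2 := Tr h b hγ ((d.good.pow n).acc hb) hi2 (by rw [e1]; exact d.NP' hn _ _)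
        (by rw [e1]; exact hz.symm) hi1 h1
      rw [(d.good.pow n).conj h hb hγ (by rw [be_one]; exact hz)] at h2
      have h3 := hdi (-n) (hc _)
      rw [zpow_neg, zpow_natCast] at h3
      rw [anti_iff', h3] at h2
      exact piI_ne h2
    obtain ⟨N, hN⟩ := eventually_atTop.1 (d.H1' hb i)
    exact hN (N + 1) (by omega) (key (N + 1) (by omega))
  obtain ⟨n0, hn0⟩ := hex
  obtain ⟨N, hN⟩ := eventually_atTop.1 (d.H1' hγ (k₂ + 1))
  obtain ⟨n, -, -, n3, n4⟩ := dIVT (P := fun n : ℤ => Aa (⇑(F ^ n) ∘ γ) (be x0 (k₂ + 1)) = -(Real.pi * I))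
    (a := n0) (c := ((max N n0.toNat : ℕ) : ℤ)) (by push_cast; omega) hn0 (by
      rw [zpow_natCast]; exact hN _ (le_max_left _ _))
  have h1 := hdi _ n4
  have hb := be_acc h b (k₂ + 1)
  have h2 : Aa (⇑(F ^ (n + 1)) ∘ γ) (⇑F ∘ be x0 (k₂ + 1)) = -(Real.pi * I) := by
    rw [← n3, ← d.good.aa' h (hg n) hb (by rw [be_one]; exact hne n _ (by omega) le_rfl)]
    congr 1
    funext t; exact zpow_succ_app F n _
  have e1 : (⇑F ∘ be x0 (k₂ + 1)) 1 = F (shiftPt (k₂ + 1) x0) := by rw [comp_apply, be_one]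
  rcases side h b (d.good.acc hb) (i := k₁) (by rw [e1]; exact np1 _ _) with h3 | h3
  · exact h3
  exfalso
  have := Tr h b (d.good.acc hb) (hg (n + 1)) (by rw [e1]; exact np1 _ _)
    (hne (n + 1) k₁ le_rfl (by omega)) (by
      rw [e1, comp_apply, zpow_succ_app]
      intro e
      exact hne n (k₂ + 1) (by omega) le_rfl (F.injective e).symm) h3 h1
  rw [this] at h2
  exact piI_ne h2

/-- Membership in the difference set. -/
lemma mem_Sdiff' {γ γ' δ : UI → Strip} {x y : Strip} (h1 : γ 1 = x) (h1' : γ' 1 = x) (hy : δ 1 = y)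
    (hyX : y ∈ Xt) (h2 : y ≠ x → Aa γ δ = -(Real.pi * I)) (h3 : y ≠ x → Aa γ' δ = Real.pi * I) :
    y ∈ Sdiff Xt γ γ' ∪ {x} := by
  by_cases hyx : y = x
  · exact Or.inr hyx
  left
  refine ⟨hyX, by rw [h1]; exact hyx, fun e => ?_⟩
  have a := h2 hyx
  have b := h3 hyx
  rw [Aa, hy, h1] at a
  rw [Aa, hy, h1', ← e, a] at b
  exact piI_ne b.symm

lemma Dyn.core (d : Dyn U Xt x0 F) {k₁ k₂ : ℤ} {x : Strip} (hx : x ∈ Xt)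
    (hacc₁ : AccFrom (shiftSet k₁ (Vset U x0.2)) x)
    (hacc₂ : AccFrom (shiftSet k₂ (Vset U x0.2)) (F⁻¹ x)) {γ : UI → Strip} (hγ : Acc U Xt γ) :
    ∃ n j : ℤ, k₁ ≤ j ∧ j ≤ k₂ ∧ AccFrom (shiftSet j (Vset U x0.2)) ((F ^ n) (γ 1)) := by
  by_contra hno
  push Not at hno
  have h := d.ctx
  have b := d.base
  have np1 : ∀ c j, F (shiftPt c x0) ≠ shiftPt j x0 := fun c j => by
    have := d.NP' (n := 1) one_ne_zero c j
    rwa [pow_one] at this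
  have dag : Aa (⇑F ∘ be x0 (k₂ + 1)) (be x0 k₁) = Real.pi * I := by
    by_cases hk : k₁ ≤ k₂
    · exact d.dag2 hk hγ hno
    · exact d.dag1' (by omega)
  have e1 : ∀ c, (⇑F ∘ be x0 c) 1 = F (shiftPt c x0) := fun c => by rw [comp_apply, be_one]
  have hFx : F⁻¹ x ∈ Xt := (d.good.inv.inX x).2 hx
  -- the right arc
  have hR : ∃ α, Acc U Xt α ∧ α 1 = x ∧
      (∀ δ, Acc U Xt δ → δ 1 ≠ x → δ 1 ≠ shiftPt k₁ x0 → Aa δ (be x0 k₁) = Real.pi * I →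
        Aa δ α = Real.pi * I) ∧
      (∀ j ≤ k₁, shiftPt j x0 ≠ x → Aa α (be x0 j) = -(Real.pi * I)) := by
    by_cases hc : x = shiftPt k₁ x0
    · refine ⟨be x0 k₁, be_acc h b k₁, by rw [be_one, hc], fun δ _ _ _ hA => hA, fun j hj hne => ?_⟩
      refine be_be' b (lt_of_le_of_ne hj ?_)
      rintro rfl; exact hne hc.symm
    · obtain ⟨α, a1, a2, a3⟩ := accV_right h b hx hacc₁ hc
      refine ⟨α, a1, a2, fun δ hδ n1 n2 hA => ?_, fun j hj hne => ?_⟩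
      · exact Tr h b a1 hδ (by rw [a2]; exact hc) n2 (by rw [a2]; exact n1.symm) a3 hA
      · exact mono_right h b a1 hj (by rw [a2]; exact hne.symm) (by rw [a2]; exact hc) a3
  have hL : ∃ α', Acc U Xt α' ∧ α' 1 = F⁻¹ x ∧
      (∀ δ, Acc U Xt δ → δ 1 ≠ F⁻¹ x → δ 1 ≠ shiftPt (k₂ + 1) x0 →
        Aa δ (be x0 (k₂ + 1)) = -(Real.pi * I) → Aa α' δ = Real.pi * I) ∧
      (shiftPt (k₂ + 1) x0 ≠ F⁻¹ x → Aa α' (be x0 (k₂ + 1)) = Real.pi * I) := by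
    by_cases hc : F⁻¹ x = shiftPt (k₂ + 1) x0
    · refine ⟨be x0 (k₂ + 1), be_acc h b _, by rw [be_one, hc], fun δ _ _ _ hA => anti_iff.1 hA,
        fun hne => absurd hc.symm hne⟩
    · obtain ⟨α, a1, a2, a3⟩ := accV_left h b hFx hacc₂ hc
      refine ⟨α, a1, a2, fun δ hδ n1 n2 hA => ?_, fun _ => a3⟩
      exact Tr h b hδ a1 n2 (by rw [a2]; exact hc) (by rw [a2]; exact n1) hA a3
  obtain ⟨α, a1, a2, a3, a4⟩ := hR
  obtain ⟨α', c1, c2, c3, c4⟩ := hL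
  have c2' : (⇑F ∘ α') 1 = x := by rw [comp_apply, c2, invF]
  have hS := lam_Sdiff h a1 (d.good.acc c1) (by rw [a2, c2'])
  rw [a2] at hS
  have M : ∀ j ≤ k₁, Aa (⇑F ∘ be x0 (k₂ + 1)) (be x0 j) = Real.pi * I →
      shiftPt j x0 ∈ Sdiff Xt α (⇑F ∘ α') ∪ {x} := by
    intro j hj hA
    refine mem_Sdiff' a2 c2' (be_one x0 j) ((h.shiftX _ _).2 b.mem) (a4 j hj) (fun hne => ?_)
    have hbj := be_acc h b j
    rw [d.good.conj h c1 hbj (by rw [c2, invF, be_one]; exact hne.symm)]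
    refine c3 _ (d.good.inv.acc hbj) ?_ ?_ ?_
    · rw [comp_apply, be_one]; exact fun e => hne ((F⁻¹).injective e)
    · rw [comp_apply, be_one]
      intro e
      have := congrArg F e
      rw [invF] at this
      exact np1 _ _ this.symm
    · rw [anti_iff, ← d.good.conj h (be_acc h b _) hbj (by rw [be_one, be_one]; exact np1 _ _)]
      exact hA
  by_cases hk : k₁ ≤ k₂ + 1
  · refine d.trapF hS (m := k₂ + 1 - k₁) (by omega) (M k₁ le_rfl dag) ?_
    rw [← d.good.comm, shift_shift, show k₁ + (k₂ + 1 - k₁) = k₂ + 1 by ring]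
    have hb := be_acc h b (k₂ + 1)
    refine mem_Sdiff' a2 c2' (e1 (k₂ + 1)) ((d.good.inX _).2 ((h.shiftX _ _).2 b.mem)) (fun hne => ?_)
      (fun hne => ?_)
    · rw [anti_iff]
      exact a3 _ (d.good.acc hb) (by rw [e1]; exact hne) (by rw [e1]; exact np1 _ _) dag
    · have n1 : shiftPt (k₂ + 1) x0 ≠ F⁻¹ x := fun e => hne (by rw [e, invF])
      rw [d.good.aa' h c1 hb (by rw [c2, be_one]; exact n1.symm)]
      exact c4 n1
  · refine trapT h hS (M (k₂ + 1) (by omega) (d.dag1' le_rfl)) ?_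
    rw [shift_shift]
    exact M (k₂ + 1 + 1) (by omega) (d.dag1' (by omega))

lemma iterZ_eq (F : Strip ≃ₜ Strip) (n : ℤ) (z : Strip) : iterZ F n z = (F ^ n) z := by
  have hp : ∀ n : ℕ, ∀ z, (F.toEquiv ^ n) z = (F ^ n) z := fun n => by
    induction n with
    | zero => intro z; rfl
    | succ n ih =>
      intro z
      rw [pow_succ, pow_succ, mulz, Equiv.Perm.mul_apply, ih]; rfl
  unfold iterZ
  cases n with
  | ofNat n => rw [Int.ofNat_eq_natCast, zpow_natCast, zpow_natCast, hp]
  | negSucc n =>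
    rw [zpow_negSucc, zpow_negSucc]
    apply (F ^ (n + 1)).injective
    rw [invF, ← hp, show (F.toEquiv ^ (n+1)) ((F.toEquiv ^ (n+1))⁻¹ z) = z from Equiv.apply_symm_apply _ z]

theorem orbit_main
    (f : Ann ≃ₜ Ann) (hf : IsotopicToId ⇑f)
    (F : Strip ≃ₜ Strip) (hF : IsLift ⇑f ⇑F)
    (X Um Up : Set Ann) (hX : IsEAC X Um Up) (hinv : ⇑f '' X = X)
    (φ : Ann → ℝ) (hφc : Continuous φ)
    (hφ : ∀ z : Strip, φ (pr z) = (F z).1 - z.1)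
    (ρ : ℝ) (hρneg : ρ < 0)
    (hrot : PrimeEndRotB 1 (pr ⁻¹' Up) (pr ⁻¹' X) ⇑F ρ)
    (hpos : 0 < sInf (rotMes ⇑f φ X))
    (η : ℝ) (hη : etaSpec (pr ⁻¹' X) η)
    (k₁ k₂ : ℤ) (x : Strip) (hx : x ∈ pr ⁻¹' X)
    (hacc₁ : AccFrom (shiftSet k₁ (Vset (pr ⁻¹' Up) η)) x)
    (hacc₂ : AccFrom (shiftSet k₂ (Vset (pr ⁻¹' Up) η)) (F.symm x)) :
    ∀ z ∈ pr ⁻¹' X, AccFrom (pr ⁻¹' Up) z →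
      ∃ n : ℤ, ∃ j : ℤ, k₁ ≤ j ∧ j ≤ k₂ ∧
        AccFrom (shiftSet j (Vset (pr ⁻¹' Up) η)) (iterZ F n z) := by
  intro z hz hacc
  obtain ⟨⟨x0, hx0, h01, h02⟩, hmax⟩ := hη
  have b : Base (pr ⁻¹' X) x0 := ⟨hx0, h01, fun w hw hw1 => by
    rw [h02]; exact hmax ⟨w, hw, hw1, rfl⟩⟩
  subst h02
  have hinvX : ∀ p, f p ∈ X ↔ p ∈ X := fun p => by
    constructor
    · intro h
      rw [← hinv] at h
      obtain ⟨q, hq, e⟩ := h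
      rwa [← f.injective e]
    · intro h
      rw [← hinv]; exact ⟨p, h, rfl⟩
  have d : Dyn (pr ⁻¹' Up) (pr ⁻¹' X) x0 F :=
    ⟨OAB.IsEAC.ctx hX, b, mk_good hf hF hX hinv,
      fun w hw C => mes_fwd hF hφc hφ hX.compact.isClosed (fun p hp => (hinvX p).2 hp) hpos hw C,
      fun w hw C => mes_bwd hF hφc hφ hX.compact.isClosed hinvX hpos hw C, ρ, hρneg, hrot⟩
  obtain ⟨σ, hσ⟩ := hacc
  obtain ⟨γ, hγ, rfl⟩ := acc_of_arc d.ctx hz hσ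
  obtain ⟨n, j, h1, h2, h3⟩ := d.core hx hacc₁ hacc₂ hγ
  exact ⟨n, j, h1, h2, by rw [iterZ_eq]; exact h3⟩

end OAB

/-- Lemma on prime ends, item 3: if `x` is accessible from `V + k₁` and
`f̃⁻¹(x)` from `V + k₂`, then the orbit of every accessible point `z` of `X̃` meets the
accessibility range of some `V + j` with `k₁ ≤ j ≤ k₂`. -/
theorem orbit_accessible_between
    (f : Ann ≃ₜ Ann) (hf : IsotopicToId ⇑f)
    (F : Strip ≃ₜ Strip) (hF : IsLift ⇑f ⇑F)
    (X Um Up : Set Ann) (hX : IsEAC X Um Up) (hinv : ⇑f '' X = X)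
    (φ : Ann → ℝ) (hφc : Continuous φ)
    (hφ : ∀ z : Strip, φ (pr z) = (F z).1 - z.1)
    (ρ : ℝ) (hρneg : ρ < 0)
    (hrot : PrimeEndRotB 1 (pr ⁻¹' Up) (pr ⁻¹' X) ⇑F ρ)
    (hpos : 0 < sInf (rotMes ⇑f φ X))
    (η : ℝ) (hη : etaSpec (pr ⁻¹' X) η)
    (k₁ k₂ : ℤ) (x : Strip) (hx : x ∈ pr ⁻¹' X)
    (hacc₁ : AccFrom (shiftSet k₁ (Vset (pr ⁻¹' Up) η)) x)
    (hacc₂ : AccFrom (shiftSet k₂ (Vset (pr ⁻¹' Up) η)) (F.symm x)) :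
    ∀ z ∈ pr ⁻¹' X, AccFrom (pr ⁻¹' Up) z →
      ∃ n : ℤ, ∃ j : ℤ, k₁ ≤ j ∧ j ≤ k₂ ∧
        AccFrom (shiftSet j (Vset (pr ⁻¹' Up) η)) (iterZ F n z) := by
  exact OAB.orbit_main f hf F hF X Um Up hX hinv φ hφc hφ ρ hρneg hrot hpos η hη k₁ k₂ x hx hacc₁ hacc₂
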